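/- arXiv:2306.08811 — 5 statements merged into one kernel-verified Lean document; each statement's English description precedes it below -/
import Mathlib

section
/- Lawrence–Varchenko polar decomposition: For every polarizing vector ξ for P and every x ∈ V*, the characteristic function of P satisfies 1_P(x) = Σ_{p ∈ Vert(P)} (−1)^{|E_p^+(ξ)|} 1_{C_p^#(ξ)}(x). -/
open Module

/-- The vertices of a full-dimensional simple polytope, each with a basis of edge vectors whose
cone contains the polytope from that vertex. -/
structure SimpleVertexFigure (ι E : Type*) [AddCommGroup E] [Module ℝ E] (n : ℕ) where
  vertex : ι → E
  edge : ι → Basis (Fin n) ℝ E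
  vertex_injective : Function.Injective vertex
  coord_nonneg : ∀ p q i, 0 ≤ (edge p).coord i (vertex q - vertex p)
  edge_mem : ∀ p i, ∃ ε : ℝ, 0 < ε ∧
    vertex p + ε • edge p i ∈ convexHull ℝ (Set.range vertex)

namespace SimpleVertexFigure

variable {ι E : Type*} [AddCommGroup E] [Module ℝ E] {n : ℕ}

/-- The half-space bounded by the facet opposite to the `i`-th edge at `p`. -/
def halfspace (F : SimpleVertexFigure ι E n) (p : ι) (i : Fin n) : Set E :=
  {y | 0 ≤ (F.edge p).coord i (y - F.vertex p)}

lemma mem_halfspace (F : SimpleVertexFigure ι E n) {p : ι} {i : Fin n} {y : E} :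
    y ∈ F.halfspace p i ↔ 0 ≤ (F.edge p).coord i (y - F.vertex p) := Iff.rfl

lemma convex_halfspace (F : SimpleVertexFigure ι E n) (p : ι) (i : Fin n) :
    Convex ℝ (F.halfspace p i) := by
  have h : F.halfspace p i =
      {y | (F.edge p).coord i (F.vertex p) ≤ (F.edge p).coord i y} := by
    ext y
    rw [mem_halfspace, map_sub, sub_nonneg, Set.mem_ofPred_eq]
  rw [h]
  exact convex_halfSpace_ge ((F.edge p).coord i).isLinear _

lemma convexHull_subset_halfspace (F : SimpleVertexFigure ι E n) (p : ι) (i : Fin n) :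
    convexHull ℝ (Set.range F.vertex) ⊆ F.halfspace p i := by
  refine convexHull_min ?_ (F.convex_halfspace p i)
  rintro _ ⟨q, rfl⟩
  exact F.coord_nonneg p q i

lemma coord_edge_nonneg (F : SimpleVertexFigure ι E n) {p q : ι} {i : Fin n}
    (h : (F.edge p).coord i (F.vertex q - F.vertex p) = 0) (j : Fin n) :
    0 ≤ (F.edge p).coord i (F.edge q j) := by
  obtain ⟨ε, hε, hmem⟩ := F.edge_mem q j
  have hy := F.convexHull_subset_halfspace p i hmem
  rw [mem_halfspace, add_sub_right_comm, map_add, h, zero_add, map_smul, smul_eq_mul] at hy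
  exact nonneg_of_mul_nonneg_right hy hε

lemma halfspace_injective (F : SimpleVertexFigure ι E n) (p : ι) :
    Function.Injective (F.halfspace p) := by
  intro i k hik
  by_contra hne
  have hk : F.vertex p - F.edge p i ∈ F.halfspace p k := by
    simp [mem_halfspace, hne]
  rw [← hik, mem_halfspace] at hk
  simp at hk
  linarith

/-- Equal half-spaces have equal boundary hyperplanes. -/
lemma coord_eq_zero_of_halfspace_eq (F : SimpleVertexFigure ι E n) {p q : ι} {i j : Fin n}
    (h : F.halfspace q j = F.halfspace p i) :
    (F.edge p).coord i (F.vertex q - F.vertex p) = 0 := by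
  by_contra hne
  have hpos : 0 < (F.edge p).coord i (F.vertex q - F.vertex p) :=
    lt_of_le_of_ne (F.coord_nonneg p q i) (Ne.symm hne)
  set a := (F.edge p).coord i (F.vertex q - F.vertex p) with ha
  set c := (F.edge p).coord i (F.edge q j) with hc
  have ht : 0 < a / (|c| + 1) := by positivity
  have hmem : F.vertex q - (a / (|c| + 1)) • F.edge q j ∈ F.halfspace p i := by
    rw [mem_halfspace, sub_right_comm, map_sub, map_smul, ← ha, ← hc, smul_eq_mul]
    have h1 : a / (|c| + 1) * (|c| + 1) = a := by field_simp
    nlinarith [le_abs_self c]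
  rw [← h, mem_halfspace] at hmem
  simp at hmem
  linarith

/-- A facet hyperplane at `p` that passes through the vertex `q` bounds a facet at `q`. -/
lemma exists_halfspace_eq (F : SimpleVertexFigure ι E n) {p q : ι} {i : Fin n}
    (h : (F.edge p).coord i (F.vertex q - F.vertex p) = 0) :
    ∃ j, F.halfspace q j = F.halfspace p i := by
  have hnonneg := F.coord_edge_nonneg h
  obtain ⟨j, hj⟩ : ∃ j, (F.edge p).coord i (F.edge q j) ≠ 0 := by
    by_contra! hall
    have h0 : (F.edge p).coord i = 0 := (F.edge q).ext fun j => by simpa using hall j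
    have h1 : (F.edge p).coord i (F.edge p i) = 1 := by simp
    rw [h0] at h1
    simp at h1
  have hjpos : 0 < (F.edge p).coord i (F.edge q j) := lt_of_le_of_ne (hnonneg j) (Ne.symm hj)
  have hface : ∀ y ∈ convexHull ℝ (Set.range F.vertex),
      (F.edge p).coord i (y - F.vertex p) = 0 → (F.edge q).coord j (y - F.vertex q) = 0 := by
    intro y hy hy0
    have hyq : (F.edge p).coord i (y - F.vertex q) = 0 := by
      rw [← sub_sub_sub_cancel_right y (F.vertex q) (F.vertex p), map_sub, hy0, h, sub_zero]
    rw [← (F.edge q).sum_repr (y - F.vertex q), map_sum] at hyq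
    have hterm := (Finset.sum_eq_zero_iff_of_nonneg (fun l _ => by
      rw [map_smul, smul_eq_mul]
      exact mul_nonneg (F.convexHull_subset_halfspace q l hy) (hnonneg l))).1 hyq j
      (Finset.mem_univ j)
    rw [map_smul, smul_eq_mul] at hterm
    exact (mul_eq_zero.1 hterm).resolve_right hj
  have hp0 := hface _ (subset_convexHull ℝ _ ⟨p, rfl⟩) (by simp)
  have hker : ∀ k, k ≠ i → (F.edge q).coord j (F.edge p k) = 0 := by
    intro k hk
    obtain ⟨ε, hε, hmem⟩ := F.edge_mem p k
    have h1 := hface _ hmem (by simp [hk])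
    rw [add_sub_right_comm, map_add, hp0, zero_add, map_smul, smul_eq_mul] at h1
    exact (mul_eq_zero.1 h1).resolve_left hε.ne'
  have hprop : (F.edge q).coord j =
      (F.edge q).coord j (F.edge p i) • (F.edge p).coord i := by
    refine (F.edge p).ext fun k => ?_
    by_cases hk : k = i
    · subst hk; simp
    · rw [hker k hk]; simp [hk]
  set r := (F.edge q).coord j (F.edge p i) with hr
  have hrpos : 0 < r := by
    have h1 : (F.edge q).coord j (F.edge q j) = 1 := by simp
    rw [hprop, LinearMap.smul_apply, smul_eq_mul] at h1
    exact pos_of_mul_pos_left (h1 ▸ one_pos) hjpos.le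
  refine ⟨j, ?_⟩
  ext y
  rw [mem_halfspace, mem_halfspace, hprop, LinearMap.smul_apply, smul_eq_mul,
    mul_nonneg_iff_of_pos_left hrpos,
    ← sub_sub_sub_cancel_right y (F.vertex q) (F.vertex p), map_sub, h, sub_zero]

open Classical in
/-- The half-spaces bounded by the facets through a vertex. -/
noncomputable def facets (F : SimpleVertexFigure ι E n) (p : ι) : Finset (Set E) :=
  Finset.univ.image (F.halfspace p)

open Classical in
/-- The half-spaces at a vertex whose opposite edge increases `ξ`. -/
noncomputable def upFacets (F : SimpleVertexFigure ι E n) (ξ : Module.Dual ℝ E) (p : ι) :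
    Finset (Set E) :=
  (Finset.univ.filter fun i => 0 < ξ (F.edge p i)).image (F.halfspace p)

lemma mem_facets (F : SimpleVertexFigure ι E n) {p : ι} {H : Set E} :
    H ∈ F.facets p ↔ ∃ i, F.halfspace p i = H := by
  simp [facets]

lemma halfspace_mem_upFacets (F : SimpleVertexFigure ι E n) {ξ : Module.Dual ℝ E} {p : ι}
    {i : Fin n} : F.halfspace p i ∈ F.upFacets ξ p ↔ 0 < ξ (F.edge p i) := by
  simp [upFacets, (F.halfspace_injective p).eq_iff]

lemma upFacets_subset_iff (F : SimpleVertexFigure ι E n) {ξ : Module.Dual ℝ E} {p : ι}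
    {S : Finset (Set E)} :
    F.upFacets ξ p ⊆ S ↔ ∀ i, 0 < ξ (F.edge p i) → F.halfspace p i ∈ S := by
  simp [upFacets, Finset.image_subset_iff]

lemma upFacets_subset_facets (F : SimpleVertexFigure ι E n) (ξ : Module.Dual ℝ E) (p : ι) :
    F.upFacets ξ p ⊆ F.facets p :=
  F.upFacets_subset_iff.2 fun i _ => F.mem_facets.2 ⟨i, rfl⟩

lemma card_upFacets (F : SimpleVertexFigure ι E n) (ξ : Module.Dual ℝ E) (p : ι) :
    (F.upFacets ξ p).card = Nat.card {i : Fin n // 0 < ξ (F.edge p i)} := by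
  classical
  rw [upFacets, Finset.card_image_of_injective _ (F.halfspace_injective p),
    Nat.card_eq_fintype_card, Fintype.card_subtype]

/-- A vertex whose increasing edges leave the face cut out by `S` is the strict maximum of `ξ`
on the vertices of that face. -/
lemma lt_of_upFacets_subset (F : SimpleVertexFigure ι E n) {ξ : Module.Dual ℝ E}
    (hξ : ∀ p i, ξ (F.edge p i) ≠ 0) {S : Finset (Set E)} {p q : ι} (hpq : q ≠ p)
    (hup : F.upFacets ξ p ⊆ S) (hq : S ⊆ F.facets q) :
    ξ (F.vertex q) < ξ (F.vertex p) := by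
  have hterm : ∀ i, (F.edge p).repr (F.vertex q - F.vertex p) i • ξ (F.edge p i) ≤ 0 ∧
      ((F.edge p).repr (F.vertex q - F.vertex p) i • ξ (F.edge p i) = 0 →
        (F.edge p).repr (F.vertex q - F.vertex p) i = 0) := by
    intro i
    rcases lt_or_gt_of_ne (hξ p i) with hi | hi
    · exact ⟨mul_nonpos_of_nonneg_of_nonpos (F.coord_nonneg p q i) hi.le,
        fun h0 => (mul_eq_zero.1 h0).resolve_right hi.ne⟩
    · obtain ⟨j, hj⟩ := F.mem_facets.1 (hq (F.upFacets_subset_iff.1 hup i hi))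
      have h0 := F.coord_eq_zero_of_halfspace_eq hj
      rw [Basis.coord_apply] at h0
      exact ⟨by rw [h0, zero_smul], fun _ => h0⟩
  have hsum : ξ (F.vertex q - F.vertex p) =
      ∑ i, (F.edge p).repr (F.vertex q - F.vertex p) i • ξ (F.edge p i) := by
    conv_lhs => rw [← (F.edge p).sum_repr (F.vertex q - F.vertex p), map_sum]
    simp
  have hle : ξ (F.vertex q - F.vertex p) ≤ 0 :=
    hsum ▸ Finset.sum_nonpos fun i _ => (hterm i).1
  have hne : ξ (F.vertex q - F.vertex p) ≠ 0 := by
    intro h0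
    rw [hsum, Finset.sum_eq_zero_iff_of_nonpos fun i _ => (hterm i).1] at h0
    refine hpq (F.vertex_injective (sub_eq_zero.1 ((F.edge p).ext_elem fun i => ?_)))
    simpa using (hterm i).2 (h0 i (Finset.mem_univ i))
  have hlt := lt_of_le_of_ne hle hne
  rw [map_sub] at hlt
  linarith

/-- An edge in the face cut out by `S` along which `ξ` increases leads to a higher vertex of
that face. -/
lemma exists_vertex_gt (F : SimpleVertexFigure ι E n) [Finite ι] {ξ : Module.Dual ℝ E}
    {S : Finset (Set E)} {p : ι} (hp : S ⊆ F.facets p) {i : Fin n}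
    (hi : 0 < ξ (F.edge p i)) (hiS : F.halfspace p i ∉ S) :
    ∃ q, S ⊆ F.facets q ∧ ξ (F.vertex p) < ξ (F.vertex q) := by
  classical
  have := Fintype.ofFinite ι
  obtain ⟨ε, hε, hmem⟩ := F.edge_mem p i
  rw [← Set.image_univ, ← Finset.coe_univ, ← Finset.coe_image, Finset.mem_convexHull'] at hmem
  obtain ⟨w, hw0, hw1, hwy⟩ := hmem
  have hlin : ∀ f : Module.Dual ℝ E,
      ∑ u ∈ Finset.univ.image F.vertex, w u * f (u - F.vertex p) = ε * f (F.edge p i) := by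
    intro f
    have h1 : ∑ u ∈ Finset.univ.image F.vertex, w u • (u - F.vertex p) = ε • F.edge p i := by
      simp_rw [smul_sub, Finset.sum_sub_distrib, ← Finset.sum_smul, hw1, hwy]
      simp
    simpa using congrArg f h1
  obtain ⟨u, hu, hupos⟩ : ∃ u ∈ Finset.univ.image F.vertex, 0 < w u * ξ (u - F.vertex p) := by
    by_contra! hall
    have h1 := Finset.sum_nonpos hall
    rw [hlin] at h1
    exact absurd h1 (not_le.2 (mul_pos hε hi))
  have hwu : 0 < w u := lt_of_le_of_ne (hw0 u hu) fun h0 => by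
    rw [← h0, zero_mul] at hupos
    exact lt_irrefl _ hupos
  obtain ⟨q, -, rfl⟩ := Finset.mem_image.1 hu
  refine ⟨q, fun H hH => ?_, ?_⟩
  · obtain ⟨k, rfl⟩ := F.mem_facets.1 (hp hH)
    have hki : i ≠ k := by
      rintro rfl
      exact hiS hH
    have h0 := hlin ((F.edge p).coord k)
    have hz : (F.edge p).coord k (F.edge p i) = 0 := by simp [hki]
    rw [hz, mul_zero, Finset.sum_eq_zero_iff_of_nonneg] at h0
    · exact F.mem_facets.2 (F.exists_halfspace_eq
        ((mul_eq_zero.1 (h0 _ hu)).resolve_left hwu.ne'))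
    · intro u' hu'
      obtain ⟨q', -, rfl⟩ := Finset.mem_image.1 hu'
      exact mul_nonneg (hw0 _ hu') (F.coord_nonneg p q' k)
  · have h1 := pos_of_mul_pos_right hupos hwu.le
    rw [map_sub] at h1
    linarith

open Classical in
/-- Each nonempty face has exactly one vertex maximizing `ξ`. -/
lemma card_maximizers (F : SimpleVertexFigure ι E n) [Fintype ι] {ξ : Module.Dual ℝ E}
    (hξ : ∀ p i, ξ (F.edge p i) ≠ 0) (S : Finset (Set E)) :
    (Finset.univ.filter fun p => F.upFacets ξ p ⊆ S ∧ S ⊆ F.facets p).card =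
      if ∃ p, S ⊆ F.facets p then 1 else 0 := by
  split_ifs with hS
  · obtain ⟨p₀, hp₀⟩ := hS
    obtain ⟨p, hp, hmax⟩ := Finset.exists_max_image (Finset.univ.filter fun p => S ⊆ F.facets p)
      (fun p => ξ (F.vertex p)) ⟨p₀, by simpa using hp₀⟩
    have hp' : S ⊆ F.facets p := by simpa using hp
    have hup : F.upFacets ξ p ⊆ S := by
      refine F.upFacets_subset_iff.2 fun i hi => ?_
      by_contra hiS
      obtain ⟨q, hq, hlt⟩ := F.exists_vertex_gt hp' hi hiS
      exact absurd (hmax q (by simpa using hq)) (not_le.2 hlt)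
    refine Finset.card_eq_one.2 ⟨p, ?_⟩
    ext q
    simp only [Finset.mem_filter, Finset.mem_univ, true_and, Finset.mem_singleton]
    refine ⟨fun hq => ?_, fun hq => hq ▸ ⟨hup, hp'⟩⟩
    by_contra hne
    exact lt_asymm (F.lt_of_upFacets_subset hξ hne hup hq.2)
      (F.lt_of_upFacets_subset hξ (Ne.symm hne) hq.1 hp')
  · exact Finset.card_eq_zero.2 (Finset.filter_eq_empty_iff.2 fun p _ hp => hS ⟨p, hp.2⟩)

lemma sum_powerset_superset_neg_one_pow_card {α : Type*} [DecidableEq α] (s t : Finset α)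
    [DecidablePred (s ⊆ ·)] :
    ∑ u ∈ t.powerset with s ⊆ u, (-1 : ℝ) ^ u.card = if s = t then (-1) ^ s.card else 0 := by
  by_cases hst : s ⊆ t
  · have h1 : t.powerset.filter (fun u => s ⊆ u) = (t \ s).powerset.image (s ∪ ·) := by
      rw [← Finset.Icc_eq_image_powerset hst]
      ext u
      simp [and_comm]
    have hdisj : ∀ u ∈ (t \ s).powerset, Disjoint s u := fun u hu =>
      Finset.disjoint_of_subset_right (Finset.mem_powerset.1 hu) Finset.disjoint_sdiff
    rw [h1, Finset.sum_image]
    · have h2 : ∀ u ∈ (t \ s).powerset,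
          (-1 : ℝ) ^ (s ∪ u).card = (-1) ^ s.card * (-1) ^ u.card := fun u hu => by
        rw [Finset.card_union_of_disjoint (hdisj u hu), pow_add]
      have h3 : ∑ u ∈ (t \ s).powerset, (-1 : ℝ) ^ u.card = if t \ s = ∅ then 1 else 0 := by
        exact_mod_cast Finset.sum_powerset_neg_one_pow_card (x := t \ s)
      have h4 : t \ s = ∅ ↔ s = t := by
        rw [Finset.sdiff_eq_empty_iff_subset]
        exact ⟨fun h => hst.antisymm h, fun h => h.ge⟩
      rw [Finset.sum_congr rfl h2, ← Finset.mul_sum, h3]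
      simp only [h4, mul_ite, mul_one, mul_zero]
    · intro u hu u' hu' h
      have h' : s ∪ u = s ∪ u' := h
      rw [← Finset.union_sdiff_cancel_left (hdisj u hu), h',
        Finset.union_sdiff_cancel_left (hdisj u' hu')]
  · rw [Finset.filter_eq_empty_iff.2, Finset.sum_empty, if_neg fun h => hst h.le]
    exact fun u hu hsu => hst (hsu.trans (Finset.mem_powerset.1 hu))

open Classical in
/-- The alternating sum over the vertices whose polarized tangent cone contains `x`. -/
noncomputable def polarSum (F : SimpleVertexFigure ι E n) [Fintype ι] (ξ : Module.Dual ℝ E)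
    (x : E) : ℝ :=
  ∑ p, if ∀ i, 0 < ξ (F.edge p i) ↔ x ∉ F.halfspace p i
    then (-1) ^ Nat.card {i : Fin n // 0 < ξ (F.edge p i)} else 0

open Classical in
/-- The facet half-spaces that do not contain `x`. -/
noncomputable def violated (F : SimpleVertexFigure ι E n) [Fintype ι] (x : E) :
    Finset (Set E) :=
  (Finset.univ.biUnion F.facets).filter (x ∉ ·)

open Classical in
/-- The Euler characteristic of the nerve of the facets visible from `x`, with opposite sign
and augmented. -/
noncomputable def nerveSum (F : SimpleVertexFigure ι E n) [Fintype ι] (x : E) : ℝ :=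
  ∑ S ∈ (F.violated x).powerset, (-1) ^ S.card * if ∃ p, S ⊆ F.facets p then 1 else 0

lemma polarSum_eq_nerveSum (F : SimpleVertexFigure ι E n) [Fintype ι] {ξ : Module.Dual ℝ E}
    (hξ : ∀ p i, ξ (F.edge p i) ≠ 0) (x : E) : F.polarSum ξ x = F.nerveSum x := by
  classical
  have hcard : ∀ S : Finset (Set E), (if ∃ p, S ⊆ F.facets p then (1 : ℝ) else 0) =
      ∑ p, if F.upFacets ξ p ⊆ S ∧ S ⊆ F.facets p then 1 else 0 := by
    intro S
    rw [Finset.sum_boole, F.card_maximizers hξ S]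
    push_cast
    rfl
  simp_rw [nerveSum, hcard, Finset.mul_sum]
  rw [Finset.sum_comm, polarSum]
  refine Finset.sum_congr rfl fun p _ => ?_
  simp_rw [mul_ite, mul_one, mul_zero]
  rw [← Finset.sum_filter]
  have h1 : (F.violated x).powerset.filter (fun S => F.upFacets ξ p ⊆ S ∧ S ⊆ F.facets p) =
      (F.facets p ∩ F.violated x).powerset.filter (fun S => F.upFacets ξ p ⊆ S) := by
    ext S
    simp only [Finset.mem_filter, Finset.mem_powerset, Finset.subset_inter_iff]
    tauto
  rw [h1, sum_powerset_superset_neg_one_pow_card, F.card_upFacets]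
  refine if_congr ?_ rfl rfl
  have hmem : ∀ i, F.halfspace p i ∈ F.facets p ∩ F.violated x ↔ x ∉ F.halfspace p i := by
    intro i
    simp only [Finset.mem_inter, violated, Finset.mem_filter, Finset.mem_biUnion]
    exact ⟨fun h => h.2.2, fun h => ⟨F.mem_facets.2 ⟨i, rfl⟩,
      ⟨p, Finset.mem_univ p, F.mem_facets.2 ⟨i, rfl⟩⟩, h⟩⟩
  refine ⟨fun h => ?_, fun h i => ?_⟩
  · ext H
    constructor
    · intro hH
      obtain ⟨i, rfl⟩ := F.mem_facets.1 (F.upFacets_subset_facets ξ p hH)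
      exact (hmem i).2 ((h i).1 (F.halfspace_mem_upFacets.1 hH))
    · intro hH
      obtain ⟨i, rfl⟩ := F.mem_facets.1 (Finset.mem_inter.1 hH).1
      exact F.halfspace_mem_upFacets.2 ((h i).2 ((hmem i).1 hH))
  · rw [← hmem, ← h, F.halfspace_mem_upFacets]

lemma nerveSum_eq_one (F : SimpleVertexFigure ι E n) [Fintype ι] {x : E}
    (hx : x ∈ convexHull ℝ (Set.range F.vertex)) : F.nerveSum x = 1 := by
  classical
  have h0 : F.violated x = ∅ := by
    refine Finset.filter_eq_empty_iff.2 fun H hH => ?_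
    obtain ⟨p, -, hp⟩ := Finset.mem_biUnion.1 hH
    obtain ⟨i, rfl⟩ := F.mem_facets.1 hp
    exact not_not.2 (F.convexHull_subset_halfspace p i hx)
  obtain ⟨_, p, rfl⟩ := convexHull_nonempty_iff.1 ⟨x, hx⟩
  simp [nerveSum, h0, Nonempty.intro p]

lemma polarSum_eq_zero (F : SimpleVertexFigure ι E n) [Fintype ι] {ξ : Module.Dual ℝ E} {x : E}
    (hx : ∀ p, ξ (F.vertex p) < ξ x) : F.polarSum ξ x = 0 := by
  classical
  refine Finset.sum_eq_zero fun p _ => if_neg fun h => ?_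
  have hsum : ξ (x - F.vertex p) =
      ∑ i, (F.edge p).repr (x - F.vertex p) i • ξ (F.edge p i) := by
    conv_lhs => rw [← (F.edge p).sum_repr (x - F.vertex p), map_sum]
    simp
  have hle : ξ (x - F.vertex p) ≤ 0 := by
    rw [hsum]
    refine Finset.sum_nonpos fun i _ => ?_
    have hi := h i
    rw [mem_halfspace, Basis.coord_apply, not_le] at hi
    by_cases hpos : 0 < ξ (F.edge p i)
    · exact mul_nonpos_of_nonpos_of_nonneg (hi.1 hpos).le hpos.le
    · exact mul_nonpos_of_nonneg_of_nonpos (not_lt.1 fun hc => hpos (hi.2 hc)) (not_lt.1 hpos)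
  rw [map_sub] at hle
  linarith [hx p]

/-- A functional strictly separating `x` from the vertices can be made polarizing. -/
lemma exists_polarizing_separating (F : SimpleVertexFigure ι E n) [Finite ι]
    {f : Module.Dual ℝ E} {x : E} (hf : ∀ p, f (F.vertex p) < f x) :
    ∃ ξ : Module.Dual ℝ E, (∀ p i, ξ (F.edge p i) ≠ 0) ∧ ∀ p, ξ (F.vertex p) < ξ x := by
  obtain ⟨g, hg⟩ := Module.exists_dual_forall_apply_ne_zero (K := ℝ)
    (fun a : ι × Fin n => F.edge a.1 a.2) fun a => (F.edge a.1).ne_zero a.2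
  have hcont : ∀ y : E, Filter.Tendsto (fun ε : ℝ => f y + ε * g y)
      (nhdsWithin 0 {0}ᶜ) (nhds (f y)) := by
    intro y
    have h1 : Continuous fun ε : ℝ => f y + ε * g y := by fun_prop
    simpa using (h1.tendsto 0).mono_left nhdsWithin_le_nhds
  have hpol : ∀ᶠ ε : ℝ in nhdsWithin 0 {0}ᶜ,
      ∀ a : ι × Fin n, f (F.edge a.1 a.2) + ε * g (F.edge a.1 a.2) ≠ 0 := by
    refine Filter.eventually_all.2 fun a => ?_
    by_cases h0 : f (F.edge a.1 a.2) = 0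
    · filter_upwards [self_mem_nhdsWithin] with ε hε
      rw [h0, zero_add]
      exact mul_ne_zero hε (hg a)
    · exact (hcont _).eventually_ne h0
  have hsep : ∀ᶠ ε : ℝ in nhdsWithin 0 {0}ᶜ,
      ∀ p, f (F.vertex p) + ε * g (F.vertex p) < f x + ε * g x :=
    Filter.eventually_all.2 fun p => (hcont _).eventually_lt (hcont _) (hf p)
  obtain ⟨ε, h1, h2⟩ := (hpol.and hsep).exists
  exact ⟨f + ε • g, fun p i => by simpa using h1 (p, i), fun p => by simpa using h2 p⟩

end SimpleVertexFigure

lemma SimpleVertexFigure.polarSum_eq_indicator {ι E : Type*} [NormedAddCommGroup E]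
    [NormedSpace ℝ E] {n : ℕ} [Fintype ι] (F : SimpleVertexFigure ι E n) {ξ : Module.Dual ℝ E}
    (hξ : ∀ p i, ξ (F.edge p i) ≠ 0) (x : E) :
    F.polarSum ξ x = Set.indicator (convexHull ℝ (Set.range F.vertex)) (fun _ => (1 : ℝ)) x := by
  rw [F.polarSum_eq_nerveSum hξ]
  by_cases hx : x ∈ convexHull ℝ (Set.range F.vertex)
  · rw [Set.indicator_of_mem hx, F.nerveSum_eq_one hx]
  · rw [Set.indicator_of_notMem hx]
    obtain ⟨f, u, hfu, hux⟩ := geometric_hahn_banach_closed_point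
      (convex_convexHull ℝ (Set.range F.vertex))
      ((Set.finite_range F.vertex).isCompact_convexHull ℝ).isClosed hx
    obtain ⟨η, hη, hsep⟩ := F.exists_polarizing_separating (f := f.toLinearMap) (x := x)
      fun p => (hfu _ (subset_convexHull ℝ _ ⟨p, rfl⟩)).trans hux
    rw [← F.polarSum_eq_nerveSum hη, F.polarSum_eq_zero hsep]

/-- **Lawrence–Varchenko polar decomposition.**
`E` plays the role of the dual space `V*` of an `n`-dimensional real vector
space `V`; a vector `ξ ∈ V` is represented by the corresponding linear
functional `ξ : Module.Dual ℝ E` (using `V ≅ V**`), so that the pairing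
`⟨w, ξ⟩` becomes `ξ w`.  `P ⊆ E` is a simple convex polytope with vertex set
`Vert` and edge vectors `w p 0, …, w p (n-1)` at each vertex `p`, `ξ` is a
polarizing vector, and the conclusion is the identity
`1_P(x) = Σ_{p ∈ Vert} (−1)^{|E_p^+(ξ)|} 1_{C_p^#(ξ)}(x)`. -/
theorem lawrence_varchenko_polar_decomposition
    {E : Type*} [NormedAddCommGroup E] [NormedSpace ℝ E] [FiniteDimensional ℝ E]
    {n : ℕ} (hdim : finrank ℝ E = n)
    (P : Set E) (Vert : Finset E) (w : E → Fin n → E)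
    (hPcompact : IsCompact P)
    (hPhull : P = convexHull ℝ (Vert : Set E))
    (hindep : ∀ p ∈ Vert, LinearIndependent ℝ (w p))
    (hspan : ∀ p ∈ Vert, Submodule.span ℝ (Set.range (w p)) = ⊤)
    (htangent : ∀ p ∈ Vert,
      {y : E | ∃ r : ℝ, 0 ≤ r ∧ ∃ x ∈ P, y = p + r • (x - p)} =
        {y : E | ∃ c : Fin n → ℝ, (∀ i, 0 ≤ c i) ∧ y = p + ∑ i, c i • w p i})
    (ξ : Module.Dual ℝ E)
    (hpol : ∀ p ∈ Vert, ∀ i, ξ (w p i) ≠ 0)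
    (x : E) :
    Set.indicator P (fun _ => (1 : ℝ)) x =
      ∑ p ∈ Vert,
        (-1 : ℝ) ^ Nat.card {i : Fin n // 0 < ξ (w p i)} *
          Set.indicator
            {y : E | ∃ c : Fin n → ℝ,
              (∀ i, 0 < ξ (w p i) → c i < 0) ∧
              (∀ i, ξ (w p i) < 0 → 0 ≤ c i) ∧
              y = p + ∑ i, c i • w p i}
            (fun _ => (1 : ℝ)) x := by
  classical
  have hcone : ∀ p ∈ Vert, ∀ q ∈ P, ∃ c : Fin n → ℝ,
      (∀ i, 0 ≤ c i) ∧ q = p + ∑ i, c i • w p i := by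
    intro p hp q hq
    have hmem : q ∈ {y : E | ∃ r : ℝ, 0 ≤ r ∧ ∃ x ∈ P, y = p + r • (x - p)} :=
      ⟨1, zero_le_one, q, hq, by simp⟩
    rw [htangent p hp] at hmem
    exact hmem
  let b : Vert → Basis (Fin n) ℝ E := fun p => Basis.mk (hindep p p.2) (hspan p p.2).ge
  have hb : ∀ (p : Vert) i, b p i = w p i := fun p i => by simp [b]
  have hcoord : ∀ (p : Vert) (c : Fin n → ℝ) i,
      (b p).coord i ((p : E) + ∑ k, c k • w p k - p) = c i := by
    intro p c i
    simp_rw [add_sub_cancel_left, ← hb, Basis.coord_apply, (b p).repr_sum_self]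
  have hrange : Set.range ((↑) : Vert → E) = (Vert : Set E) := by simp
  let F : SimpleVertexFigure Vert E n :=
    { vertex := (↑)
      edge := b
      vertex_injective := Subtype.val_injective
      coord_nonneg := fun p q i => by
        obtain ⟨c, hc, hq⟩ := hcone p p.2 q (hPhull ▸ subset_convexHull ℝ _ q.2)
        rw [hq, hcoord]
        exact hc i
      edge_mem := fun p i => by
        have hmem : (p : E) + w p i ∈ {y : E | ∃ c : Fin n → ℝ,
            (∀ i, 0 ≤ c i) ∧ y = p + ∑ i, c i • w p i} :=
          ⟨Pi.single i 1, fun k => by by_cases h : k = i <;> simp [h],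
            by simp [Pi.single_apply, ite_smul]⟩
        rw [← htangent p p.2] at hmem
        obtain ⟨r, hr, y, hy, heq⟩ := hmem
        have heq' : w p i = r • (y - p) := add_left_cancel heq
        have hr0 : r ≠ 0 := by
          rintro rfl
          rw [zero_smul] at heq'
          exact (hindep p p.2).ne_zero i heq'
        refine ⟨r⁻¹, inv_pos.2 (lt_of_le_of_ne hr (Ne.symm hr0)), ?_⟩
        rw [hb, heq', smul_smul, inv_mul_cancel₀ hr0, one_smul, add_sub_cancel, hrange, ← hPhull]
        exact hy }
  have hξ : ∀ p i, ξ (F.edge p i) ≠ 0 := fun p i => by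
    change ξ (b p i) ≠ 0
    rw [hb]
    exact hpol p p.2 i
  have hmain := F.polarSum_eq_indicator hξ x
  change _ = Set.indicator (convexHull ℝ (Set.range ((↑) : Vert → E))) _ x at hmain
  rw [hrange, ← hPhull] at hmain
  rw [← hmain, SimpleVertexFigure.polarSum, ← Finset.sum_coe_sort Vert]
  refine Finset.sum_congr rfl fun p _ => ?_
  rw [Set.indicator_apply, mul_ite, mul_one, mul_zero]
  change (if ∀ i, 0 < ξ (b p i) ↔ ¬ 0 ≤ (b p).coord i (x - p)
    then (-1 : ℝ) ^ Nat.card {i : Fin n // 0 < ξ (b p i)} else 0) = _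
  simp_rw [hb]
  refine if_congr ⟨fun h => ?_, ?_⟩ rfl rfl
  · refine ⟨fun i => (b p).coord i (x - p), fun i hi => not_le.1 ((h i).1 hi),
      fun i hi => by_contra fun hc => lt_asymm hi ((h i).2 hc), ?_⟩
    simp_rw [← hb, Basis.coord_apply, (b p).sum_repr, add_sub_cancel]
  · rintro ⟨c, hneg, hnonneg, rfl⟩ i
    rw [hcoord, not_le]
    refine ⟨hneg i, fun hc => ?_⟩
    rcases lt_or_gt_of_ne (hpol p p.2 i) with hi | hi
    · exact absurd (hnonneg i hi) (not_le.2 hc)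
    · exact hi
end

section
/- Dual Lawrence–Varchenko polar decomposition: For every polarizing vector ξ for P and every x ∈ V*, one has (−1)^n · 1_{P°}(x) = Σ_{p ∈ Vert(P)} (−1)^{|E_p^+(ξ)|} 1_{Č_p^#(ξ)}(x), where P° denotes the interior of P in V*. -/
open Module

/-- The edge vectors `w p` at the vertices `p` of a simple polytope `P`, together with the dual
coordinate functionals `c p`. -/
structure IsSimpleEdgeSystem {E ι : Type*} [AddCommGroup E] [Module ℝ E] [Fintype ι]
    [DecidableEq ι] (P : Set E) (Vert : Finset E) (w : E → ι → E) (c : E → ι → Dual ℝ E) :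
    Prop where
  hull : P = convexHull ℝ (Vert : Set E)
  expand : ∀ p ∈ Vert, ∀ v, ∑ k, c p k v • w p k = v
  dual : ∀ p ∈ Vert, ∀ j k, c p j (w p k) = if j = k then 1 else 0
  nonneg : ∀ p ∈ Vert, ∀ x ∈ P, ∀ k, 0 ≤ c p k (x - p)
  edge : ∀ p ∈ Vert, ∀ k, ∃ r : ℝ, 0 < r ∧ p + r • w p k ∈ P

/-- The signed indicator of the dual polarized tangent cone at `p`, averaged over the two
possible signs of each edge vector on which `ξ` vanishes. -/
noncomputable def polarWeight {E ι : Type*} [AddCommGroup E] [Module ℝ E] [Fintype ι]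
    (w : E → ι → E) (c : E → ι → Dual ℝ E) (ξ : Dual ℝ E) (x p : E) : ℝ :=
  ∏ k, ((SignType.sign (ξ (w p k)) : ℝ) + if 0 < c p k (x - p) then 1 else -1) / 2

namespace IsSimpleEdgeSystem

variable {E ι : Type*} [AddCommGroup E] [Module ℝ E] [Fintype ι] [DecidableEq ι]
  {P : Set E} {Vert : Finset E} {w : E → ι → E} {c : E → ι → Dual ℝ E}

lemma mem (h : IsSimpleEdgeSystem P Vert w c) {p : E} (hp : p ∈ Vert) : p ∈ P := by
  rw [h.hull]
  exact subset_convexHull ℝ _ hp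

lemma eq_zero_of_coord (h : IsSimpleEdgeSystem P Vert w c) {p : E} (hp : p ∈ Vert) {v : E}
    (hv : ∀ k, c p k v = 0) : v = 0 := by
  rw [← h.expand p hp v]
  simp [hv]

lemma eq_smul_of_coord (h : IsSimpleEdgeSystem P Vert w c) {p : E} (hp : p ∈ Vert) {i : ι} {v : E}
    (hv : ∀ k, k ≠ i → c p k v = 0) : v = c p i v • w p i := by
  conv_lhs => rw [← h.expand p hp v]
  exact Finset.sum_eq_single i (fun k _ hk => by simp [hv k hk]) (by simp)

/-- A vertex is not an interior point of a segment contained in the polytope. -/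
lemma eq_zero_of_mem_of_mem (h : IsSimpleEdgeSystem P Vert w c) {p u : E} (hp : p ∈ Vert)
    {s t : ℝ} (hs : 0 < s) (ht : 0 < t) (h₁ : p + s • u ∈ P) (h₂ : p - t • u ∈ P) : u = 0 := by
  refine h.eq_zero_of_coord hp fun k => ?_
  have e₁ := h.nonneg p hp _ h₁ k
  have e₂ := h.nonneg p hp _ h₂ k
  simp only [add_sub_cancel_left, sub_sub_cancel_left, map_smul, map_neg, smul_eq_mul] at e₁ e₂
  nlinarith [nonneg_of_mul_nonneg_right e₁ hs,
    nonneg_of_mul_nonneg_right (by linarith : 0 ≤ t * (-(c p k u))) ht]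

/-- Every edge ray at a vertex contains a second vertex. -/
lemma exists_vertex_on_edge (h : IsSimpleEdgeSystem P Vert w c) {p : E} (hp : p ∈ Vert) (i : ι) :
    ∃ q ∈ Vert, ∃ l : ℝ, 0 < l ∧ q = p + l • w p i := by
  obtain ⟨r, hr, hy⟩ := h.edge p hp i
  rw [h.hull, Finset.mem_convexHull'] at hy
  obtain ⟨a, ha, ha1, hay⟩ := hy
  have key : ∀ j, ∑ v ∈ Vert, a v * c p j (v - p) = r * if j = i then 1 else 0 := by
    intro j
    have e : r • w p i = ∑ v ∈ Vert, a v • (v - p) := by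
      simp [smul_sub, Finset.sum_sub_distrib, ← Finset.sum_smul, ha1, hay]
    rw [← h.dual p hp j i, ← smul_eq_mul r, ← map_smul, e, map_sum]
    simp
  obtain ⟨v, hv, hpos⟩ : ∃ v ∈ Vert, 0 < a v * c p i (v - p) := by
    by_contra! hcon
    have := Finset.sum_nonpos hcon
    rw [key] at this
    simp at this
    linarith
  have hav : 0 < a v := (ha v hv).lt_of_ne fun h0 => by simp [← h0] at hpos
  refine ⟨v, hv, c p i (v - p), pos_of_mul_pos_right hpos hav.le, ?_⟩
  rw [← h.eq_smul_of_coord hp (v := v - p) fun k hk => ?_, add_sub_cancel]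
  have h0 := key k
  rw [if_neg hk, mul_zero, Finset.sum_eq_zero_iff_of_nonneg fun v hv =>
    mul_nonneg (ha v hv) (h.nonneg p hp v (h.mem hv) k)] at h0
  exact (mul_eq_zero.mp (h0 v hv)).resolve_left hav.ne'

lemma edge_ne_zero (h : IsSimpleEdgeSystem P Vert w c) {p : E} (hp : p ∈ Vert) (i : ι) :
    w p i ≠ 0 := by
  intro h0
  simpa [h0] using h.dual p hp i i

/-- The two vertices of an edge have matching edge vectors, up to positive scaling and modulo the
direction of their common edge. -/
lemma exists_adjacent (h : IsSimpleEdgeSystem P Vert w c) {p : E} (hp : p ∈ Vert) (i : ι) :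
    ∃ q ∈ Vert, ∃ l : ℝ, 0 < l ∧ q = p + l • w p i ∧ ∃ φ : Equiv.Perm ι,
      (∃ m : ℝ, 0 < m ∧ w q (φ i) = -(m • w p i)) ∧
      ∀ k, k ≠ i → ∃ α : ℝ, 0 < α ∧ ∃ β : ℝ, w q (φ k) = α • w p k + β • w p i := by
  obtain ⟨q, hq, l, hl, rfl⟩ := h.exists_vertex_on_edge hp i
  set q := p + l • w p i with hqdef
  refine ⟨q, hq, l, hl, rfl, ?_⟩
  have hnn : ∀ j, j ≠ i → ∀ m, 0 ≤ c p j (w q m) := by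
    intro j hj m
    obtain ⟨r, hr, hy⟩ := h.edge q hq m
    have := h.nonneg p hp _ hy j
    have e : q + r • w q m - p = l • w p i + r • w q m := by rw [hqdef]; abel
    rw [e] at this
    simp only [map_add, map_smul, h.dual p hp, if_neg hj, smul_eq_mul, mul_zero, zero_add] at this
    exact nonneg_of_mul_nonneg_right this hr
  have back : ∃ i', ∃ m : ℝ, 0 < m ∧ w q i' = -(m • w p i) := by
    have hpq : p - q = -(l • w p i) := by rw [hqdef]; abel
    obtain ⟨k₀, hk₀⟩ : ∃ k, c q k (p - q) ≠ 0 := by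
      by_contra! hcon
      have := h.eq_zero_of_coord hq hcon
      rw [hpq, neg_eq_zero, smul_eq_zero] at this
      exact this.elim hl.ne' (h.edge_ne_zero hp i)
    have hk₀' : 0 < c q k₀ (p - q) := (h.nonneg q hq p (h.mem hp) k₀).lt_of_ne hk₀.symm
    have hz : ∀ j, j ≠ i → c p j (w q k₀) = 0 := by
      intro j hj
      have e : ∑ k, c q k (p - q) * c p j (w q k) = 0 := by
        have := congrArg (c p j) (h.expand q hq (p - q))
        rw [map_sum] at this
        simp only [map_smul, smul_eq_mul] at this
        rw [this, hpq]
        simp [h.dual p hp, hj]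
      rw [Finset.sum_eq_zero_iff_of_nonneg fun k _ =>
        mul_nonneg (h.nonneg q hq p (h.mem hp) k) (hnn j hj k)] at e
      exact (mul_eq_zero.mp (e k₀ (Finset.mem_univ _))).resolve_left hk₀
    have hw := h.eq_smul_of_coord hp hz
    set ν := c p i (w q k₀)
    refine ⟨k₀, -ν, ?_, by rw [hw]; simp⟩
    have e1 : c q k₀ (w q k₀) = 1 := by simp [h.dual q hq]
    rw [hw, map_smul, smul_eq_mul] at e1
    rw [hpq, map_neg, map_smul, smul_eq_mul] at hk₀'
    have : c q k₀ (w p i) < 0 := by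
      by_contra! hcon
      nlinarith [mul_nonneg hl.le hcon]
    by_contra! hcon
    nlinarith
  obtain ⟨i', m, hm, hi'⟩ := back
  have match_edge : ∀ k, k ≠ i → ∃ k', ∃ α : ℝ, 0 < α ∧ ∃ β : ℝ,
      w q k' = α • w p k + β • w p i := by
    intro k hk
    obtain ⟨r, hr, hy⟩ := h.edge p hp k
    set y := p + r • w p k with hydef
    have e : ∀ j, j ≠ i → ∑ m, c q m (y - q) * c p j (w q m) = r * if j = k then 1 else 0 := by
      intro j hj
      have := congrArg (c p j) (h.expand q hq (y - q))
      rw [map_sum] at this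
      simp only [map_smul, smul_eq_mul] at this
      rw [this, hydef, hqdef]
      simp [h.dual p hp, hj]
    obtain ⟨k', -, hk'⟩ : ∃ k' ∈ Finset.univ, 0 < c q k' (y - q) * c p k (w q k') := by
      by_contra! hcon
      have := Finset.sum_nonpos hcon
      rw [e k hk] at this
      simp at this
      linarith
    have h1 : 0 < c q k' (y - q) := by
      refine (h.nonneg q hq y hy k').lt_of_ne fun h0 => ?_
      simp [← h0] at hk'
    refine ⟨k', c p k (w q k'), pos_of_mul_pos_right hk' h1.le, c p i (w q k'), ?_⟩
    have hz : ∀ j, j ≠ i → j ≠ k → c p j (w q k') = 0 := by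
      intro j hj hjk
      have e0 := e j hj
      rw [if_neg hjk, mul_zero, Finset.sum_eq_zero_iff_of_nonneg fun m _ =>
        mul_nonneg (h.nonneg q hq y hy m) (hnn j hj m)] at e0
      exact (mul_eq_zero.mp (e0 k' (Finset.mem_univ _))).resolve_left h1.ne'
    rw [← sub_eq_zero]
    refine h.eq_zero_of_coord hp fun j => ?_
    simp only [map_sub, map_add, map_smul, h.dual p hp, smul_eq_mul]
    by_cases hji : j = i
    · subst hji
      simp [hk.symm]
    · by_cases hjk : j = k
      · subst hjk
        simp [hji]
      · simp [hji, hjk, hz j hji hjk]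
  choose! f α hα β hf using match_edge
  let φ : ι → ι := fun k => if k = i then i' else f k
  have hφ : Function.Injective φ := by
    have hcoord : ∀ k, k ≠ i → ∀ j, j ≠ i → c p j (w q (φ k)) = α k * if j = k then 1 else 0 := by
      intro k hk j hj
      simp [φ, hk, hf k hk, h.dual p hp, hj]
    have hcoord' : ∀ j, j ≠ i → c p j (w q (φ i)) = 0 := by
      intro j hj
      simp [φ, hi', h.dual p hp, hj]
    intro a b hab
    by_cases ha : a = i
    · by_cases hb : b = i
      · rw [ha, hb]
      · have e := hcoord b hb b hb
        rw [← hab, ha, hcoord' b hb] at e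
        simp [(hα b hb).ne] at e
    · have e := hcoord a ha a ha
      by_cases hb : b = i
      · rw [hab, hb, hcoord' a ha] at e
        simp [(hα a ha).ne] at e
      · rw [hab, hcoord b hb a ha] at e
        by_contra hne
        simp [hne, (hα a ha).ne] at e
  refine ⟨Equiv.ofBijective φ (Finite.injective_iff_bijective.mp hφ), ⟨m, hm, ?_⟩, fun k hk =>
    ⟨α k, hα k hk, β k, ?_⟩⟩
  · simpa [φ] using hi'
  · simpa [φ, hk] using hf k hk

/-- Corresponding coordinates at adjacent vertices are positive at the same points. -/
lemma coord_pos_iff (h : IsSimpleEdgeSystem P Vert w c) {p q : E} (hp : p ∈ Vert) (hq : q ∈ Vert)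
    {i : ι} {l : ℝ} (hpq : q = p + l • w p i) {φ : Equiv.Perm ι} {m : ℝ}
    (hi : w q (φ i) = -(m • w p i)) (hφ : ∀ k, k ≠ i → ∃ α : ℝ, 0 < α ∧ ∃ β : ℝ,
      w q (φ k) = α • w p k + β • w p i) (x : E) {k : ι} (hk : k ≠ i) :
    0 < c q (φ k) (x - q) ↔ 0 < c p k (x - p) := by
  choose! α hα β hβ using hφ
  have e : c p k (x - p) = c q (φ k) (x - q) * α k := by
    have h1 : c p k (x - p) = c p k (x - q) := by
      rw [hpq]
      simp [h.dual p hp, hk]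
    rw [h1]
    conv_lhs => rw [← h.expand q hq (x - q)]
    rw [← Equiv.sum_comp φ, map_sum, Finset.sum_eq_single k]
    · rw [hβ k hk]
      simp [h.dual p hp, hk]
    · intro j _ hj
      by_cases hji : j = i
      · rw [hji, hi]
        simp [h.dual p hp, hk]
      · rw [hβ j hji]
        simp [h.dual p hp, hk, hj.symm]
    · simp
  rw [e, mul_pos_iff_of_pos_right (hα k hk)]

/-- The total polar weight does not change when `ξ` crosses a wall on which at most one edge
direction at each vertex degenerates. -/
lemma sum_polarWeight_eq_of_sign_eq (h : IsSimpleEdgeSystem P Vert w c) {ξ η : Dual ℝ E}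
    (hgen : ∀ p ∈ Vert, ∀ i k, ξ (w p i) = 0 → ξ (w p k) = 0 → i = k)
    (hsign : ∀ p ∈ Vert, ∀ k, ξ (w p k) ≠ 0 →
      SignType.sign (η (w p k)) = SignType.sign (ξ (w p k))) (x : E) :
    ∑ p ∈ Vert, polarWeight w c η x p = ∑ p ∈ Vert, polarWeight w c ξ x p := by
  classical
  rw [← sub_eq_zero, ← Finset.sum_sub_distrib]
  have hdiff : ∀ p ∈ Vert, ∀ i, ξ (w p i) = 0 →
      polarWeight w c η x p - polarWeight w c ξ x p = (SignType.sign (η (w p i)) : ℝ) / 2 *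
        ∏ k ∈ Finset.univ.erase i,
          ((SignType.sign (ξ (w p k)) : ℝ) + if 0 < c p k (x - p) then 1 else -1) / 2 := by
    intro p hp i hi
    unfold polarWeight
    rw [← Finset.mul_prod_erase _ _ (Finset.mem_univ i),
      ← Finset.mul_prod_erase Finset.univ (fun k => ((SignType.sign (ξ (w p k)) : ℝ) + _) / 2)
        (Finset.mem_univ i), hi]
    have e : ∏ k ∈ Finset.univ.erase i,
          ((SignType.sign (η (w p k)) : ℝ) + if 0 < c p k (x - p) then 1 else -1) / 2 =
        ∏ k ∈ Finset.univ.erase i,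
          ((SignType.sign (ξ (w p k)) : ℝ) + if 0 < c p k (x - p) then 1 else -1) / 2 := by
      refine Finset.prod_congr rfl fun k hk => ?_
      rw [hsign p hp k fun h0 => (Finset.ne_of_mem_erase hk) (hgen p hp k i h0 hi)]
    rw [e]
    simp only [sign_zero, SignType.coe_zero]
    ring
  rw [← Finset.sum_filter_of_ne (p := fun p => ∃ i, ξ (w p i) = 0)]
  swap
  · intro p hp hne
    by_contra! hcon
    refine hne (sub_eq_zero.mpr (Finset.prod_congr rfl fun k _ => ?_))
    rw [hsign p hp k (hcon k)]
  have step : ∀ p ∈ Vert.filter fun p => ∃ i, ξ (w p i) = 0, ∃ q ∈ Vert,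
      (polarWeight w c η x p - polarWeight w c ξ x p) +
        (polarWeight w c η x q - polarWeight w c ξ x q) = 0 ∧
      ∃ i j, ∃ l m : ℝ, 0 < l ∧ 0 < m ∧ ξ (w p i) = 0 ∧ ξ (w q j) = 0 ∧
        q = p + l • w p i ∧ w q j = -(m • w p i) := by
    intro p hp
    obtain ⟨hp, i, hi⟩ := Finset.mem_filter.mp hp
    obtain ⟨q, hq, l, hl, hpq, φ, ⟨m, hm, hφi⟩, hφ⟩ := h.exists_adjacent hp i
    have hqi : ξ (w q (φ i)) = 0 := by simp [hφi, hi]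
    refine ⟨q, hq, ?_, i, φ i, l, m, hl, hm, hi, hqi, hpq, hφi⟩
    rw [hdiff p hp i hi, hdiff q hq (φ i) hqi]
    have e : ∏ k ∈ Finset.univ.erase (φ i),
          ((SignType.sign (ξ (w q k)) : ℝ) + if 0 < c q k (x - q) then 1 else -1) / 2 =
        ∏ k ∈ Finset.univ.erase i,
          ((SignType.sign (ξ (w p k)) : ℝ) + if 0 < c p k (x - p) then 1 else -1) / 2 := by
      symm
      refine Finset.prod_equiv φ (by simp) fun k hk => ?_
      have hki := Finset.ne_of_mem_erase hk
      simp only [h.coord_pos_iff hp hq hpq hφi hφ x hki]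
      obtain ⟨α, hα, β, hβ⟩ := hφ k hki
      rw [hβ, map_add, map_smul, map_smul, hi, smul_zero, add_zero, smul_eq_mul, sign_mul,
        sign_pos hα, one_mul]
    rw [e, hφi, map_neg, map_smul, smul_eq_mul, Left.sign_neg, sign_mul, sign_pos hm, one_mul]
    push_cast
    ring
  choose! π hπ hcancel i j l m hl hm hi hj hpq hij using step
  have hmem : ∀ p ∈ Vert.filter fun p => ∃ i, ξ (w p i) = 0,
      π p ∈ Vert.filter fun p => ∃ i, ξ (w p i) = 0 := fun p hp =>
    Finset.mem_filter.mpr ⟨hπ p hp, j p hp, hj p hp⟩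
  refine Finset.sum_involution (fun p _ => π p) hcancel ?_ hmem ?_
  · intro p hp _ heq
    have e := hpq p hp
    rw [heq, left_eq_add, smul_eq_zero] at e
    exact e.elim (hl p hp).ne' (h.edge_ne_zero (Finset.mem_filter.mp hp).1 _)
  · intro p hp
    have hp' := (Finset.mem_filter.mp hp).1
    have hq := hmem p hp
    have hr := hπ _ hq
    have e1 := hpq p hp
    have e2 := hpq _ hq
    rw [hgen _ (hπ p hp) _ _ (hi _ hq) (hj p hp), hij p hp] at e2
    have e3 : π (π p) = p + (l p - l (π p) * m p) • w p (i p hp) := by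
      refine (e2.trans (congrArg (· + _) e1)).trans ?_
      module
    have hw := h.edge_ne_zero hp' (i p hp)
    rcases lt_trichotomy (l p) (l (π p) * m p) with hlt | heq | hlt
    · refine absurd (h.eq_zero_of_mem_of_mem hp' (hl p hp) (sub_pos.mpr hlt) (e1 ▸ h.mem (hπ p hp))
        ?_) hw
      convert h.mem hr using 1
      rw [e3]
      module
    · rw [e3, heq, sub_self, zero_smul, add_zero]
    · refine absurd (h.eq_zero_of_mem_of_mem (u := w p (i p hp)) hr
        (mul_pos (hl _ hq) (hm p hp)) (sub_pos.mpr hlt) ?_ ?_) hw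
      · convert h.mem (hπ p hp) using 1
        refine Eq.trans ?_ e1.symm
        rw [e3]
        module
      · convert h.mem hp' using 1
        rw [e3]
        module

lemma sum_polarWeight_eq_zero_of_lt (h : IsSimpleEdgeSystem P Vert w c) {ξ : Dual ℝ E} {x : E}
    (hx : ∀ p ∈ Vert, ξ x < ξ p) : ∑ p ∈ Vert, polarWeight w c ξ x p = 0 := by
  refine Finset.sum_eq_zero fun p hp => ?_
  by_contra hne
  have hne' := Finset.prod_ne_zero_iff.mp hne
  have : 0 ≤ ξ (x - p) := by
    rw [← h.expand p hp (x - p), map_sum]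
    refine Finset.sum_nonneg fun k _ => ?_
    rw [map_smul, smul_eq_mul]
    have hk := hne' k (Finset.mem_univ k)
    rcases lt_trichotomy (ξ (w p k)) 0 with hξ | hξ | hξ
    · split_ifs at hk with hc
      · simp [hξ] at hk
      · exact mul_nonneg_of_nonpos_of_nonpos (not_lt.mp hc) hξ.le
    · simp [hξ]
    · split_ifs at hk with hc
      · positivity
      · simp [hξ] at hk
  rw [map_sub] at this
  linarith [hx p hp]

lemma sum_polarWeight_eq_one (h : IsSimpleEdgeSystem P Vert w c) {ξ : Dual ℝ E}
    (hpol : ∀ p ∈ Vert, ∀ k, ξ (w p k) ≠ 0) (hne : Vert.Nonempty) {x : E}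
    (hx : ∀ p ∈ Vert, ∀ k, 0 < c p k (x - p)) : ∑ p ∈ Vert, polarWeight w c ξ x p = 1 := by
  obtain ⟨p, hp, hmin⟩ := Finset.exists_min_image Vert ξ hne
  have hpos : ∀ k, 0 < ξ (w p k) := by
    intro k
    refine (hpol p hp k).lt_or_gt.resolve_left fun hneg => ?_
    obtain ⟨q, hq, l, hl, hpq⟩ := h.exists_vertex_on_edge hp k
    have := hmin q hq
    rw [hpq, map_add, map_smul, smul_eq_mul] at this
    nlinarith
  rw [Finset.sum_eq_single_of_mem p hp]
  · exact Finset.prod_eq_one fun k _ => by rw [if_pos (hx p hp k)]; simp [hpos k]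
  · intro q hq hqp
    obtain ⟨k, hk⟩ : ∃ k, ξ (w q k) < 0 := by
      by_contra! hcon
      refine hqp ?_
      have hle : 0 ≤ ∑ k, c q k (p - q) * ξ (w q k) :=
        Finset.sum_nonneg fun k _ => mul_nonneg (h.nonneg q hq p (h.mem hp) k) (hcon k)
      have e : ∑ k, c q k (p - q) * ξ (w q k) = ξ (p - q) := by
        conv_rhs => rw [← h.expand q hq (p - q)]
        simp
      have h0 : ∑ k, c q k (p - q) * ξ (w q k) = 0 := by
        refine le_antisymm ?_ hle
        rw [e, map_sub]
        linarith [hmin q hq]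
      rw [Finset.sum_eq_zero_iff_of_nonneg fun k _ =>
        mul_nonneg (h.nonneg q hq p (h.mem hp) k) (hcon k)] at h0
      have := h.eq_zero_of_coord hq fun k =>
        (mul_eq_zero.mp (h0 k (Finset.mem_univ k))).resolve_right (hpol q hq k)
      exact (sub_eq_zero.mp this).symm
    exact Finset.prod_eq_zero (Finset.mem_univ k) (by rw [if_pos (hx q hq k)]; simp [hk])

/-- A functional separating `x` from the vertices can be perturbed so that, on the line through
`ξ` and it, at most one edge direction degenerates at a time at each vertex. -/
lemma exists_generic_dual (h : IsSimpleEdgeSystem P Vert w c) {ξ f : Dual ℝ E}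
    (hpol : ∀ p ∈ Vert, ∀ k, ξ (w p k) ≠ 0) {x : E} (hf : ∀ p ∈ Vert, f x < f p) :
    ∃ η : Dual ℝ E, (∀ p ∈ Vert, η x < η p) ∧
      ∀ p ∈ Vert, ∀ i k, i ≠ k → ξ (w p i) * η (w p k) - ξ (w p k) * η (w p i) ≠ 0 := by
  let T := {a : Vert × ι × ι // a.2.1 ≠ a.2.2}
  let u : T → E := fun a => ξ (w a.1.1 a.1.2.1) • w a.1.1 a.1.2.2 -
    ξ (w a.1.1 a.1.2.2) • w a.1.1 a.1.2.1
  have hu : ∀ a, u a ≠ 0 := by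
    rintro ⟨⟨⟨p, hp⟩, i, k⟩, hik⟩ h0
    have e := congrArg (c p k) h0
    simp only [u, map_sub, map_smul, h.dual p hp, if_neg (Ne.symm hik), smul_eq_mul, map_zero,
      if_true, mul_one, mul_zero, sub_zero] at e
    exact hpol p hp i e
  obtain ⟨g, hg⟩ := Module.exists_dual_forall_apply_ne_zero (K := ℝ) u hu
  have h1 : ∀ᶠ s : ℝ in nhdsWithin 0 {0}ᶜ, ∀ p ∈ Vert, (f + s • g) x < (f + s • g) p := by
    refine nhdsWithin_le_nhds ((Finset.eventually_all Vert).mpr fun p hp => ?_)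
    have hl : ContinuousAt (fun s : ℝ => (f + s • g) x) 0 := by
      simp only [LinearMap.add_apply, LinearMap.smul_apply, smul_eq_mul]
      fun_prop
    have hr : ContinuousAt (fun s : ℝ => (f + s • g) p) 0 := by
      simp only [LinearMap.add_apply, LinearMap.smul_apply, smul_eq_mul]
      fun_prop
    exact hl.eventually_lt hr (by simpa using hf p hp)
  have h2 : ∀ᶠ s : ℝ in nhdsWithin 0 {0}ᶜ, ∀ a, (f + s • g) (u a) ≠ 0 := by
    refine Filter.eventually_all.mpr fun a => ?_
    by_cases hfa : f (u a) = 0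
    · filter_upwards [self_mem_nhdsWithin] with s hs
      simpa [hfa, hg a] using hs
    · refine nhdsWithin_le_nhds ?_
      have hc : ContinuousAt (fun s : ℝ => (f + s • g) (u a)) 0 := by
        simp only [LinearMap.add_apply, LinearMap.smul_apply, smul_eq_mul]
        fun_prop
      exact hc.eventually_ne (by simpa using hfa)
  obtain ⟨s, hs1, hs2⟩ := (h1.and h2).exists
  refine ⟨f + s • g, hs1, fun p hp i k hik => ?_⟩
  have := hs2 ⟨⟨⟨p, hp⟩, i, k⟩, hik⟩
  simpa only [u, map_sub, map_smul, smul_eq_mul] using this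

lemma sum_polarWeight_eq_of_generic (h : IsSimpleEdgeSystem P Vert w c) {ξ η : Dual ℝ E}
    (hgen : ∀ p ∈ Vert, ∀ i k, i ≠ k → ξ (w p i) * η (w p k) - ξ (w p k) * η (w p i) ≠ 0) (x : E) :
    ∑ p ∈ Vert, polarWeight w c ξ x p = ∑ p ∈ Vert, polarWeight w c η x p := by
  let F : ℝ → ℝ := fun t => ∑ p ∈ Vert, polarWeight w c ((1 - t) • ξ + t • η) x p
  have hF : IsLocallyConstant F := by
    refine (IsLocallyConstant.iff_eventually_eq F).mpr fun t₀ => ?_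
    have hev : ∀ᶠ t in nhds t₀, ∀ p ∈ Vert, ∀ k, ((1 - t₀) • ξ + t₀ • η) (w p k) ≠ 0 →
        SignType.sign (((1 - t) • ξ + t • η) (w p k)) =
          SignType.sign (((1 - t₀) • ξ + t₀ • η) (w p k)) := by
      refine (Finset.eventually_all Vert).mpr fun p _ => Filter.eventually_all.mpr fun k => ?_
      by_cases h0 : ((1 - t₀) • ξ + t₀ • η) (w p k) = 0
      · exact Filter.Eventually.of_forall fun t hne => absurd h0 hne
      · have hc : ContinuousAt (fun t : ℝ => ((1 - t) • ξ + t • η) (w p k)) t₀ := by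
          simp only [LinearMap.add_apply, LinearMap.smul_apply, smul_eq_mul]
          fun_prop
        have hs : ContinuousAt (fun t : ℝ => SignType.sign (((1 - t) • ξ + t • η) (w p k))) t₀ :=
          ContinuousAt.comp (f := fun t : ℝ => ((1 - t) • ξ + t • η) (w p k))
            (continuousAt_sign_of_ne_zero h0) hc
        filter_upwards [hs.eventually (IsOpen.mem_nhds (isOpen_discrete
          {SignType.sign (((1 - t₀) • ξ + t₀ • η) (w p k))}) rfl)] with t ht _
        exact ht
    filter_upwards [hev] with t ht
    refine h.sum_polarWeight_eq_of_sign_eq (fun p hp i k hi hk => ?_) ht x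
    by_contra hik
    simp only [LinearMap.add_apply, LinearMap.smul_apply, smul_eq_mul] at hi hk
    have e1 : t₀ * (ξ (w p i) * η (w p k) - ξ (w p k) * η (w p i)) = 0 := by
      linear_combination ξ (w p i) * hk - ξ (w p k) * hi
    have e2 : (1 - t₀) * (ξ (w p i) * η (w p k) - ξ (w p k) * η (w p i)) = 0 := by
      linear_combination η (w p k) * hi - η (w p i) * hk
    exact hgen p hp i k hik (by linear_combination e1 + e2)
  simpa [F] using hF.apply_eq_of_preconnectedSpace 0 1

end IsSimpleEdgeSystem

section Normed

variable {E ι : Type*} [NormedAddCommGroup E] [NormedSpace ℝ E]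
  [Fintype ι] [DecidableEq ι]
  {P : Set E} {Vert : Finset E} {w : E → ι → E} {c : E → ι → Dual ℝ E}

namespace IsSimpleEdgeSystem

lemma coord_pos_of_mem_interior (h : IsSimpleEdgeSystem P Vert w c) {x : E}
    (hx : x ∈ interior P) {p : E} (hp : p ∈ Vert) (k : ι) : 0 < c p k (x - p) := by
  have hc : ContinuousAt (fun s : ℝ => x - s • w p k) 0 := by fun_prop
  have hev : ∀ᶠ s : ℝ in nhdsWithin 0 (Set.Ioi 0), x - s • w p k ∈ P :=
    nhdsWithin_le_nhds (hc.eventually (by simpa using mem_interior_iff_mem_nhds.mp hx))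
  obtain ⟨s, hs, hs0⟩ := (hev.and self_mem_nhdsWithin).exists
  have := h.nonneg p hp _ hs k
  rw [sub_right_comm, map_sub, map_smul, h.dual p hp, if_pos rfl, smul_eq_mul, mul_one] at this
  have hs0' : 0 < s := hs0
  linarith

variable [FiniteDimensional ℝ E]

lemma interior_nonempty (h : IsSimpleEdgeSystem P Vert w c) (hne : Vert.Nonempty) :
    (interior P).Nonempty := by
  have hconv : Convex ℝ P := h.hull ▸ convex_convexHull ℝ _
  obtain ⟨p, hp⟩ := hne
  rw [hconv.interior_nonempty_iff_affineSpan_eq_top,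
    ← AffineSubspace.direction_eq_top_iff_of_nonempty ⟨p, subset_affineSpan ℝ P (h.mem hp)⟩,
    eq_top_iff]
  intro v _
  rw [← h.expand p hp v]
  refine Submodule.sum_mem _ fun k _ => Submodule.smul_mem _ _ ?_
  obtain ⟨r, hr, hy⟩ := h.edge p hp k
  have := AffineSubspace.vsub_mem_direction (subset_affineSpan ℝ P hy)
    (subset_affineSpan ℝ P (h.mem hp))
  rw [vsub_eq_sub, add_sub_cancel_left] at this
  exact (Submodule.smul_mem_iff _ hr.ne').mp this

/-- A point outside the interior can be pushed out of the polytope without changing the signs of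
its coordinates at the vertices. -/
lemma exists_notMem_coord_pos_iff (h : IsSimpleEdgeSystem P Vert w c) (hne : Vert.Nonempty)
    {x : E} (hx : x ∉ interior P) :
    ∃ y, y ∉ P ∧ ∀ p ∈ Vert, ∀ k, 0 < c p k (y - p) ↔ 0 < c p k (x - p) := by
  have hconv : Convex ℝ P := h.hull ▸ convex_convexHull ℝ _
  obtain ⟨q, hq⟩ := h.interior_nonempty hne
  have hev : ∀ᶠ s : ℝ in nhdsWithin 0 (Set.Ioi 0), ∀ p ∈ Vert, ∀ k,
      0 < c p k (x + s • (x - q) - p) ↔ 0 < c p k (x - p) := by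
    refine (Finset.eventually_all Vert).mpr fun p hp => Filter.eventually_all.mpr fun k => ?_
    have hqp := h.coord_pos_of_mem_interior hq hp k
    have e : ∀ s : ℝ, c p k (x + s • (x - q) - p) =
        c p k (x - p) + s * (c p k (x - p) - c p k (q - p)) := by
      intro s
      simp only [map_add, map_sub, map_smul, smul_eq_mul]
      ring
    by_cases hc : 0 < c p k (x - p)
    · have hcont : ContinuousAt
          (fun s : ℝ => c p k (x - p) + s * (c p k (x - p) - c p k (q - p))) 0 := by fun_prop
      filter_upwards [nhdsWithin_le_nhds (hcont.eventually_const_lt (u := 0)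
        (by simpa only [zero_mul, add_zero] using hc))] with s hs
      rw [e]
      exact iff_of_true hs hc
    · filter_upwards [self_mem_nhdsWithin] with s hs
      rw [e]
      refine iff_of_false (not_lt.mpr ?_) hc
      have hs' : 0 < s := hs
      nlinarith
  obtain ⟨s, hs, hs0⟩ := (hev.and self_mem_nhdsWithin).exists
  have hs0' : 0 < s := hs0
  refine ⟨x + s • (x - q), fun hy => hx ?_, hs⟩
  have := hconv.combo_interior_self_mem_interior hq hy (a := s / (1 + s)) (b := 1 / (1 + s))
    (by positivity) (by positivity) (by field_simp; ring)
  convert this using 1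
  match_scalars
  · field_simp
  · field_simp
    ring

lemma sum_polarWeight_eq_zero (h : IsSimpleEdgeSystem P Vert w c) (hcpt : IsCompact P)
    {ξ : Dual ℝ E} (hpol : ∀ p ∈ Vert, ∀ k, ξ (w p k) ≠ 0) {x : E} (hx : x ∉ interior P) :
    ∑ p ∈ Vert, polarWeight w c ξ x p = 0 := by
  rcases Vert.eq_empty_or_nonempty with rfl | hne
  · simp
  obtain ⟨y, hyP, hy⟩ := h.exists_notMem_coord_pos_iff hne hx
  have hconv : Convex ℝ P := h.hull ▸ convex_convexHull ℝ _
  obtain ⟨f, u, hfu, hf⟩ := geometric_hahn_banach_point_closed hconv hcpt.isClosed hyP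
  obtain ⟨η, hη, hgen⟩ := h.exists_generic_dual (f := (f : E →ₗ[ℝ] ℝ)) hpol
    fun p hp => hfu.trans (hf p (h.mem hp))
  rw [← h.sum_polarWeight_eq_zero_of_lt hη, ← h.sum_polarWeight_eq_of_generic hgen]
  refine Finset.sum_congr rfl fun p hp => Finset.prod_congr rfl fun k _ => ?_
  simp only [hy p hp k]

end IsSimpleEdgeSystem

end Normed

lemma neg_one_pow_mul_indicator_eq_polarWeight {E : Type*} [AddCommGroup E] [Module ℝ E] {n : ℕ}
    {w : E → Fin n → E} {c : E → Fin n → Dual ℝ E} {p : E}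
    (hexp : ∀ v, ∑ k, c p k v • w p k = v)
    (hdual : ∀ j k, c p j (w p k) = if j = k then 1 else 0) {ξ : Dual ℝ E}
    (hpol : ∀ k, ξ (w p k) ≠ 0) (x : E) :
    (-1 : ℝ) ^ Nat.card {i : Fin n // 0 < ξ (w p i)} *
        Set.indicator {y : E | ∃ a : Fin n → ℝ, (∀ i, 0 < ξ (w p i) → 0 < a i) ∧
          (∀ i, ξ (w p i) < 0 → a i ≤ 0) ∧ y = p + ∑ i, a i • w p i} (fun _ => (1 : ℝ)) x =
      (-1 : ℝ) ^ n * polarWeight w c ξ x p := by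
  classical
  set S := {y : E | ∃ a : Fin n → ℝ, (∀ i, 0 < ξ (w p i) → 0 < a i) ∧
    (∀ i, ξ (w p i) < 0 → a i ≤ 0) ∧ y = p + ∑ i, a i • w p i}
  have hmem : x ∈ S ↔
      ∀ i, (0 < ξ (w p i) → 0 < c p i (x - p)) ∧ (ξ (w p i) < 0 → c p i (x - p) ≤ 0) := by
    constructor
    · rintro ⟨a, ha, ha', rfl⟩ i
      have e : c p i (p + ∑ k, a k • w p k - p) = a i := by
        rw [add_sub_cancel_left, map_sum]
        simp [hdual]
      rw [e]
      exact ⟨ha i, ha' i⟩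
    · intro hx
      exact ⟨fun i => c p i (x - p), fun i => (hx i).1, fun i => (hx i).2, by
        rw [hexp, add_sub_cancel]⟩
  have hcard : (-1 : ℝ) ^ Nat.card {i : Fin n // 0 < ξ (w p i)} =
      ∏ i, if 0 < ξ (w p i) then (-1 : ℝ) else 1 := by
    rw [Finset.prod_ite, Finset.prod_const, Finset.prod_const_one, mul_one,
      Nat.card_eq_fintype_card, Fintype.card_subtype]
  have hn : (-1 : ℝ) ^ n = ∏ _i : Fin n, (-1 : ℝ) := by simp
  rw [hcard, hn, polarWeight, ← Finset.prod_mul_distrib]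
  by_cases hx : ∀ i, (0 < ξ (w p i) → 0 < c p i (x - p)) ∧ (ξ (w p i) < 0 → c p i (x - p) ≤ 0)
  · rw [Set.indicator_of_mem (hmem.mpr hx), mul_one]
    refine Finset.prod_congr rfl fun i _ => ?_
    rcases (hpol i).lt_or_gt with hi | hi
    · rw [if_neg hi.not_gt, if_neg ((hx i).2 hi).not_gt, sign_neg hi]
      norm_num
    · rw [if_pos hi, if_pos ((hx i).1 hi), sign_pos hi]
      norm_num
  · rw [Set.indicator_of_notMem fun hx' => hx (hmem.mp hx'), mul_zero]
    push Not at hx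
    obtain ⟨i, hi⟩ := hx
    refine (Finset.prod_eq_zero (Finset.mem_univ i) ?_).symm
    rcases (hpol i).lt_or_gt with hneg | hpos
    · rw [if_pos (hi fun h0 => absurd h0 hneg.not_gt).2, sign_neg hneg]
      norm_num
    · have : ¬ 0 < c p i (x - p) := fun h0 => absurd (hi fun _ => h0).1 hpos.not_gt
      rw [if_neg this, sign_pos hpos]
      norm_num

/-- Simplicial tangent cones at the vertices provide a system of edge vectors and dual
coordinates. -/
lemma exists_isSimpleEdgeSystem {E ι : Type*} [AddCommGroup E] [Module ℝ E] [Fintype ι]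
    [DecidableEq ι] {P : Set E} {Vert : Finset E} {w : E → ι → E}
    (hPhull : P = convexHull ℝ (Vert : Set E))
    (hindep : ∀ p ∈ Vert, LinearIndependent ℝ (w p))
    (hspan : ∀ p ∈ Vert, Submodule.span ℝ (Set.range (w p)) = ⊤)
    (htangent : ∀ p ∈ Vert,
      {y : E | ∃ r : ℝ, 0 ≤ r ∧ ∃ x ∈ P, y = p + r • (x - p)} =
        {y : E | ∃ c : ι → ℝ, (∀ i, 0 ≤ c i) ∧ y = p + ∑ i, c i • w p i}) :
    ∃ c : E → ι → Dual ℝ E, IsSimpleEdgeSystem P Vert w c := by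
  have hc : ∀ p, ∃ c : ι → Dual ℝ E, p ∈ Vert → (∀ v, ∑ k, c k v • w p k = v) ∧
      ∀ j k, c j (w p k) = if j = k then 1 else 0 := by
    intro p
    by_cases hp : p ∈ Vert
    · let b := Basis.mk (hindep p hp) (hspan p hp).ge
      refine ⟨b.coord, fun _ => ⟨fun v => ?_, fun j k => ?_⟩⟩
      · simpa [b] using b.sum_repr v
      · have e : w p k = b k := by simp [b]
        rw [e, Basis.coord_apply, Basis.repr_self, Finsupp.single_apply]
        simp only [eq_comm]
    · exact ⟨0, fun h => absurd h hp⟩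
  choose c hc using hc
  refine ⟨c, hPhull, fun p hp => (hc p hp).1, fun p hp => (hc p hp).2, fun p hp x hx k => ?_,
    fun p hp k => ?_⟩
  · obtain ⟨a, ha, hxa⟩ := (Set.ext_iff.mp (htangent p hp) x).mp
      ⟨1, zero_le_one, x, hx, by simp⟩
    have e : c p k (x - p) = a k := by
      rw [hxa, add_sub_cancel_left, map_sum]
      simp [(hc p hp).2]
    rw [e]
    exact ha k
  · obtain ⟨r, hr, y, hy, he⟩ := (Set.ext_iff.mp (htangent p hp) (p + w p k)).mpr
      ⟨Pi.single k 1, fun i => by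
        by_cases hi : i = k
        · subst hi; simp
        · simp [hi], by simp [Pi.single_apply]⟩
    have he' : w p k = r • (y - p) := add_left_cancel he
    have hr0 : r ≠ 0 := by
      rintro rfl
      exact (hindep p hp).ne_zero k (by simpa using he')
    refine ⟨r⁻¹, inv_pos.mpr (hr.lt_of_ne hr0.symm), ?_⟩
    rw [he', smul_smul, inv_mul_cancel₀ hr0, one_smul, add_sub_cancel]
    exact hy

/-- **Dual Lawrence–Varchenko polar decomposition.**
`E` plays the role of the dual space `V*` of an `n`-dimensional real vector
space `V`; a vector `ξ ∈ V` is represented by the corresponding linear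
functional `ξ : Module.Dual ℝ E` (using `V ≅ V**`), so that the pairing
`⟨w, ξ⟩` becomes `ξ w`.  For a simple convex polytope `P` with polarizing
vector `ξ`, `(−1)^n · 1_{P°}(x) = Σ_{p ∈ Vert} (−1)^{|E_p^+(ξ)|} 1_{Č_p^#(ξ)}(x)`. -/
theorem dual_lawrence_varchenko_polar_decomposition
    {E : Type*} [NormedAddCommGroup E] [NormedSpace ℝ E] [FiniteDimensional ℝ E]
    {n : ℕ} (hdim : finrank ℝ E = n)
    (P : Set E) (Vert : Finset E) (w : E → Fin n → E)
    (hPcompact : IsCompact P)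
    (hPhull : P = convexHull ℝ (Vert : Set E))
    (hindep : ∀ p ∈ Vert, LinearIndependent ℝ (w p))
    (hspan : ∀ p ∈ Vert, Submodule.span ℝ (Set.range (w p)) = ⊤)
    (htangent : ∀ p ∈ Vert,
      {y : E | ∃ r : ℝ, 0 ≤ r ∧ ∃ x ∈ P, y = p + r • (x - p)} =
        {y : E | ∃ c : Fin n → ℝ, (∀ i, 0 ≤ c i) ∧ y = p + ∑ i, c i • w p i})
    (ξ : Module.Dual ℝ E)
    (hpol : ∀ p ∈ Vert, ∀ i, ξ (w p i) ≠ 0)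
    (x : E) :
    (-1 : ℝ) ^ n * Set.indicator (interior P) (fun _ => (1 : ℝ)) x =
      ∑ p ∈ Vert,
        (-1 : ℝ) ^ Nat.card {i : Fin n // 0 < ξ (w p i)} *
          Set.indicator
            {y : E | ∃ c : Fin n → ℝ,
              (∀ i, 0 < ξ (w p i) → 0 < c i) ∧
              (∀ i, ξ (w p i) < 0 → c i ≤ 0) ∧
              y = p + ∑ i, c i • w p i}
            (fun _ => (1 : ℝ)) x := by
  obtain ⟨c, h⟩ := exists_isSimpleEdgeSystem hPhull hindep hspan htangent
  rw [Finset.sum_congr rfl fun p hp => neg_one_pow_mul_indicator_eq_polarWeight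
    (h.expand p hp) (h.dual p hp) (hpol p hp) x, ← Finset.mul_sum]
  congr 1
  by_cases hx : x ∈ interior P
  · have hne : Vert.Nonempty := by
      rw [← Finset.coe_nonempty, ← convexHull_nonempty_iff (𝕜 := ℝ), ← hPhull]
      exact ⟨x, interior_subset hx⟩
    rw [Set.indicator_of_mem hx, h.sum_polarWeight_eq_one hpol hne fun p hp k =>
      h.coord_pos_of_mem_interior hx hp k]
  · rw [Set.indicator_of_notMem hx, h.sum_polarWeight_eq_zero hPcompact hpol hx]
end

section
/- Independence of the polarization: For any two polarizing vectors ξ and ξ′ for P, the functions Σ_{p ∈ Vert(P)} (−1)^{|E_p^+(ξ)|} 1_{Č_p^#(ξ)} and Σ_{p ∈ Vert(P)} (−1)^{|E_p^+(ξ′)|} 1_{Č_p^#(ξ′)} on V* are equal. -/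
open Module

/-- A linear frame `w` at a point `p` of `P`, with dual frame `c`, such that `P` lies in the
simplicial cone spanned by `w` at `p` and contains an initial segment of each of its edges. -/
structure IsSimpleVertex {E ι : Type*} [AddCommGroup E] [Module ℝ E] [Fintype ι] (P : Set E)
    (p : E) (w : ι → E) (c : ι → Dual ℝ E) : Prop where
  mem : p ∈ P
  sum_repr : ∀ v, ∑ i, c i v • w i = v
  dual_self : ∀ i, c i (w i) = 1
  dual_ne : ∀ i j, i ≠ j → c i (w j) = 0
  nonneg : ∀ x ∈ P, ∀ i, 0 ≤ c i (x - p)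
  edge : ∀ i, ∃ ε : ℝ, 0 < ε ∧ p + ε • w i ∈ P

/-- The part of `P` on which the functionals `c i`, `i ∈ S`, take the same value as at `p`. -/
def simpleFace {E ι : Type*} [AddCommGroup E] [Module ℝ E] (P : Set E)
    (p : E) (c : ι → Dual ℝ E) (S : Finset ι) : Set E :=
  {x | x ∈ P ∧ ∀ i ∈ S, c i (x - p) = 0}

namespace IsSimpleVertex

variable {E ι : Type*} [AddCommGroup E] [Module ℝ E] [Fintype ι] {P : Set E} {p q : E}
  {w w' : ι → E} {c c' : ι → Dual ℝ E} {S S' : Finset ι}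

theorem self_mem_face (h : IsSimpleVertex P p w c) (S : Finset ι) : p ∈ simpleFace P p c S :=
  ⟨h.mem, fun i _ => by simp⟩

theorem edge_mem_face (h : IsSimpleVertex P p w c) {i : ι} (hi : i ∉ S) :
    ∃ ε : ℝ, 0 < ε ∧ p + ε • w i ∈ simpleFace P p c S := by
  obtain ⟨ε, hε, hP⟩ := h.edge i
  refine ⟨ε, hε, hP, fun j hj => ?_⟩
  have hji : j ≠ i := fun e => hi (e ▸ hj)
  simp [h.dual_ne j i hji]

theorem face_injective (h : IsSimpleVertex P p w c)
    (hF : simpleFace P p c S = simpleFace P p c S') : S = S' := by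
  have key : ∀ {A B : Finset ι}, simpleFace P p c A = simpleFace P p c B → B ⊆ A := by
    intro A B hAB i hi
    by_contra hA
    obtain ⟨ε, hε, hm⟩ := h.edge_mem_face hA
    rw [hAB] at hm
    have := hm.2 i hi
    simp [h.dual_self] at this
    exact hε.ne' this
  exact (key hF.symm).antisymm (key hF)

theorem exists_face_eq (hp : IsSimpleVertex P p w c) (hq : IsSimpleVertex P q w' c')
    (hqF : q ∈ simpleFace P p c S) : ∃ S', simpleFace P q c' S' = simpleFace P p c S := by
  classical
  set l : Dual ℝ E := ∑ i ∈ S, c i with hl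
  have hlval : ∀ v, l v = ∑ i ∈ S, c i v := fun v => by simp [hl]
  have hlq : l (q - p) = 0 := by
    rw [hlval]; exact Finset.sum_eq_zero fun i hi => hqF.2 i hi
  have hmem : ∀ x ∈ P, (l (x - q) = 0 ↔ ∀ i ∈ S, c i (x - p) = 0) := by
    intro x hx
    have e : l (x - q) = l (x - p) := by
      rw [← sub_sub_sub_cancel_right x q p, map_sub, hlq, sub_zero]
    rw [e, hlval, Finset.sum_eq_zero_iff_of_nonneg fun i _ => hp.nonneg x hx i]
  have hlw : ∀ i, 0 ≤ l (w' i) := by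
    intro i
    obtain ⟨ε, hε, hm⟩ := hq.edge i
    have h1 : 0 ≤ l (q + ε • w' i - p) := by
      rw [hlval]; exact Finset.sum_nonneg fun j _ => hp.nonneg _ hm j
    rw [add_sub_right_comm, map_add, hlq, zero_add, map_smul, smul_eq_mul] at h1
    exact nonneg_of_mul_nonneg_right h1 hε
  refine ⟨Finset.univ.filter fun i => l (w' i) ≠ 0, ?_⟩
  ext x
  refine and_congr_right fun hx => ?_
  rw [← hmem x hx]
  conv_rhs => rw [← hq.sum_repr (x - q), map_sum]
  simp only [map_smul, smul_eq_mul]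
  rw [Finset.sum_eq_zero_iff_of_nonneg fun i _ => mul_nonneg (hq.nonneg x hx i) (hlw i)]
  simp only [Finset.mem_filter, Finset.mem_univ, true_and, mul_eq_zero, true_imp_iff]
  exact forall_congr' fun i => by tauto

theorem dual_apply_eq_zero_of_face_eq (hp : IsSimpleVertex P p w c)
    (hF : simpleFace P p c S = simpleFace P q c' S') {i j : ι} (hi : i ∈ S') (hj : j ∉ S) :
    c' i (w j) = 0 := by
  obtain ⟨ε, hε, hm⟩ := hp.edge_mem_face hj
  have hpm := hp.self_mem_face S
  rw [hF] at hm hpm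
  have h1 := hm.2 i hi
  rw [add_sub_right_comm, map_add, hpm.2 i hi, zero_add, map_smul, smul_eq_mul] at h1
  exact (mul_eq_zero.1 h1).resolve_left hε.ne'

theorem linearIndependent (hp : IsSimpleVertex P p w c) : LinearIndependent ℝ w := by
  rw [Fintype.linearIndependent_iff]
  intro g hg i
  have := congrArg (c i) hg
  rw [map_sum, map_zero, Finset.sum_eq_single i] at this
  · simpa [hp.dual_self] using this
  · intro j _ hj
    simp [hp.dual_ne i j hj.symm]
  · simp

theorem card_le_of_face_eq (hp : IsSimpleVertex P p w c) (hq : IsSimpleVertex P q w' c')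
    (hF : simpleFace P p c S = simpleFace P q c' S') : S'.card ≤ S.card := by
  classical
  have h1 : LinearIndependent ℝ fun j : {j // j ∉ S} => w j :=
    hp.linearIndependent.comp _ Subtype.val_injective
  have h2 : Set.range (fun j : {j // j ∉ S} => w j) ≤
      Submodule.span ℝ (((S'ᶜ).image w' : Finset E) : Set E) := by
    rintro _ ⟨⟨j, hj⟩, rfl⟩
    show w j ∈ _
    rw [← hq.sum_repr (w j)]
    refine Submodule.sum_mem _ fun i _ => ?_
    by_cases hi : i ∈ S'
    · rw [hp.dual_apply_eq_zero_of_face_eq hF hi hj, zero_smul]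
      exact Submodule.zero_mem _
    · refine Submodule.smul_mem _ _ (Submodule.subset_span ?_)
      exact Finset.mem_coe.2 (Finset.mem_image_of_mem _ (Finset.mem_compl.2 hi))
  have h3 := linearIndependent_le_span_aux' _ h1 _ h2
  have h4 : Fintype.card {j // j ∉ S} = Fintype.card ι - S.card := by
    rw [Fintype.card_subtype_compl, Fintype.card_coe]
  have h5 : ((S'ᶜ).image w').card ≤ Fintype.card ι - S'.card :=
    Finset.card_image_le.trans (Finset.card_compl S').le
  simp only [Finset.coe_sort_coe, Fintype.card_coe, h4] at h3
  have := S.card_le_univ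
  have := S'.card_le_univ
  omega

theorem pos_of_face_eq (hp : IsSimpleVertex P p w c) (hq : IsSimpleVertex P q w' c')
    (hF : simpleFace P p c S = simpleFace P q c' S') {x : E} (hx : ∀ j ∈ S, 0 < c j (x - p)) :
    ∀ i ∈ S', 0 < c' i (x - q) := by
  intro i hi
  have hpm := hp.self_mem_face S
  rw [hF] at hpm
  have hpq := hpm.2 i hi
  have hw : ∀ j, 0 ≤ c' i (w j) := by
    intro j
    obtain ⟨ε, hε, hm⟩ := hp.edge j
    have h1 := hq.nonneg _ hm i
    rw [add_sub_right_comm, map_add, hpq, zero_add, map_smul, smul_eq_mul] at h1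
    exact nonneg_of_mul_nonneg_right h1 hε
  have hex : ∃ j, c' i (w j) ≠ 0 := by
    by_contra! hno
    have := hq.dual_self i
    rw [← hp.sum_repr (w' i), map_sum] at this
    simp [hno] at this
  obtain ⟨j, hj⟩ := hex
  have hzero : ∀ j ∉ S, c' i (w j) = 0 := fun j hj =>
    hp.dual_apply_eq_zero_of_face_eq hF hi hj
  have e : c' i (x - q) = ∑ j, c j (x - p) * c' i (w j) := by
    rw [← sub_add_sub_cancel x p q, map_add, hpq, add_zero]
    conv_lhs => rw [← hp.sum_repr (x - p), map_sum]
    simp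
  rw [e]
  have hjS : j ∈ S := by
    by_contra hjS
    exact hj (hzero j hjS)
  refine Finset.sum_pos' (fun k _ => ?_)
    ⟨j, Finset.mem_univ j, mul_pos (hx j hjS) ((hw j).lt_of_ne' hj)⟩
  by_cases hk : k ∈ S
  · exact mul_nonneg (hx k hk).le (hw k)
  · rw [hzero k hk, mul_zero]

theorem le_of_mem_face (hp : IsSimpleVertex P p w c) {ξ : Dual ℝ E}
    (hξ : ∀ i ∉ S, ξ (w i) < 0) {x : E} (hx : x ∈ simpleFace P p c S) :
    ξ x ≤ ξ p ∧ (ξ x = ξ p → x = p) := by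
  have e : ξ x - ξ p = ∑ i, c i (x - p) * ξ (w i) := by
    rw [← map_sub]
    conv_lhs => rw [← hp.sum_repr (x - p), map_sum]
    simp
  have hle : ∀ i ∈ Finset.univ, c i (x - p) * ξ (w i) ≤ 0 := by
    intro i _
    by_cases hi : i ∈ S
    · rw [hx.2 i hi, zero_mul]
    · exact mul_nonpos_of_nonneg_of_nonpos (hp.nonneg x hx.1 i) (hξ i hi).le
  refine ⟨sub_nonpos.1 (e ▸ Finset.sum_nonpos hle), fun heq => ?_⟩
  rw [heq, sub_self, eq_comm, Finset.sum_eq_zero_iff_of_nonpos hle] at e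
  rw [← sub_eq_zero, ← hp.sum_repr (x - p)]
  refine Finset.sum_eq_zero fun i hi => ?_
  by_cases hiS : i ∈ S
  · rw [hx.2 i hiS, zero_smul]
  · rw [(mul_eq_zero.1 (e i hi)).resolve_right (hξ i hiS).ne, zero_smul]

theorem exists_isMax_vertex {Vert : Finset E} (hP : P = convexHull ℝ (Vert : Set E))
    (hp : IsSimpleVertex P p w c) (hpV : p ∈ Vert) (S : Finset ι) (ξ : Dual ℝ E) :
    ∃ q ∈ Vert, q ∈ simpleFace P p c S ∧ ∀ x ∈ simpleFace P p c S, ξ x ≤ ξ q := by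
  classical
  obtain ⟨q, hq, hmax⟩ := Finset.exists_max_image
    (Vert.filter fun v => v ∈ simpleFace P p c S) ξ
    ⟨p, Finset.mem_filter.2 ⟨hpV, hp.self_mem_face S⟩⟩
  rw [Finset.mem_filter] at hq
  refine ⟨q, hq.1, hq.2, fun x hx => ?_⟩
  have hxP := hx.1
  rw [hP, Finset.mem_convexHull'] at hxP
  obtain ⟨a, ha0, ha1, hax⟩ := hxP
  have hVP : ∀ v ∈ Vert, v ∈ P := fun v hv => hP ▸ subset_convexHull ℝ _ hv
  have hface : ∀ v ∈ Vert, a v ≠ 0 → v ∈ simpleFace P p c S := by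
    intro v hv hav
    refine ⟨hVP v hv, fun i hi => ?_⟩
    have h1 : ∑ v ∈ Vert, a v * c i (v - p) = 0 := by
      rw [← hx.2 i hi, ← hax, map_sub, map_sum]
      simp only [map_sub, mul_sub, Finset.sum_sub_distrib, ← Finset.sum_mul, ha1, one_mul,
        map_smul, smul_eq_mul]
    rw [Finset.sum_eq_zero_iff_of_nonneg fun v hv =>
      mul_nonneg (ha0 v hv) (hp.nonneg v (hVP v hv) i)] at h1
    exact (mul_eq_zero.1 (h1 v hv)).resolve_left hav
  calc ξ x = ∑ v ∈ Vert, a v * ξ v := by rw [← hax, map_sum]; simp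
    _ ≤ ∑ v ∈ Vert, a v * ξ q := by
      refine Finset.sum_le_sum fun v hv => ?_
      by_cases hav : a v = 0
      · simp [hav]
      · exact mul_le_mul_of_nonneg_left
          (hmax v (Finset.mem_filter.2 ⟨hv, hface v hv hav⟩)) (ha0 v hv)
    _ = ξ q := by rw [← Finset.sum_mul, ha1, one_mul]

theorem exists_face_eq_of_polarizing {Vert : Finset E} {w : E → ι → E} {c : E → ι → Dual ℝ E}
    (hP : P = convexHull ℝ (Vert : Set E))
    (hV : ∀ p ∈ Vert, IsSimpleVertex P p (w p) (c p)) (hp : p ∈ Vert) (S : Finset ι)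
    {ξ : Dual ℝ E} (hξ : ∀ p ∈ Vert, ∀ i, ξ (w p i) ≠ 0) :
    ∃ q ∈ Vert, ∃ S', (∀ i ∉ S', ξ (w q i) < 0) ∧
      simpleFace P q (c q) S' = simpleFace P p (c p) S := by
  obtain ⟨q, hqV, hqF, hmax⟩ := (hV p hp).exists_isMax_vertex hP hp S ξ
  obtain ⟨S', hS'⟩ := (hV p hp).exists_face_eq (hV q hqV) hqF
  refine ⟨q, hqV, S', fun i hi => (hξ q hqV i).lt_of_le ?_, hS'⟩
  obtain ⟨ε, hε, hm⟩ := (hV q hqV).edge_mem_face hi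
  have h1 := hmax _ (hS' ▸ hm)
  rw [map_add, map_smul, smul_eq_mul] at h1
  by_contra! hpos
  nlinarith [mul_pos hε hpos]

end IsSimpleVertex

theorem Finset.sum_eq_sum_of_key {α β M : Type*} [AddCommMonoid M] {A B : Finset α} (F : α → β)
    (f : α → M) (hA : Set.InjOn F A) (hB : Set.InjOn F B) (hAB : ∀ a ∈ A, ∃ b ∈ B, F b = F a)
    (hBA : ∀ b ∈ B, ∃ a ∈ A, F a = F b) (hf : ∀ a ∈ A, ∀ b ∈ B, F b = F a → f a = f b) :
    ∑ a ∈ A, f a = ∑ b ∈ B, f b := by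
  choose g hg hFg using hAB
  refine Finset.sum_bij g hg (fun a ha a' ha' e => hA ha ha' ?_) (fun b hb => ?_)
    fun a ha => hf a ha _ (hg a ha) (hFg a ha)
  · rw [← hFg a ha, ← hFg a' ha', e]
  · obtain ⟨a, ha, e⟩ := hBA b hb
    exact ⟨a, ha, hB (hg a ha) hb ((hFg a ha).trans e)⟩

open Classical in
/-- Expansion of a signed indicator of a polarized orthant as an alternating sum of indicators of
open orthants. -/
theorem signed_indicator_eq_sum {ι : Type*} [Fintype ι] (s a : ι → ℝ) (hs : ∀ i, s i ≠ 0) :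
    (-1 : ℝ) ^ Nat.card {i // 0 < s i} *
        (if (∀ i, 0 < s i → 0 < a i) ∧ (∀ i, s i < 0 → a i ≤ 0) then 1 else 0) =
      ∑ S : Finset ι, if ∀ i ∉ S, s i < 0 then
        (-1 : ℝ) ^ S.card * (if ∀ i ∈ S, 0 < a i then 1 else 0) else 0 := by
  have hexp := Finset.prod_add (fun i => if 0 < a i then (-1 : ℝ) else 0)
    (fun i => if s i < 0 then (1 : ℝ) else 0) Finset.univ
  have hL : ∏ i, ((if 0 < a i then (-1 : ℝ) else 0) + (if s i < 0 then (1 : ℝ) else 0)) =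
      ∏ i, ((if 0 < s i then (-1 : ℝ) else 1) *
        (if (0 < s i → 0 < a i) ∧ (s i < 0 → a i ≤ 0) then 1 else 0)) := by
    refine Finset.prod_congr rfl fun i _ => ?_
    rcases lt_or_gt_of_ne (hs i) with h | h <;> by_cases h' : 0 < a i <;>
      simp [h, h', h.not_gt, not_lt.1, not_le.2]
  rw [hL, Finset.prod_mul_distrib, Finset.prod_ite_zero] at hexp
  rw [Finset.powerset_univ] at hexp
  convert hexp using 2
  · rw [Finset.prod_ite]
    simp [Nat.card_eq_fintype_card, Fintype.card_subtype]
  · simp [forall_and]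
  · rename_i S _
    rw [Finset.prod_ite_zero, Finset.prod_ite_zero]
    simp

theorem exists_isSimpleVertex {E ι : Type*} [AddCommGroup E] [Module ℝ E] [Fintype ι]
    {P : Set E} {p : E} {w : ι → E} (hp : p ∈ P) (hindep : LinearIndependent ℝ w)
    (hspan : Submodule.span ℝ (Set.range w) = ⊤)
    (htangent : {y : E | ∃ r : ℝ, 0 ≤ r ∧ ∃ x ∈ P, y = p + r • (x - p)} =
      {y : E | ∃ c : ι → ℝ, (∀ i, 0 ≤ c i) ∧ y = p + ∑ i, c i • w i}) :
    ∃ c : ι → Dual ℝ E, IsSimpleVertex P p w c := by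
  classical
  let b := Basis.mk hindep hspan.ge
  have hb : ∀ i, b i = w i := fun i => Basis.mk_apply hindep hspan.ge i
  have hrepr : ∀ v, ∑ i, b.coord i v • w i = v := fun v => by
    simpa [hb] using b.sum_repr v
  have hdual : ∀ i j, b.coord i (w j) = if j = i then 1 else 0 := fun i j => by
    rw [← hb j, Basis.coord_apply, Basis.repr_self, Finsupp.single_apply]
  refine ⟨b.coord, hp, hrepr, fun i => by simp [hdual], fun i j hij => ?_, ?_, ?_⟩
  · rw [hdual, if_neg hij.symm]
  · intro x hx i
    have hm : x ∈ {y : E | ∃ r : ℝ, 0 ≤ r ∧ ∃ x ∈ P, y = p + r • (x - p)} :=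
      ⟨1, zero_le_one, x, hx, by simp⟩
    rw [htangent] at hm
    obtain ⟨a, ha, rfl⟩ := hm
    simpa [-Basis.coord_apply, hdual] using ha i
  · intro i
    have hm : p + w i ∈ {y : E | ∃ c : ι → ℝ, (∀ i, 0 ≤ c i) ∧ y = p + ∑ i, c i • w i} :=
      ⟨fun j => if j = i then 1 else 0, fun j => by dsimp only; split_ifs <;> norm_num, by simp⟩
    rw [← htangent] at hm
    obtain ⟨r, hr, x, hx, e⟩ := hm
    have e' : w i = r • (x - p) := add_left_cancel e
    have hr0 : r ≠ 0 := by
      rintro rfl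
      exact hindep.ne_zero i (by simpa using e')
    refine ⟨r⁻¹, inv_pos.2 (hr.lt_of_ne' hr0), ?_⟩
    rw [e', inv_smul_smul₀ hr0, add_sub_cancel]
    exact hx

open Classical in
/-- The alternating sum of indicators of dual polarized tangent cones, rewritten as a sum over the
pairs of a vertex and a face whose maximum is attained at that vertex. -/
theorem sum_signed_indicator_eq {E : Type*} [AddCommGroup E] [Module ℝ E] {ι : Type*} [Fintype ι]
    {P : Set E} {Vert : Finset E} {w : E → ι → E} {c : E → ι → Dual ℝ E}
    (hV : ∀ p ∈ Vert, IsSimpleVertex P p (w p) (c p)) {ξ : Dual ℝ E}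
    (hξ : ∀ p ∈ Vert, ∀ i, ξ (w p i) ≠ 0) (x : E) :
    ∑ p ∈ Vert, (-1 : ℝ) ^ Nat.card {i // 0 < ξ (w p i)} *
      Set.indicator {y : E | ∃ a : ι → ℝ, (∀ i, 0 < ξ (w p i) → 0 < a i) ∧
        (∀ i, ξ (w p i) < 0 → a i ≤ 0) ∧ y = p + ∑ i, a i • w p i} (fun _ => (1 : ℝ)) x =
    ∑ z ∈ (Vert ×ˢ (Finset.univ : Finset (Finset ι))).filter
        (fun z => ∀ i ∉ z.2, ξ (w z.1 i) < 0),
      (-1 : ℝ) ^ z.2.card * (if ∀ i ∈ z.2, 0 < c z.1 i (x - z.1) then 1 else 0) := by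
  rw [Finset.sum_filter, Finset.sum_product]
  refine Finset.sum_congr rfl fun p hp => ?_
  rw [← signed_indicator_eq_sum (fun i => ξ (w p i)) (fun i => c p i (x - p)) (hξ p hp),
    Set.indicator_apply]
  congr 1
  refine if_congr ⟨?_, fun h => ⟨_, h.1, h.2, ?_⟩⟩ rfl rfl
  · rintro ⟨a, ha, ha', rfl⟩
    have e : ∀ i, c p i (p + ∑ j, a j • w p j - p) = a i := by
      intro i
      rw [add_sub_cancel_left, map_sum, Finset.sum_eq_single i]
      · simp [(hV p hp).dual_self]
      · intro j _ hj
        simp [(hV p hp).dual_ne i j hj.symm]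
      · simp
    simp only [e]
    exact ⟨ha, ha'⟩
  · rw [(hV p hp).sum_repr, add_sub_cancel]

open Classical in
theorem sum_signed_indicator_independent {E : Type*} [AddCommGroup E] [Module ℝ E] {ι : Type*}
    [Fintype ι] {P : Set E} {Vert : Finset E} {w : E → ι → E} {c : E → ι → Dual ℝ E}
    (hPhull : P = convexHull ℝ (Vert : Set E))
    (hV : ∀ p ∈ Vert, IsSimpleVertex P p (w p) (c p)) {ξ ξ' : Dual ℝ E}
    (hpol : ∀ p ∈ Vert, ∀ i, ξ (w p i) ≠ 0) (hpol' : ∀ p ∈ Vert, ∀ i, ξ' (w p i) ≠ 0) (x : E) :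
    ∑ p ∈ Vert, (-1 : ℝ) ^ Nat.card {i // 0 < ξ (w p i)} *
      Set.indicator {y : E | ∃ a : ι → ℝ, (∀ i, 0 < ξ (w p i) → 0 < a i) ∧
        (∀ i, ξ (w p i) < 0 → a i ≤ 0) ∧ y = p + ∑ i, a i • w p i} (fun _ => (1 : ℝ)) x =
    ∑ p ∈ Vert, (-1 : ℝ) ^ Nat.card {i // 0 < ξ' (w p i)} *
      Set.indicator {y : E | ∃ a : ι → ℝ, (∀ i, 0 < ξ' (w p i) → 0 < a i) ∧
        (∀ i, ξ' (w p i) < 0 → a i ≤ 0) ∧ y = p + ∑ i, a i • w p i} (fun _ => (1 : ℝ)) x := by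
  have hinj : ∀ η : Dual ℝ E, Set.InjOn (fun z : E × Finset ι => simpleFace P z.1 (c z.1) z.2)
      ((Vert ×ˢ (Finset.univ : Finset (Finset ι))).filter
        (fun z => ∀ i ∉ z.2, η (w z.1 i) < 0) : Finset _) := by
    rintro η ⟨p, S⟩ hp ⟨q, T⟩ hq e
    simp only [Finset.coe_filter, Finset.mem_product, Finset.mem_univ, and_true,
      Set.mem_ofPred_eq] at hp hq e
    have hpq := (hV q hq.1).le_of_mem_face hq.2 (e ▸ (hV p hp.1).self_mem_face S)
    have hqp := (hV p hp.1).le_of_mem_face hp.2 (e ▸ (hV q hq.1).self_mem_face T)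
    obtain rfl := hpq.2 (hpq.1.antisymm hqp.1)
    rw [(hV p hp.1).face_injective e]
  have hex : ∀ η : Dual ℝ E, (∀ p ∈ Vert, ∀ i, η (w p i) ≠ 0) →
      ∀ z : E × Finset ι, z.1 ∈ Vert →
      ∃ y ∈ (Vert ×ˢ (Finset.univ : Finset (Finset ι))).filter
        (fun z => ∀ i ∉ z.2, η (w z.1 i) < 0),
        simpleFace P y.1 (c y.1) y.2 = simpleFace P z.1 (c z.1) z.2 := by
    intro η hη z hz
    obtain ⟨q, hq, T, hT, e⟩ :=
      IsSimpleVertex.exists_face_eq_of_polarizing hPhull hV hz z.2 hη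
    exact ⟨(q, T), by simpa [hq] using hT, e⟩
  have hmem : ∀ {η : Dual ℝ E} {z : E × Finset ι},
      z ∈ (Vert ×ˢ (Finset.univ : Finset (Finset ι))).filter
        (fun z => ∀ i ∉ z.2, η (w z.1 i) < 0) → z.1 ∈ Vert := fun hz =>
    (Finset.mem_product.1 (Finset.mem_filter.1 hz).1).1
  rw [sum_signed_indicator_eq hV hpol, sum_signed_indicator_eq hV hpol']
  refine Finset.sum_eq_sum_of_key (fun z => simpleFace P z.1 (c z.1) z.2) _ (hinj ξ) (hinj ξ')
    (fun a ha => hex ξ' hpol' a (hmem ha)) (fun b hb => hex ξ hpol b (hmem hb))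
    fun a ha b hb e => ?_
  have ha' := hV _ (hmem ha)
  have hb' := hV _ (hmem hb)
  rw [(ha'.card_le_of_face_eq hb' e.symm).antisymm (hb'.card_le_of_face_eq ha' e)]
  exact congrArg _ (if_congr ⟨ha'.pos_of_face_eq hb' e.symm, hb'.pos_of_face_eq ha' e⟩ rfl rfl)

/-- **Independence of the polarization.**  For any two polarizing vectors
`ξ` and `ξ'` for the simple convex polytope `P`, the functions
`Σ_{p ∈ Vert} (−1)^{|E_p^+(ξ)|} 1_{Č_p^#(ξ)}` and
`Σ_{p ∈ Vert} (−1)^{|E_p^+(ξ')|} 1_{Č_p^#(ξ')}` agree on all of `V*`.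
`E` plays the role of the dual space `V*`, and vectors of `V` are represented
by functionals on `E` (via `V ≅ V**`), so that `⟨w, ξ⟩` becomes `ξ w`. -/
theorem dual_polarized_sum_independent_of_polarization
    {E : Type*} [NormedAddCommGroup E] [NormedSpace ℝ E] [FiniteDimensional ℝ E]
    {n : ℕ} (hdim : finrank ℝ E = n)
    (P : Set E) (Vert : Finset E) (w : E → Fin n → E)
    (hPcompact : IsCompact P)
    (hPhull : P = convexHull ℝ (Vert : Set E))
    (hindep : ∀ p ∈ Vert, LinearIndependent ℝ (w p))
    (hspan : ∀ p ∈ Vert, Submodule.span ℝ (Set.range (w p)) = ⊤)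
    (htangent : ∀ p ∈ Vert,
      {y : E | ∃ r : ℝ, 0 ≤ r ∧ ∃ x ∈ P, y = p + r • (x - p)} =
        {y : E | ∃ c : Fin n → ℝ, (∀ i, 0 ≤ c i) ∧ y = p + ∑ i, c i • w p i})
    (ξ ξ' : Module.Dual ℝ E)
    (hpol : ∀ p ∈ Vert, ∀ i, ξ (w p i) ≠ 0)
    (hpol' : ∀ p ∈ Vert, ∀ i, ξ' (w p i) ≠ 0) :
    (fun x : E =>
      ∑ p ∈ Vert,
        (-1 : ℝ) ^ Nat.card {i : Fin n // 0 < ξ (w p i)} *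
          Set.indicator
            {y : E | ∃ c : Fin n → ℝ,
              (∀ i, 0 < ξ (w p i) → 0 < c i) ∧
              (∀ i, ξ (w p i) < 0 → c i ≤ 0) ∧
              y = p + ∑ i, c i • w p i}
            (fun _ => (1 : ℝ)) x) =
    (fun x : E =>
      ∑ p ∈ Vert,
        (-1 : ℝ) ^ Nat.card {i : Fin n // 0 < ξ' (w p i)} *
          Set.indicator
            {y : E | ∃ c : Fin n → ℝ,
              (∀ i, 0 < ξ' (w p i) → 0 < c i) ∧
              (∀ i, ξ' (w p i) < 0 → c i ≤ 0) ∧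
              y = p + ∑ i, c i • w p i}
            (fun _ => (1 : ℝ)) x) := by
  have hfr : ∀ p ∈ Vert, ∃ c : Fin n → Dual ℝ E, IsSimpleVertex P p (w p) c := fun p hp =>
    exists_isSimpleVertex (hPhull ▸ subset_convexHull ℝ _ hp) (hindep p hp) (hspan p hp)
      (htangent p hp)
  choose! c hV using hfr
  exact funext (sum_signed_indicator_independent hPhull hV hpol hpol')
end

section
/- Polar decomposition of the cone over a polytope: For every polarizing vector ξ for P and every x ∈ V* × ℝ, Σ_{p ∈ Vert(P)} (−1)^{|E_p^+(ξ)|} 1_{K_p^#(ξ)}(x) = 1_C(x) + (−1)^n · 1_{−C°}(x), where C° is the interior of C in V* × ℝ. -/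
open Module

/-- The cone `C = {r(η, 1) : η ∈ P, r ≥ 0} ⊆ V* × ℝ` over a polytope `P ⊆ V*`. -/
def coneOverPolytope {E : Type*} [AddCommGroup E] [Module ℝ E] (P : Set E) :
    Set (E × ℝ) :=
  {z : E × ℝ | ∃ r : ℝ, 0 ≤ r ∧ ∃ η ∈ P, z = r • (η, (1 : ℝ))}

/-- The facet functionals, edge vectors and generators of the cone over a simple polytope, where
`vert` indexes the vertices and `height` is the functional equal to one on the polytope. -/
structure SimpleCone (W β : Type*) [AddCommGroup W] [Module ℝ W] (n : ℕ) where
  vert : Finset β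
  gen : β → W
  facets : Finset (Dual ℝ W)
  facet : β → Fin n → Dual ℝ W
  edge : β → Fin n → W
  height : Dual ℝ W
  facet_mem : ∀ p ∈ vert, ∀ i, facet p i ∈ facets
  facet_gen : ∀ p ∈ vert, ∀ i, facet p i (gen p) = 0
  exists_eq_facet : ∀ p ∈ vert, ∀ F ∈ facets, F (gen p) = 0 → ∃ i, F = facet p i
  nonneg : ∀ p ∈ vert, ∀ F ∈ facets, 0 ≤ F (gen p)
  facet_edge : ∀ p ∈ vert, ∀ i k, facet p i (edge p k) = if i = k then 1 else 0
  height_gen : ∀ p ∈ vert, height (gen p) = 1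
  height_edge : ∀ p ∈ vert, ∀ i, height (edge p i) = 0
  expansion : ∀ p ∈ vert, ∀ x, x = height x • gen p + ∑ i, facet p i x • edge p i
  exists_combination : ∀ x, (∀ F ∈ facets, 0 ≤ F x) →
    ∃ r : β → ℝ, (∀ p ∈ vert, 0 ≤ r p) ∧ x = ∑ p ∈ vert, r p • gen p
  gen_injOn : Set.InjOn gen vert
  exists_ne_zero : ∀ p ∈ vert, ∃ F ∈ facets, F (gen p) ≠ 0

namespace SimpleCone

open scoped Classical in
/-- The indicator of the nonnegative reals. -/
noncomputable def step (r : ℝ) : ℝ := if 0 ≤ r then 1 else 0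

variable {W β : Type*} [AddCommGroup W] [Module ℝ W] {n : ℕ}

theorem facet_injective (S : SimpleCone W β n) {p : β} (hp : p ∈ S.vert) :
    Function.Injective (S.facet p) := by
  intro i k h
  by_contra hik
  have h1 := S.facet_edge p hp i i
  rw [h, S.facet_edge p hp k i] at h1
  simp [Ne.symm hik] at h1

open scoped Classical in
/-- The vertices of the face cut out by the functionals in `J`. -/
noncomputable def faceVert (S : SimpleCone W β n) (J : Finset (Dual ℝ W)) : Finset β :=
  {p ∈ S.vert | ∀ F ∈ J, F (S.gen p) = 0}

theorem mem_faceVert (S : SimpleCone W β n) {J : Finset (Dual ℝ W)} {p : β} :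
    p ∈ S.faceVert J ↔ p ∈ S.vert ∧ ∀ F ∈ J, F (S.gen p) = 0 := by
  simp [faceVert]

theorem exists_combination_face (S : SimpleCone W β n) {J : Finset (Dual ℝ W)}
    (hJ : J ⊆ S.facets) {x : W} (hxJ : ∀ F ∈ J, F x = 0) (hx : ∀ F ∈ S.facets, 0 ≤ F x) :
    ∃ r : β → ℝ, (∀ p ∈ S.faceVert J, 0 ≤ r p) ∧ x = ∑ p ∈ S.faceVert J, r p • S.gen p := by
  classical
  obtain ⟨r, hr, hxr⟩ := S.exists_combination x hx
  refine ⟨r, fun p hp => hr p (S.mem_faceVert.1 hp).1, ?_⟩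
  rw [hxr]
  symm
  apply Finset.sum_subset (fun p hp => (S.mem_faceVert.1 hp).1)
  intro p hp hpJ
  have : ∃ F ∈ J, F (S.gen p) ≠ 0 := by
    by_contra! h
    exact hpJ (S.mem_faceVert.2 ⟨hp, h⟩)
  obtain ⟨F, hF, hFp⟩ := this
  have h0 := hxJ F hF
  rw [hxr, map_sum] at h0
  have h1 := (Finset.sum_eq_zero_iff_of_nonneg (fun v hv => by
    rw [map_smul, smul_eq_mul]
    exact mul_nonneg (hr v hv) (S.nonneg v hv F (hJ hF)))).1 h0 p hp
  rw [map_smul, smul_eq_mul] at h1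
  rw [(mul_eq_zero.1 h1).resolve_right hFp, zero_smul]

theorem eq_zero_of_faceVert_eq_empty (S : SimpleCone W β n) {J : Finset (Dual ℝ W)}
    (hJ : J ⊆ S.facets) {x : W} (hxJ : ∀ F ∈ J, F x = 0) (hx : ∀ F ∈ S.facets, 0 ≤ F x)
    (h : S.faceVert J = ∅) : x = 0 := by
  obtain ⟨r, -, hr⟩ := S.exists_combination_face hJ hxJ hx
  simpa [h] using hr

theorem facet_expansion (S : SimpleCone W β n) {p : β} (hp : p ∈ S.vert) (L : Dual ℝ W) (x : W) :
    L x = S.height x * L (S.gen p) + ∑ i, S.facet p i x * L (S.edge p i) := by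
  conv_lhs => rw [S.expansion p hp x]
  simp

theorem apply_edge_eq_zero (S : SimpleCone W β n) {J : Finset (Dual ℝ W)} (hJ : J ⊆ S.facets)
    {p : β} (hp : p ∈ S.faceVert J) {i : Fin n} (hi : S.facet p i ∉ J) {F : Dual ℝ W}
    (hF : F ∈ J) : F (S.edge p i) = 0 := by
  obtain ⟨hpv, hpJ⟩ := S.mem_faceVert.1 hp
  obtain ⟨k, rfl⟩ := S.exists_eq_facet p hpv F (hJ hF) (hpJ F hF)
  rw [S.facet_edge p hpv, if_neg]
  rintro rfl
  exact hi hF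

/-- A small displacement from a vertex stays strictly inside the facets not containing it. -/
theorem exists_pos_forall_pos (S : SimpleCone W β n) {p : β} (hp : p ∈ S.vert) (y : W) :
    ∃ ε : ℝ, 0 < ε ∧ ∀ F ∈ S.facets, F (S.gen p) ≠ 0 → 0 < F (S.gen p + ε • y) := by
  have h : ∀ᶠ ε : ℝ in nhdsWithin 0 (Set.Ioi 0), ∀ F ∈ S.facets, F (S.gen p) ≠ 0 →
      0 < F (S.gen p + ε • y) := by
    rw [Finset.eventually_all]
    intro F hF
    by_cases h0 : F (S.gen p) = 0
    · simp [h0]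
    have hpos : 0 < F (S.gen p) := lt_of_le_of_ne (S.nonneg p hp F hF) (Ne.symm h0)
    have hc : Filter.Tendsto (fun ε : ℝ => F (S.gen p) + ε * F y) (nhds 0)
        (nhds (F (S.gen p) + 0 * F y)) := by
      apply Continuous.tendsto
      fun_prop
    rw [zero_mul, add_zero] at hc
    filter_upwards [(hc.mono_left nhdsWithin_le_nhds).eventually (lt_mem_nhds hpos)] with ε hε _
    simpa using hε
  obtain ⟨ε, hε, hε0⟩ := (h.and self_mem_nhdsWithin).exists
  exact ⟨ε, hε0, hε⟩

theorem edge_nonpos_of_isMax (S : SimpleCone W β n) (ξ : Dual ℝ W) {J : Finset (Dual ℝ W)}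
    (hJ : J ⊆ S.facets) {q : β} (hq : q ∈ S.faceVert J)
    (hmax : ∀ p ∈ S.faceVert J, ξ (S.gen p) ≤ ξ (S.gen q)) {i : Fin n} (hi : S.facet q i ∉ J) :
    ξ (S.edge q i) ≤ 0 := by
  obtain ⟨hqv, hqJ⟩ := S.mem_faceVert.1 hq
  obtain ⟨ε, hε, hpos⟩ := S.exists_pos_forall_pos hqv (S.edge q i)
  obtain ⟨r, hr, hx⟩ := S.exists_combination_face hJ (x := S.gen q + ε • S.edge q i)
    (fun F hF => by simp [hqJ F hF, S.apply_edge_eq_zero hJ hq hi hF])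
    (fun F hF => by
      by_cases h0 : F (S.gen q) = 0
      · obtain ⟨k, rfl⟩ := S.exists_eq_facet q hqv F hF h0
        simp only [map_add, map_smul, h0, S.facet_edge q hqv, smul_eq_mul]
        split_ifs <;> simp [hε.le]
      · exact (hpos F hF h0).le)
  have h1 := congrArg S.height hx
  have h2 := congrArg ξ hx
  simp only [map_add, map_smul, map_sum, S.height_gen q hqv, S.height_edge q hqv, smul_eq_mul,
    mul_zero, add_zero] at h1 h2
  rw [Finset.sum_congr rfl (fun p hp => by
    rw [S.height_gen p (S.mem_faceVert.1 hp).1, mul_one])] at h1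
  have h3 : ∑ p ∈ S.faceVert J, r p * ξ (S.gen p) ≤ ∑ p ∈ S.faceVert J, r p * ξ (S.gen q) :=
    Finset.sum_le_sum fun p hp => mul_le_mul_of_nonneg_left (hmax p hp) (hr p hp)
  rw [← Finset.sum_mul, ← h1] at h3
  by_contra! h
  nlinarith [mul_pos hε h]

theorem eq_of_edge_neg (S : SimpleCone W β n) (ξ : Dual ℝ W)
    {J : Finset (Dual ℝ W)} {p q : β} (hp : p ∈ S.faceVert J) (hq : q ∈ S.faceVert J)
    (hneg : ∀ i, S.facet p i ∉ J → ξ (S.edge p i) < 0) (hle : ξ (S.gen p) ≤ ξ (S.gen q)) :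
    p = q := by
  obtain ⟨hpv, hpJ⟩ := S.mem_faceVert.1 hp
  obtain ⟨hqv, hqJ⟩ := S.mem_faceVert.1 hq
  have h1 := S.facet_expansion hpv ξ (S.gen q)
  rw [S.height_gen q hqv, one_mul] at h1
  have h0 : ∀ i ∈ Finset.univ, S.facet p i (S.gen q) * ξ (S.edge p i) ≤ 0 := by
    intro i _
    by_cases hi : S.facet p i ∈ J
    · simp [hqJ _ hi]
    · exact mul_nonpos_of_nonneg_of_nonpos (S.nonneg q hqv _ (S.facet_mem p hpv i)) (hneg i hi).le
  have h2 := (Finset.sum_eq_zero_iff_of_nonpos h0).1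
    (le_antisymm (Finset.sum_nonpos h0) (by linarith))
  have h3 : S.gen q = S.gen p := by
    rw [S.expansion p hpv (S.gen q), S.height_gen q hqv, one_smul, add_eq_left]
    refine Finset.sum_eq_zero fun i hi => ?_
    by_cases hiJ : S.facet p i ∈ J
    · rw [hqJ _ hiJ, zero_smul]
    · rw [(mul_eq_zero.1 (h2 i hi)).resolve_right (hneg i hiJ).ne, zero_smul]
  exact S.gen_injOn hpv hqv h3.symm

open scoped Classical in
/-- The signed indicator at the vertex `p` of the polarized tangent cone of the face `J`. -/
noncomputable def polarTerm (S : SimpleCone W β n) (ξ : Dual ℝ W) (J : Finset (Dual ℝ W)) (x : W)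
    (p : β) : ℝ :=
  ∏ i, if S.facet p i ∈ J then 1 else
    step (S.facet p i x) - if 0 < ξ (S.edge p i) then 1 else 0

theorem sum_polarTerm_of_nonneg (S : SimpleCone W β n) (ξ : Dual ℝ W)
    (hξ : ∀ p ∈ S.vert, ∀ i, ξ (S.edge p i) ≠ 0) {J : Finset (Dual ℝ W)} (hJ : J ⊆ S.facets)
    (hne : (S.faceVert J).Nonempty) {x : W} (hx : ∀ F ∈ S.facets, 0 ≤ F x) :
    ∑ p ∈ S.faceVert J, S.polarTerm ξ J x p = 1 := by
  classical
  obtain ⟨q, hq, hmax⟩ := (S.faceVert J).exists_max_image (fun p => ξ (S.gen p)) hne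
  have hneg : ∀ i, S.facet q i ∉ J → ξ (S.edge q i) < 0 := fun i hi =>
    lt_of_le_of_ne (S.edge_nonpos_of_isMax ξ hJ hq hmax hi) (hξ q (S.mem_faceVert.1 hq).1 i)
  have hstep : ∀ p ∈ S.faceVert J, ∀ i, step (S.facet p i x) = 1 := fun p hp i =>
    if_pos (hx _ (S.facet_mem p (S.mem_faceVert.1 hp).1 i))
  rw [Finset.sum_eq_single_of_mem q hq]
  · refine Finset.prod_eq_one fun i _ => ?_
    split_ifs with h1 h2
    · rfl
    · exact absurd h2 (hneg i h1).not_gt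
    · rw [hstep q hq, sub_zero]
  · intro p hp hpq
    have : ∃ i, S.facet p i ∉ J ∧ 0 ≤ ξ (S.edge p i) := by
      by_contra! h
      exact hpq (S.eq_of_edge_neg ξ hp hq h (hmax p hp))
    obtain ⟨i, hiJ, hi⟩ := this
    have hi' : 0 < ξ (S.edge p i) :=
      lt_of_le_of_ne hi (Ne.symm (hξ p (S.mem_faceVert.1 hp).1 i))
    refine Finset.prod_eq_zero (Finset.mem_univ i) ?_
    rw [if_neg hiJ, if_pos hi', hstep p hp, sub_self]

/-- A face of positive dimension contains, up to positive scaling, a point in its relative interior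
avoiding finitely many hyperplanes. -/
theorem exists_generic (S : SimpleCone W β n) {J : Finset (Dual ℝ W)} (hJ : J ⊆ S.facets)
    {p : β} (hp : p ∈ S.faceVert J) (T : Finset (Dual ℝ W)) :
    ∃ y : W, (∀ F ∈ J, F y = 0) ∧ (∀ F ∈ S.facets, F ∉ J → 0 < F y) ∧
      ∀ L ∈ T, (∃ v, (∀ F ∈ J, F v = 0) ∧ L v ≠ 0) → L y ≠ 0 := by
  classical
  obtain ⟨hpv, hpJ⟩ := S.mem_faceVert.1 hp
  set v₀ : W := ∑ i with S.facet p i ∉ J, S.edge p i with hv₀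
  obtain ⟨ε, hε, hpos⟩ := S.exists_pos_forall_pos hpv v₀
  set y₀ : W := S.gen p + ε • v₀ with hy₀
  have hy₀J : ∀ F ∈ J, F y₀ = 0 := by
    intro F hF
    rw [hy₀, hv₀, map_add, map_smul, map_sum, hpJ F hF, Finset.sum_eq_zero, smul_zero, add_zero]
    intro i hi
    exact S.apply_edge_eq_zero hJ hp (Finset.mem_filter.1 hi).2 hF
  have hy₀pos : ∀ F ∈ S.facets, F ∉ J → 0 < F y₀ := by
    intro F hF hFJ
    by_cases h0 : F (S.gen p) = 0
    · obtain ⟨k, rfl⟩ := S.exists_eq_facet p hpv F hF h0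
      simp [hy₀, hv₀, h0, S.facet_edge p hpv, hFJ, hε]
    · exact hpos F hF h0
  let U : Submodule ℝ W := ⨅ F ∈ J, LinearMap.ker F
  have hU : ∀ v, v ∈ U ↔ ∀ F ∈ J, F v = 0 := by simp [U, Submodule.mem_iInf]
  let T' : Finset (Dual ℝ W) := {L ∈ T | ∃ v, (∀ F ∈ J, F v = 0) ∧ L v ≠ 0}
  obtain ⟨u, huU, hu⟩ := Module.Dual.exists_forall_mem_ne_zero_of_forall_exists U
    (fun L : T' => (L : Dual ℝ W)) (fun L => by
      obtain ⟨v, hv, hLv⟩ := (Finset.mem_filter.1 L.2).2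
      exact ⟨v, (hU v).2 hv, hLv⟩)
  have hcont : ∀ F : Dual ℝ W, Filter.Tendsto (fun δ : ℝ => F y₀ + δ * F u)
      (nhdsWithin 0 (Set.Ioi 0)) (nhds (F y₀)) := by
    intro F
    have : Filter.Tendsto (fun δ : ℝ => F y₀ + δ * F u) (nhds 0) (nhds (F y₀ + 0 * F u)) :=
      Continuous.tendsto (by fun_prop) 0
    rw [zero_mul, add_zero] at this
    exact this.mono_left nhdsWithin_le_nhds
  have h1 : ∀ᶠ δ : ℝ in nhdsWithin 0 (Set.Ioi 0), ∀ F ∈ S.facets, F ∉ J → 0 < F (y₀ + δ • u) := by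
    rw [Finset.eventually_all]
    intro F hF
    by_cases hFJ : F ∈ J
    · simp [hFJ]
    filter_upwards [(hcont F).eventually (lt_mem_nhds (hy₀pos F hF hFJ))] with δ hδ _
    simpa using hδ
  have h2 : ∀ᶠ δ : ℝ in nhdsWithin 0 (Set.Ioi 0), ∀ L ∈ T', L (y₀ + δ • u) ≠ 0 := by
    rw [Finset.eventually_all]
    intro L hL
    by_cases h0 : L y₀ = 0
    · filter_upwards [self_mem_nhdsWithin] with δ hδ
      simpa [h0] using ⟨(Set.mem_Ioi.1 hδ).ne', hu ⟨L, hL⟩⟩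
    · filter_upwards [(hcont L).eventually (isOpen_ne.mem_nhds h0)] with δ hδ
      simpa using hδ
  obtain ⟨δ, hδ1, hδ2⟩ := (h1.and h2).exists
  refine ⟨y₀ + δ • u, fun F hF => ?_, hδ1, fun L hL hv => hδ2 L (Finset.mem_filter.2 ⟨hL, hv⟩)⟩
  rw [map_add, map_smul, hy₀J F hF, (hU u).1 huU F hF, smul_zero, add_zero]

/-- Moving `x` into a generic direction interior to the face until it first crosses a facet
hyperplane; the hyperplanes crossed at that moment have the same trace on the face. -/
theorem exists_crossing (S : SimpleCone W β n) {J : Finset (Dual ℝ W)} (hJ : J ⊆ S.facets)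
    {p : β} (hp : p ∈ S.faceVert J) {x : W} (hxJ : ∀ F ∈ J, F x = 0)
    (hx : ∃ F ∈ S.facets, F x < 0) :
    ∃ z : W, (∀ F ∈ J, F z = 0) ∧ (∀ F ∈ S.facets, F ∉ J → 0 ≤ F x → 0 < F z) ∧
      (∀ F ∈ S.facets, F x < 0 → F z ≤ 0) ∧ (∃ F ∈ S.facets, F x < 0 ∧ F z = 0) ∧
      ∀ F ∈ S.facets, ∀ G ∈ S.facets, F x < 0 → G x < 0 → F z = 0 → G z = 0 →
        ∀ v, (∀ H ∈ J, H v = 0) → F x * G v = G x * F v := by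
  classical
  obtain ⟨y, hyJ, hy, hgen⟩ := S.exists_generic hJ hp
    ((S.facets ×ˢ S.facets).image fun q => q.1 x • q.2 - q.2 x • q.1)
  have hnJ : ∀ F, F x < 0 → F ∉ J := fun F hF h => hF.ne (hxJ F h)
  have hne : ({F ∈ S.facets | F x < 0}).Nonempty := by
    obtain ⟨F, hF, hFx⟩ := hx
    exact ⟨F, Finset.mem_filter.2 ⟨hF, hFx⟩⟩
  obtain ⟨F₀, hF₀, hmin⟩ := Finset.exists_min_image _ (fun F : Dual ℝ W => -F x / F y) hne
  obtain ⟨hF₀S, hF₀x⟩ := Finset.mem_filter.1 hF₀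
  set ρ : ℝ := -F₀ x / F₀ y with hρ
  have hρ0 : 0 < ρ := div_pos (neg_pos.2 hF₀x) (hy F₀ hF₀S (hnJ F₀ hF₀x))
  have hz : ∀ F : Dual ℝ W, F (x + ρ • y) = F x + ρ * F y := by simp
  refine ⟨x + ρ • y, fun F hF => ?_, fun F hF hFJ hFx => ?_, fun F hF hFx => ?_,
    ⟨F₀, hF₀S, hF₀x, ?_⟩, fun F hF G hG hFx hGx hFz hGz v hv => ?_⟩
  · rw [hz, hxJ F hF, hyJ F hF, mul_zero, add_zero]
  · rw [hz]
    have := mul_pos hρ0 (hy F hF hFJ)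
    linarith
  · rw [hz]
    have h := hmin F (Finset.mem_filter.2 ⟨hF, hFx⟩)
    rw [le_div_iff₀ (hy F hF (hnJ F hFx))] at h
    linarith
  · rw [hz, hρ, div_mul_cancel₀ _ (hy F₀ hF₀S (hnJ F₀ hF₀x)).ne']
    ring
  · by_contra hv'
    refine hgen (F x • G - G x • F)
      (Finset.mem_image.2 ⟨(F, G), Finset.mem_product.2 ⟨hF, hG⟩, rfl⟩)
      ⟨v, hv, by simpa [sub_eq_zero] using hv'⟩ ?_
    rw [hz] at hFz hGz
    have h1 : F x = -(ρ * F y) := by linarith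
    have h2 : G x = -(ρ * G y) := by linarith
    simp only [LinearMap.sub_apply, LinearMap.smul_apply, smul_eq_mul, h1, h2]
    ring

theorem step_of_neg {r : ℝ} (h : r < 0) : step r = 0 := if_neg h.not_ge

theorem step_of_nonneg {r : ℝ} (h : 0 ≤ r) : step r = 1 := if_pos h

theorem polarTerm_congr (S : SimpleCone W β n) (ξ : Dual ℝ W) {J : Finset (Dual ℝ W)} {x z : W}
    {p : β} (h : ∀ i, S.facet p i ∉ J → step (S.facet p i x) = step (S.facet p i z)) :
    S.polarTerm ξ J x p = S.polarTerm ξ J z p := by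
  classical
  refine Finset.prod_congr rfl fun i _ => ?_
  split_ifs with h1
  · rfl
  all_goals rw [h i h1]

open scoped Classical in
theorem polarTerm_crossing (S : SimpleCone W β n) (ξ : Dual ℝ W) {J : Finset (Dual ℝ W)}
    {x z : W} {p : β} (hp : p ∈ S.vert) {i₀ : Fin n} (hi₀ : S.facet p i₀ ∉ J)
    (hx : S.facet p i₀ x < 0) (hz : S.facet p i₀ z = 0)
    (h : ∀ i, S.facet p i ∉ J → i ≠ i₀ → step (S.facet p i x) = step (S.facet p i z)) :
    S.polarTerm ξ J x p =
      S.polarTerm ξ J z p - S.polarTerm ξ (insert (S.facet p i₀) J) z p := by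
  unfold polarTerm
  rw [← Finset.mul_prod_erase _ _ (Finset.mem_univ i₀),
    ← Finset.mul_prod_erase _ _ (Finset.mem_univ i₀),
    ← Finset.mul_prod_erase _ _ (Finset.mem_univ i₀)]
  have h1 : ∀ i ∈ Finset.univ.erase i₀, (if S.facet p i ∈ J then (1 : ℝ) else
      step (S.facet p i x) - if 0 < ξ (S.edge p i) then 1 else 0) =
      if S.facet p i ∈ J then 1 else
      step (S.facet p i z) - if 0 < ξ (S.edge p i) then 1 else 0 := by
    intro i hi
    split_ifs with h1
    · rfl
    all_goals rw [h i h1 (Finset.ne_of_mem_erase hi)]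
  have h2 : ∀ i ∈ Finset.univ.erase i₀, (if S.facet p i ∈ insert (S.facet p i₀) J then (1 : ℝ) else
      step (S.facet p i z) - if 0 < ξ (S.edge p i) then 1 else 0) =
      if S.facet p i ∈ J then 1 else
      step (S.facet p i z) - if 0 < ξ (S.edge p i) then 1 else 0 := by
    intro i hi
    have hne : S.facet p i ≠ S.facet p i₀ :=
      fun h => Finset.ne_of_mem_erase hi (S.facet_injective hp h)
    simp only [Finset.mem_insert, hne, false_or]
  rw [Finset.prod_congr rfl h1, Finset.prod_congr rfl h2, if_neg hi₀, if_neg hi₀,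
    if_pos (Finset.mem_insert_self _ _), step_of_neg hx, hz, step_of_nonneg le_rfl]
  ring

open scoped Classical in
theorem sum_polarTerm_of_vertex (S : SimpleCone W β n) (ξ : Dual ℝ W)
    {J : Finset (Dual ℝ W)} (hJ : J ⊆ S.facets) {p : β} (hp : p ∈ S.faceVert J)
    (hfull : ∀ i, S.facet p i ∈ J) {x : W} (hxJ : ∀ F ∈ J, F x = 0) :
    ∑ q ∈ S.faceVert J, S.polarTerm ξ J x q =
      (if ∀ F ∈ S.facets, 0 ≤ F x then 1 else 0) +
        (-1) ^ (n + J.card) * (if ∀ F ∈ S.facets, F ∉ J → F x < 0 then 1 else 0) := by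
  obtain ⟨hpv, hpJ⟩ := S.mem_faceVert.1 hp
  have hJim : J = Finset.univ.image (S.facet p) := by
    ext F
    refine ⟨fun hF => ?_, fun hF => ?_⟩
    · obtain ⟨i, rfl⟩ := S.exists_eq_facet p hpv F (hJ hF) (hpJ F hF)
      exact Finset.mem_image_of_mem _ (Finset.mem_univ i)
    · obtain ⟨i, -, rfl⟩ := Finset.mem_image.1 hF
      exact hfull i
  have hcard : J.card = n := by
    rw [hJim, Finset.card_image_of_injective _ (S.facet_injective hpv), Finset.card_univ,
      Fintype.card_fin]
  have hprop : ∀ y : W, (∀ F ∈ J, F y = 0) → y = S.height y • S.gen p := by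
    intro y hy
    conv_lhs => rw [S.expansion p hpv y]
    rw [Finset.sum_eq_zero (fun i _ => by rw [hy _ (hfull i), zero_smul]), add_zero]
  have hV : S.faceVert J = {p} := by
    refine Finset.eq_singleton_iff_unique_mem.2 ⟨hp, fun q hq => ?_⟩
    obtain ⟨hqv, hqJ⟩ := S.mem_faceVert.1 hq
    refine S.gen_injOn hqv hpv ?_
    rw [hprop _ hqJ, S.height_gen q hqv, one_smul]
  have hterm : S.polarTerm ξ J x p = 1 := Finset.prod_eq_one fun i _ => if_pos (hfull i)
  have hFx : ∀ F : Dual ℝ W, F x = S.height x * F (S.gen p) := fun F => by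
    conv_lhs => rw [hprop x hxJ]
    simp
  obtain ⟨F, hF, hFp⟩ := S.exists_ne_zero p hpv
  have hFpos : 0 < F (S.gen p) := lt_of_le_of_ne (S.nonneg p hpv F hF) (Ne.symm hFp)
  rw [hV, Finset.sum_singleton, hterm, hcard, Even.neg_one_pow ⟨n, rfl⟩, one_mul]
  rcases le_or_gt 0 (S.height x) with h | h
  · rw [if_pos, if_neg, add_zero]
    · push Not
      exact ⟨F, hF, fun h => hFp (hpJ F h), by rw [hFx]; positivity⟩
    · intro G hG
      rw [hFx]
      exact mul_nonneg h (S.nonneg p hpv G hG)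
  · rw [if_neg, if_pos, zero_add]
    · intro G hG hGJ
      rw [hFx]
      refine mul_neg_of_neg_of_pos h (lt_of_le_of_ne (S.nonneg p hpv G hG) (Ne.symm fun h0 => ?_))
      obtain ⟨i, rfl⟩ := S.exists_eq_facet p hpv G hG h0
      exact hGJ (hfull i)
    · push Not
      exact ⟨F, hF, by rw [hFx]; exact mul_neg_of_neg_of_pos h hFpos⟩

open scoped Classical in
/-- The polar decomposition of the face of a simple cone cut out by the functionals in `J`. -/
theorem sum_polarTerm (S : SimpleCone W β n) (ξ : Dual ℝ W)
    (hξ : ∀ p ∈ S.vert, ∀ i, ξ (S.edge p i) ≠ 0) {J : Finset (Dual ℝ W)} (hJ : J ⊆ S.facets)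
    (hne : (S.faceVert J).Nonempty) {x : W} (hxJ : ∀ F ∈ J, F x = 0) :
    ∑ p ∈ S.faceVert J, S.polarTerm ξ J x p =
      (if ∀ F ∈ S.facets, 0 ≤ F x then 1 else 0) +
        (-1) ^ (n + J.card) * (if ∀ F ∈ S.facets, F ∉ J → F x < 0 then 1 else 0) := by
  induction hm : ({F ∈ S.facets | F x < 0}).card using Nat.strong_induction_on
    generalizing J x with
  | _ m ih =>
  subst hm
  obtain ⟨p, hp⟩ := hne
  obtain ⟨hpv, hpJ⟩ := S.mem_faceVert.1 hp
  by_cases hfull : ∀ i, S.facet p i ∈ J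
  · exact S.sum_polarTerm_of_vertex ξ hJ hp hfull hxJ
  push Not at hfull
  obtain ⟨k, hk⟩ := hfull
  by_cases hx : ∀ F ∈ S.facets, 0 ≤ F x
  · rw [S.sum_polarTerm_of_nonneg ξ hξ hJ ⟨p, hp⟩ hx, if_pos hx, if_neg, mul_zero, add_zero]
    intro h
    exact (h _ (S.facet_mem p hpv k) hk).not_ge (hx _ (S.facet_mem p hpv k))
  rw [if_neg hx, zero_add]
  push Not at hx
  obtain ⟨z, hzJ, hzpos, hzneg, ⟨F₁, hF₁, hF₁x, hF₁z⟩, hpar⟩ := S.exists_crossing hJ hp hxJ hx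
  have hnJ : ∀ F, F x < 0 → F ∉ J := fun F hF h => hF.ne (hxJ F h)
  have hlt : ({F ∈ S.facets | F z < 0}).card < ({F ∈ S.facets | F x < 0}).card := by
    refine Finset.card_lt_card (Finset.ssubset_iff_of_subset ?_ |>.2
      ⟨F₁, Finset.mem_filter.2 ⟨hF₁, hF₁x⟩, fun h => (Finset.mem_filter.1 h).2.ne hF₁z⟩)
    intro F hF
    obtain ⟨hF, hFz⟩ := Finset.mem_filter.1 hF
    refine Finset.mem_filter.2 ⟨hF, ?_⟩
    by_contra! hFx
    by_cases hFJ : F ∈ J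
    · exact hFz.ne (hzJ F hFJ)
    · exact (hzpos F hF hFJ hFx).not_gt hFz
  have hsame : ∀ F ∈ S.facets, F ∉ J → (F x < 0 → F z ≠ 0) → step (F x) = step (F z) := by
    intro F hF hFJ h
    rcases lt_or_ge (F x) 0 with hFx | hFx
    · rw [step_of_neg hFx, step_of_neg (lt_of_le_of_ne (hzneg F hF hFx) (h hFx))]
    · rw [step_of_nonneg hFx, step_of_nonneg (hzpos F hF hFJ hFx).le]
  have ihz := ih _ hlt hJ ⟨p, hp⟩ hzJ rfl
  have hnotneg : ¬ ∀ F ∈ S.facets, F ∉ J → F z < 0 := fun h =>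
    (h F₁ hF₁ (hnJ F₁ hF₁x)).ne hF₁z
  rw [if_neg hnotneg, mul_zero, add_zero] at ihz
  by_cases hrel : ∃ F₀ ∈ S.facets, F₀ x < 0 ∧ F₀ z = 0 ∧ (S.faceVert (insert F₀ J)).Nonempty
  · obtain ⟨F₀, hF₀, hF₀x, hF₀z, hne₀⟩ := hrel
    have hF₀J : F₀ ∉ J := hnJ F₀ hF₀x
    have hJ₀ : insert F₀ J ⊆ S.facets := Finset.insert_subset hF₀ hJ
    have huniq : ∀ G ∈ S.facets, G x < 0 → G z = 0 → G = F₀ := by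
      intro G hG hGx hGz
      obtain ⟨q, hq⟩ := hne₀
      obtain ⟨hqv, hqJ⟩ := S.mem_faceVert.1 hq
      have hqJ' : q ∈ S.faceVert J :=
        S.mem_faceVert.2 ⟨hqv, fun F hF => hqJ F (Finset.mem_insert_of_mem hF)⟩
      have hF₀q := hqJ F₀ (Finset.mem_insert_self _ _)
      have h1 := hpar F₀ hF₀ G hG hF₀x hGx hF₀z hGz (S.gen q) (S.mem_faceVert.1 hqJ').2
      rw [hF₀q, mul_zero] at h1
      obtain ⟨l, rfl⟩ := S.exists_eq_facet q hqv G hG ((mul_eq_zero.1 h1).resolve_left hF₀x.ne)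
      obtain ⟨i, rfl⟩ := S.exists_eq_facet q hqv F₀ hF₀ hF₀q
      have h2 := hpar _ hF₀ _ hG hF₀x hGx hF₀z hGz (S.edge q i)
        (fun F hF => S.apply_edge_eq_zero hJ hqJ' hF₀J hF)
      rw [S.facet_edge q hqv, S.facet_edge q hqv, if_pos rfl, mul_one] at h2
      by_cases hli : l = i
      · rw [hli]
      · rw [if_neg hli, mul_zero] at h2
        exact absurd h2.symm hGx.ne
    have hz₀ : ∀ F ∈ insert F₀ J, F z = 0 := by
      intro F hF
      rcases Finset.mem_insert.1 hF with rfl | hF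
      exacts [hF₀z, hzJ F hF]
    have ih₀ := ih _ hlt hJ₀ hne₀ hz₀ rfl
    have hsub : S.faceVert (insert F₀ J) ⊆ S.faceVert J := fun q hq =>
      S.mem_faceVert.2 ⟨(S.mem_faceVert.1 hq).1,
        fun F hF => (S.mem_faceVert.1 hq).2 F (Finset.mem_insert_of_mem hF)⟩
    have hsum : ∑ q ∈ S.faceVert J, S.polarTerm ξ J x q = ∑ q ∈ S.faceVert J, S.polarTerm ξ J z q -
        ∑ q ∈ S.faceVert (insert F₀ J), S.polarTerm ξ (insert F₀ J) z q := by
      rw [← Finset.sum_sdiff hsub, ← Finset.sum_sdiff hsub (f := fun q => S.polarTerm ξ J z q),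
        add_sub_assoc, ← Finset.sum_sub_distrib]
      congr 1
      · refine Finset.sum_congr rfl fun q hq => ?_
        obtain ⟨hqJ, hq₀⟩ := Finset.mem_sdiff.1 hq
        obtain ⟨hqv, hqJ'⟩ := S.mem_faceVert.1 hqJ
        refine S.polarTerm_congr ξ fun i hi => hsame _ (S.facet_mem q hqv i) hi fun hix hiz => ?_
        have := huniq _ (S.facet_mem q hqv i) hix hiz
        refine hq₀ (S.mem_faceVert.2 ⟨hqv, fun F hF => ?_⟩)
        rcases Finset.mem_insert.1 hF with rfl | hF
        exacts [this ▸ S.facet_gen q hqv i, hqJ' F hF]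
      · refine Finset.sum_congr rfl fun q hq => ?_
        obtain ⟨hqv, hqJ⟩ := S.mem_faceVert.1 hq
        obtain ⟨i, hi⟩ := S.exists_eq_facet q hqv F₀ hF₀ (hqJ F₀ (Finset.mem_insert_self _ _))
        subst hi
        refine S.polarTerm_crossing ξ hqv hF₀J hF₀x hF₀z fun l hl hli =>
          hsame _ (S.facet_mem q hqv l) hl fun hlx hlz => hli ?_
        exact S.facet_injective hqv (huniq _ (S.facet_mem q hqv l) hlx hlz)
    have hiff : (∀ F ∈ S.facets, F ∉ insert F₀ J → F z < 0) ↔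
        ∀ F ∈ S.facets, F ∉ J → F x < 0 := by
      refine ⟨fun h F hF hFJ => ?_, fun h F hF hFJ => ?_⟩
      · by_contra! hFx
        have hFne : F ≠ F₀ := fun h => by
          rw [h] at hFx
          exact hFx.not_gt hF₀x
        exact (h F hF (by simp [hFne, hFJ])).not_gt (hzpos F hF hFJ hFx)
      · simp only [Finset.mem_insert, not_or] at hFJ
        have hFx := h F hF hFJ.2
        exact lt_of_le_of_ne (hzneg F hF hFx) fun h0 => hFJ.1 (huniq F hF hFx h0)
    rw [hsum, ihz, ih₀, Finset.card_insert_of_notMem hF₀J, ← add_assoc, pow_succ]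
    simp only [hiff]
    ring
  · push Not at hrel
    have hirr : ∀ q ∈ S.faceVert J, ∀ i, S.facet q i ∉ J → S.facet q i x < 0 →
        S.facet q i z ≠ 0 := by
      intro q hq i _ hix hiz
      obtain ⟨hqv, hqJ⟩ := S.mem_faceVert.1 hq
      have h := hrel _ (S.facet_mem q hqv i) hix hiz
      refine Finset.notMem_empty q (h ▸ S.mem_faceVert.2 ⟨hqv, fun F hF => ?_⟩)
      rcases Finset.mem_insert.1 hF with rfl | hF
      exacts [S.facet_gen q hqv i, hqJ F hF]
    have hsum : ∑ q ∈ S.faceVert J, S.polarTerm ξ J x q =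
        ∑ q ∈ S.faceVert J, S.polarTerm ξ J z q :=
      Finset.sum_congr rfl fun q hq => S.polarTerm_congr ξ fun i hi =>
        hsame _ (S.facet_mem q (S.mem_faceVert.1 hq).1 i) hi (hirr q hq i hi)
    have hkz : S.facet p k z ≠ 0 := by
      rcases lt_or_ge (S.facet p k x) 0 with h | h
      · exact hirr p hp k hk h
      · exact (hzpos _ (S.facet_mem p hpv k) hk h).ne'
    have hempty := hrel F₁ hF₁ hF₁x hF₁z
    have hJ₁ : insert F₁ J ⊆ S.facets := Finset.insert_subset hF₁ hJ
    have hz₁ : ∀ F ∈ insert F₁ J, F z = 0 := by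
      intro F hF
      rcases Finset.mem_insert.1 hF with rfl | hF
      exacts [hF₁z, hzJ F hF]
    rw [hsum, ihz, if_neg, if_neg, mul_zero]
    · intro h
      have h0 := S.eq_zero_of_faceVert_eq_empty hJ₁ (x := -z)
        (fun F hF => by rw [map_neg, hz₁ F hF, neg_zero])
        (fun F hF => by
          rw [map_neg, Left.nonneg_neg_iff]
          by_cases hFJ : F ∈ J
          · exact (hzJ F hFJ).le
          · exact hzneg F hF (h F hF hFJ)) hempty
      rw [neg_eq_zero] at h0
      exact hkz (by rw [h0, map_zero])
    · intro h
      have h0 := S.eq_zero_of_faceVert_eq_empty hJ₁ hz₁ h hempty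
      exact hkz (by rw [h0, map_zero])

end SimpleCone

section Polytope

variable {E : Type*} [NormedAddCommGroup E] [NormedSpace ℝ E]

theorem exists_cone_coordinates {n : ℕ} {p : E} {w : Fin n → E} (hli : LinearIndependent ℝ w)
    (hsp : Submodule.span ℝ (Set.range w) = ⊤) :
    ∃ f : Fin n → Dual ℝ (E × ℝ), (∀ i, f i (p, 1) = 0) ∧
      (∀ i k, f i (w k, 0) = if i = k then 1 else 0) ∧
      ∀ x : E × ℝ, x = x.2 • (p, (1 : ℝ)) + ∑ i, f i x • (w i, (0 : ℝ)) := by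
  let b : Basis (Fin n) ℝ E := Basis.mk hli hsp.ge
  refine ⟨fun i => b.coord i ∘ₗ
    (LinearMap.fst ℝ E ℝ - (LinearMap.snd ℝ E ℝ).smulRight p), fun i => by simp, fun i k => ?_,
    fun x => ?_⟩
  · have hk : w k = b k := by simp [b]
    simp [hk, Finsupp.single_apply, eq_comm]
  · have h := b.sum_repr (x.1 - x.2 • p)
    have hb : ∀ i, b i = w i := fun i => by simp [b]
    simp only [hb] at h
    ext
    · simp [Prod.fst_sum, -map_sub, h]
    · simp [Prod.snd_sum]

theorem mem_coneOverPolytope_convexHull {Vert : Finset E} {x : E × ℝ}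
    (hx : x ∈ coneOverPolytope (convexHull ℝ (Vert : Set E))) :
    ∃ r : E → ℝ, (∀ p ∈ Vert, 0 ≤ r p) ∧ x = ∑ p ∈ Vert, r p • (p, (1 : ℝ)) := by
  obtain ⟨r, hr, η, hη, rfl⟩ := hx
  obtain ⟨u, hu, hu1, rfl⟩ := Finset.mem_convexHull'.1 hη
  refine ⟨fun v => r * u v, fun v hv => mul_nonneg hr (hu v hv), ?_⟩
  ext
  · simp [Prod.fst_sum, Finset.smul_sum, mul_smul]
  · simp [Prod.snd_sum, ← Finset.mul_sum, hu1]

theorem exists_simpleCone {n : ℕ} (hn : 0 < n) {P : Set E} {Vert : Finset E} {w : E → Fin n → E}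
    (hne : Vert.Nonempty) (hPcompact : IsCompact P)
    (hPhull : P = convexHull ℝ (Vert : Set E))
    (hindep : ∀ p ∈ Vert, LinearIndependent ℝ (w p))
    (hspan : ∀ p ∈ Vert, Submodule.span ℝ (Set.range (w p)) = ⊤)
    (htangent : ∀ p ∈ Vert,
      {y : E | ∃ r : ℝ, 0 ≤ r ∧ ∃ x ∈ P, y = p + r • (x - p)} =
        {y : E | ∃ c : Fin n → ℝ, (∀ i, 0 ≤ c i) ∧ y = p + ∑ i, c i • w p i}) :
    ∃ (S : SimpleCone (E × ℝ) E n) (N : E → Fin n → ℝ), S.vert = Vert ∧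
      (∀ p, S.gen p = (p, 1)) ∧ (∀ p ∈ Vert, ∀ i, 0 < N p i) ∧
      (∀ p i, S.edge p i = (N p i • w p i, 0)) ∧ (∀ x, S.height x = x.2) ∧
      coneOverPolytope P = {x | ∀ F ∈ S.facets, 0 ≤ F x} := by
  classical
  have hVP : ∀ v ∈ Vert, v ∈ P := fun v hv => hPhull ▸ subset_convexHull ℝ _ hv
  have hcoord : ∀ p, ∃ f : Fin n → Dual ℝ (E × ℝ), p ∈ Vert → (∀ i, f i (p, 1) = 0) ∧
      (∀ i k, f i (w p k, 0) = if i = k then 1 else 0) ∧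
      ∀ x : E × ℝ, x = x.2 • (p, (1 : ℝ)) + ∑ i, f i x • (w p i, (0 : ℝ)) := by
    intro p
    by_cases hp : p ∈ Vert
    · obtain ⟨f, hf⟩ := exists_cone_coordinates (p := p) (hindep p hp) (hspan p hp)
      exact ⟨f, fun _ => hf⟩
    · exact ⟨0, fun h => absurd h hp⟩
  choose f hf using hcoord
  have hexp : ∀ p ∈ Vert, ∀ (L : Dual ℝ (E × ℝ)) (x : E × ℝ),
      L x = x.2 * L (p, 1) + ∑ i, f p i x * L (w p i, 0) := by
    intro p hp L x
    conv_lhs => rw [(hf p hp).2.2 x]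
    simp only [map_add, map_smul, map_sum, smul_eq_mul]
  have hfnonneg : ∀ p ∈ Vert, ∀ q ∈ Vert, ∀ i, 0 ≤ f p i (q, 1) := by
    intro p hp q hq i
    have h : q ∈ {y : E | ∃ r : ℝ, 0 ≤ r ∧ ∃ x ∈ P, y = p + r • (x - p)} :=
      ⟨1, zero_le_one, q, hVP q hq, by simp⟩
    rw [htangent p hp] at h
    obtain ⟨c, hc, hqc⟩ := h
    have h1 : (q, (1 : ℝ)) = (p, 1) + ∑ k, c k • (w p k, (0 : ℝ)) := by
      ext
      · simp [Prod.fst_sum, ← hqc]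
      · simp [Prod.snd_sum]
    rw [h1, map_add, (hf p hp).1, map_sum]
    simp only [map_smul, (hf p hp).2.1, smul_eq_mul]
    simp [hc i]
  have hedge : ∀ p ∈ Vert, ∀ i, ∃ a : E → ℝ, (∀ v ∈ Vert, 0 ≤ a v) ∧
      w p i = ∑ v ∈ Vert, a v • (v - p) := by
    intro p hp i
    have h : p + w p i ∈ {y : E | ∃ c : Fin n → ℝ, (∀ i, 0 ≤ c i) ∧ y = p + ∑ i, c i • w p i} :=
      ⟨fun k => if k = i then 1 else 0, fun k => by positivity, by simp⟩
    rw [← htangent p hp] at h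
    obtain ⟨r, hr, x, hx, hxw⟩ := h
    rw [hPhull] at hx
    obtain ⟨u, hu, hu1, rfl⟩ := Finset.mem_convexHull'.1 hx
    refine ⟨fun v => r * u v, fun v hv => mul_nonneg hr (hu v hv), ?_⟩
    rw [add_right_inj] at hxw
    rw [hxw]
    simp only [mul_smul, ← Finset.smul_sum, smul_sub, Finset.sum_sub_distrib]
    rw [← Finset.sum_smul, hu1, one_smul]
  have hedge' : ∀ p ∈ Vert, ∀ i, ∃ a : E → ℝ, (∀ v ∈ Vert, 0 ≤ a v) ∧
      ∀ L : Dual ℝ (E × ℝ), L (w p i, 0) = ∑ v ∈ Vert, a v * (L (v, 1) - L (p, 1)) := by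
    intro p hp i
    obtain ⟨a, ha, haw⟩ := hedge p hp i
    refine ⟨a, ha, fun L => ?_⟩
    have h1 : (w p i, (0 : ℝ)) = ∑ v ∈ Vert, a v • ((v, (1 : ℝ)) - (p, (1 : ℝ))) := by
      ext
      · simp [Prod.fst_sum, ← haw]
      · simp [Prod.snd_sum]
    rw [h1]
    simp only [map_sum, map_smul, map_sub, smul_eq_mul]
  let N : E → Fin n → ℝ := fun p i => ∑ v ∈ Vert, f p i (v, 1)
  have hN : ∀ p ∈ Vert, ∀ i, 0 < N p i := by
    intro p hp i
    refine lt_of_le_of_ne (Finset.sum_nonneg fun v hv => hfnonneg p hp v hv i) fun h => ?_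
    have h0 := (Finset.sum_eq_zero_iff_of_nonneg fun v hv => hfnonneg p hp v hv i).1 h.symm
    obtain ⟨a, -, ha⟩ := hedge' p hp i
    have h1 := ha (f p i)
    rw [(hf p hp).2.1, if_pos rfl, (hf p hp).1,
      Finset.sum_eq_zero fun v hv => by rw [h0 v hv, sub_zero, mul_zero]] at h1
    exact one_ne_zero h1
  let φ : E → Fin n → Dual ℝ (E × ℝ) := fun p i => (N p i)⁻¹ • f p i
  have hφ : ∀ p i x, φ p i x = (N p i)⁻¹ * f p i x := fun p i x => rfl
  have hφ0 : ∀ p ∈ Vert, ∀ i x, φ p i x = 0 ↔ f p i x = 0 := fun p hp i x => by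
    rw [hφ, mul_eq_zero, or_iff_right (inv_ne_zero (hN p hp i).ne')]
  have hφnonneg : ∀ p ∈ Vert, ∀ i x, 0 ≤ φ p i x ↔ 0 ≤ f p i x := fun p hp i x => by
    rw [hφ, mul_nonneg_iff_of_pos_left (inv_pos.2 (hN p hp i))]
  have hshared : ∀ p ∈ Vert, ∀ q ∈ Vert, ∀ i, φ p i (q, 1) = 0 → ∃ k, φ p i = φ q k := by
    intro p hp q hq i hpq
    rw [hφ0 p hp] at hpq
    have hpos : ∀ k, 0 ≤ f p i (w q k, 0) := by
      intro k
      obtain ⟨a, ha, haL⟩ := hedge' q hq k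
      rw [haL]
      refine Finset.sum_nonneg fun v hv => mul_nonneg (ha v hv) ?_
      rw [hpq, sub_zero]
      exact hfnonneg p hp v hv i
    have hk : ∃ k, f p i (w q k, 0) ≠ 0 := by
      by_contra! h
      have h1 := hexp q hq (f p i) (w p i, 0)
      simp [(hf p hp).2.1, h] at h1
    obtain ⟨k, hk⟩ := hk
    have hzero : ∀ v ∈ Vert, f p i (v, 1) = 0 → f q k (v, 1) = 0 := by
      intro v hv h
      rw [hexp q hq, hpq, mul_zero, zero_add, Finset.sum_eq_zero_iff_of_nonneg
        fun l _ => mul_nonneg (hfnonneg q hq v hv l) (hpos l)] at h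
      exact (mul_eq_zero.1 (h k (Finset.mem_univ k))).resolve_right hk
    have hqkp := hzero p hp ((hf p hp).1 i)
    have hother : ∀ l, l ≠ i → f q k (w p l, 0) = 0 := by
      intro l hl
      obtain ⟨a, ha, haL⟩ := hedge' p hp l
      have h := haL (f p i)
      rw [(hf p hp).2.1, if_neg (Ne.symm hl), eq_comm, (hf p hp).1,
        Finset.sum_eq_zero_iff_of_nonneg fun v hv => mul_nonneg (ha v hv)
          (by rw [sub_zero]; exact hfnonneg p hp v hv i)] at h
      rw [haL]
      refine Finset.sum_eq_zero fun v hv => ?_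
      rcases mul_eq_zero.1 (h v hv) with h1 | h1
      · rw [h1, zero_mul]
      · rw [sub_zero] at h1
        rw [hzero v hv h1, hqkp, sub_zero, mul_zero]
    have hprop : ∀ x, f q k x = f p i x * f q k (w p i, 0) := by
      intro x
      rw [hexp p hp (f q k) x, hqkp, mul_zero, zero_add]
      exact Finset.sum_eq_single_of_mem i (Finset.mem_univ i)
        fun l _ hl => by rw [hother l hl, mul_zero]
    have hNN : N q k = N p i * f q k (w p i, 0) := by
      simp only [N, Finset.sum_mul, ← hprop]
    refine ⟨k, LinearMap.ext fun x => ?_⟩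
    have h1 := (hN p hp i).ne'
    have h2 : f q k (w p i, 0) ≠ 0 := fun h => (hN q hq k).ne' (by rw [hNN, h, mul_zero])
    rw [hφ, hφ, hNN, hprop x]
    field_simp
  let facets : Finset (Dual ℝ (E × ℝ)) := (Vert ×ˢ Finset.univ).image fun q => φ q.1 q.2
  have hfacets : ∀ F, F ∈ facets ↔ ∃ p ∈ Vert, ∃ i, φ p i = F := by
    intro F
    simp [facets]
  have hfacetsV : ∀ F ∈ facets, ∀ v ∈ Vert, 0 ≤ F (v, 1) := by
    intro F hF v hv
    obtain ⟨p, hp, i, rfl⟩ := (hfacets F).1 hF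
    exact (hφnonneg p hp i _).2 (hfnonneg p hp v hv i)
  have hcone : coneOverPolytope P = {x | ∀ F ∈ facets, 0 ≤ F x} := by
    ext x
    refine ⟨fun hx F hF => ?_, fun hx => ?_⟩
    · rw [hPhull] at hx
      obtain ⟨r, hr, rfl⟩ := mem_coneOverPolytope_convexHull hx
      rw [map_sum]
      refine Finset.sum_nonneg fun v hv => ?_
      rw [map_smul]
      exact mul_nonneg (hr v hv) (hfacetsV F hF v hv)
    · obtain ⟨y, t⟩ := x
      have hfx : ∀ p ∈ Vert, ∀ i, 0 ≤ f p i (y, t) := fun p hp i =>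
        (hφnonneg p hp i _).1 (hx _ ((hfacets _).2 ⟨p, hp, i, rfl⟩))
      have hmax : ∀ L : Dual ℝ E, ∀ q ∈ Vert, (∀ v ∈ Vert, L v ≤ L q) → L y ≤ t * L q := by
        intro L q hq hLq
        have h := hexp q hq (L ∘ₗ LinearMap.fst ℝ E ℝ) (y, t)
        simp only [LinearMap.comp_apply, LinearMap.fst_apply] at h
        rw [h, add_le_iff_nonpos_right]
        refine Finset.sum_nonpos fun i _ => mul_nonpos_of_nonneg_of_nonpos (hfx q hq i) ?_
        obtain ⟨a, ha, haw⟩ := hedge q hq i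
        rw [haw, map_sum]
        refine Finset.sum_nonpos fun v hv => ?_
        rw [map_smul, map_sub, smul_eq_mul]
        exact mul_nonpos_of_nonneg_of_nonpos (ha v hv) (sub_nonpos.2 (hLq v hv))
      have hmin : ∀ L : Dual ℝ E, ∀ q ∈ Vert, (∀ v ∈ Vert, L q ≤ L v) → t * L q ≤ L y := by
        intro L q hq hLq
        have h := hmax (-L) q hq fun v hv => by simpa using hLq v hv
        simpa using h
      obtain ⟨p, hp⟩ := hne
      rcases lt_trichotomy t 0 with ht | rfl | ht
      · exfalso
        let L : Dual ℝ E := f p ⟨0, hn⟩ ∘ₗ LinearMap.inl ℝ E ℝ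
        obtain ⟨q, hq, hqmax⟩ := Vert.exists_max_image L ⟨p, hp⟩
        obtain ⟨q', hq', hqmin⟩ := Vert.exists_min_image L ⟨p, hp⟩
        have h1 := (hmin L q' hq' hqmin).trans (hmax L q hq hqmax)
        have h2 : L q ≤ L q' := not_lt.1 fun h => (mul_lt_mul_of_neg_left h ht).not_ge h1
        have h3 : ∀ v ∈ Vert, L v = L p := fun v hv =>
          le_antisymm (((hqmax v hv).trans h2).trans (hqmin p hp))
            (((hqmax p hp).trans h2).trans (hqmin v hv))
        obtain ⟨a, -, haw⟩ := hedge p hp ⟨0, hn⟩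
        have h4 : L (w p ⟨0, hn⟩) = 1 := by
          simp [L, (hf p hp).2.1]
        rw [haw, map_sum, Finset.sum_eq_zero fun v hv => by
          rw [map_smul, map_sub, h3 v hv, sub_self, smul_zero]] at h4
        exact zero_ne_one h4
      · have hy : y = 0 := by
          rw [← Module.forall_dual_apply_eq_zero_iff ℝ]
          intro L
          obtain ⟨q, hq, hqmax⟩ := Vert.exists_max_image L ⟨p, hp⟩
          obtain ⟨q', hq', hqmin⟩ := Vert.exists_min_image L ⟨p, hp⟩
          have h1 := hmax L q hq hqmax
          have h2 := hmin L q' hq' hqmin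
          rw [zero_mul] at h1 h2
          exact le_antisymm h1 h2
        exact ⟨0, le_rfl, p, hVP p hp, by simp [hy]⟩
      · refine ⟨t, ht.le, t⁻¹ • y, ?_, by simp [smul_smul, ht.ne']⟩
        by_contra hyP
        obtain ⟨L, u, hLu, huL⟩ := geometric_hahn_banach_closed_point
          (hPhull ▸ convex_convexHull ℝ _) hPcompact.isClosed hyP
        obtain ⟨q, hq, hqmax⟩ := Vert.exists_max_image L ⟨p, hp⟩
        have h1 := hmax L q hq hqmax
        have h2 := hLu q (hVP q hq)
        rw [map_smul, smul_eq_mul, lt_inv_mul_iff₀ ht] at huL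
        have h3 := mul_lt_mul_of_pos_left h2 ht
        exact absurd h1 (h3.trans huL).not_ge
  have hinj : Function.Injective fun p : E => (p, (1 : ℝ)) := fun p q h => congrArg Prod.fst h
  refine ⟨{
    vert := Vert
    gen := fun p => (p, 1)
    facets := facets
    facet := φ
    edge := fun p i => (N p i • w p i, 0)
    height := LinearMap.snd ℝ E ℝ
    facet_mem := fun p hp i => (hfacets _).2 ⟨p, hp, i, rfl⟩
    facet_gen := fun p hp i => (hφ0 p hp i _).2 ((hf p hp).1 i)
    exists_eq_facet := fun p hp F hF h0 => by
      obtain ⟨q, hq, i, rfl⟩ := (hfacets F).1 hF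
      exact hshared q hq p hp i h0
    nonneg := fun p hp F hF => hfacetsV F hF p hp
    facet_edge := fun p hp i k => by
      have h : (N p k • w p k, (0 : ℝ)) = N p k • (w p k, (0 : ℝ)) := by simp
      rw [h, map_smul, hφ, (hf p hp).2.1]
      split_ifs with hik
      · subst hik
        have := (hN p hp i).ne'
        simp [this]
      · simp
    height_gen := fun p _ => rfl
    height_edge := fun p _ i => rfl
    expansion := fun p hp x => by
      conv_lhs => rw [(hf p hp).2.2 x]
      congr 1
      refine Finset.sum_congr rfl fun i _ => ?_
      have := (hN p hp i).ne'
      ext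
      · simp only [hφ, Prod.smul_fst, smul_smul]
        congr 1
        field_simp
      · simp
    exists_combination := fun x hx => by
      have h : x ∈ coneOverPolytope P := hcone ▸ hx
      rw [hPhull] at h
      exact mem_coneOverPolytope_convexHull h
    gen_injOn := hinj.injOn
    exists_ne_zero := fun p hp => by
      by_contra! hall
      obtain ⟨a, -, haw⟩ := hedge p hp ⟨0, hn⟩
      refine (hindep p hp).ne_zero ⟨0, hn⟩ ?_
      rw [haw]
      refine Finset.sum_eq_zero fun v hv => ?_
      have h := (hf v hv).2.2 (p, 1)
      rw [Finset.sum_eq_zero fun i _ => by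
        rw [(hφ0 v hv i _).1 (hall _ ((hfacets _).2 ⟨v, hv, i, rfl⟩)), zero_smul]] at h
      have h' := congrArg Prod.fst h
      simp only [one_smul, add_zero] at h'
      rw [h', sub_self, smul_zero] }, N, rfl, fun p => rfl, hN, fun p i => rfl, fun x => rfl, hcone⟩

end Polytope

section Interior

variable {W : Type*} [NormedAddCommGroup W] [NormedSpace ℝ W] [FiniteDimensional ℝ W]

theorem interior_setOf_forall_dual_nonneg {Φ : Finset (Dual ℝ W)} (hΦ : ∀ F ∈ Φ, F ≠ 0) :
    interior {x : W | ∀ F ∈ Φ, 0 ≤ F x} = {x | ∀ F ∈ Φ, 0 < F x} := by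
  apply subset_antisymm
  · intro x hx F hF
    have hopen : IsOpenMap F := F.isOpenMap_of_finiteDimensional
      (LinearMap.surjective (hΦ F hF))
    have h1 : F x ∈ interior (Set.Ici (0 : ℝ)) := by
      refine (hopen.image_interior_subset _).trans (interior_mono ?_) (Set.mem_image_of_mem F hx)
      rintro _ ⟨y, hy, rfl⟩
      exact hy F hF
    simpa using h1
  · refine interior_maximal (fun x hx F hF => (hx F hF).le) ?_
    have h : {x : W | ∀ F ∈ Φ, 0 < F x} = ⋂ F ∈ Φ, {x | 0 < F x} := by
      ext
      simp
    rw [h]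
    exact isOpen_biInter_finset fun F _ =>
      isOpen_lt continuous_const F.continuous_of_finiteDimensional

end Interior

/-- The product of the signed indicators over the facets at a vertex is the signed indicator of the
polarized cone at that vertex. -/
theorem SimpleCone.polarTerm_empty {W β : Type*} [AddCommGroup W] [Module ℝ W] {n : ℕ}
    (S : SimpleCone W β n) (ξ : Dual ℝ W) {p : β} (hξ : ∀ i, ξ (S.edge p i) ≠ 0) (x : W)
    [Decidable ((∀ i, 0 < ξ (S.edge p i) → S.facet p i x < 0) ∧
        ∀ i, ξ (S.edge p i) < 0 → 0 ≤ S.facet p i x)] :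
    S.polarTerm ξ ∅ x p = (-1) ^ Nat.card {i // 0 < ξ (S.edge p i)} *
      if (∀ i, 0 < ξ (S.edge p i) → S.facet p i x < 0) ∧
        (∀ i, ξ (S.edge p i) < 0 → 0 ≤ S.facet p i x) then 1 else 0 := by
  classical
  simp only [polarTerm, Finset.notMem_empty, if_false]
  split_ifs with h
  · rw [Nat.card_eq_fintype_card, Fintype.card_subtype, mul_one, ← Finset.prod_const,
      Finset.prod_filter]
    refine Finset.prod_congr rfl fun i _ => ?_
    split_ifs with hi
    · rw [step_of_neg (h.1 i hi), zero_sub]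
    · rw [step_of_nonneg (h.2 i (lt_of_le_of_ne (not_lt.1 hi) (hξ i))), sub_zero]
  · rw [mul_zero]
    have hex : ∃ i, (0 < ξ (S.edge p i) ∧ 0 ≤ S.facet p i x) ∨
        (ξ (S.edge p i) < 0 ∧ S.facet p i x < 0) := by
      by_contra! hall
      exact h ⟨fun i => (hall i).1, fun i => (hall i).2⟩
    obtain ⟨i, hi⟩ := hex
    refine Finset.prod_eq_zero (Finset.mem_univ i) ?_
    rcases hi with ⟨h1, h2⟩ | ⟨h1, h2⟩
    · rw [if_pos h1, step_of_nonneg h2, sub_self]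
    · rw [if_neg h1.not_gt, step_of_neg h2, sub_self]

theorem coneOverPolytope_singleton {E : Type*} [NormedAddCommGroup E] [Subsingleton E]
    [NormedSpace ℝ E] (p : E) :
    coneOverPolytope {p} = {x | 0 ≤ x.2} ∧ interior (coneOverPolytope {p}) = {x | 0 < x.2} := by
  have h : coneOverPolytope {p} = {x : E × ℝ | 0 ≤ x.2} := by
    ext x
    constructor
    · rintro ⟨r, hr, η, -, rfl⟩
      simpa using hr
    · intro hx
      exact ⟨x.2, hx, p, rfl, Prod.ext (Subsingleton.elim _ _) (by simp)⟩
  refine ⟨h, ?_⟩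
  rw [h]
  have := (isOpenMap_snd (X := E) (Y := ℝ)).preimage_interior_eq_interior_preimage continuous_snd
    (Set.Ici (0 : ℝ))
  rw [interior_Ici] at this
  exact this.symm

/-- **Polar decomposition of the cone over a polytope.**  For a simple convex
polytope `P` with polarizing vector `ξ`, vertex set `Vert`, and for every
`x ∈ V* × ℝ`:
`Σ_{p ∈ Vert} (−1)^{|E_p^+(ξ)|} 1_{K_p^#(ξ)}(x) = 1_C(x) + (−1)^n · 1_{−C°}(x)`,
where `K_p^#(ξ) = (C_p^#(ξ) × {1}) + ℝ μ_p` with `μ_p = (p, 1)`.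
`E` plays the role of the dual space `V*`, and `ξ ∈ V` is represented by the
functional `ξ : Module.Dual ℝ E` (via `V ≅ V**`), so `⟨w, ξ⟩` becomes `ξ w`. -/
theorem polar_decomposition_cone_over_polytope
    {E : Type*} [NormedAddCommGroup E] [NormedSpace ℝ E] [FiniteDimensional ℝ E]
    {n : ℕ} (hdim : finrank ℝ E = n)
    (P : Set E) (Vert : Finset E) (w : E → Fin n → E)
    (hPcompact : IsCompact P)
    (hPhull : P = convexHull ℝ (Vert : Set E))
    (hindep : ∀ p ∈ Vert, LinearIndependent ℝ (w p))
    (hspan : ∀ p ∈ Vert, Submodule.span ℝ (Set.range (w p)) = ⊤)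
    (htangent : ∀ p ∈ Vert,
      {y : E | ∃ r : ℝ, 0 ≤ r ∧ ∃ x ∈ P, y = p + r • (x - p)} =
        {y : E | ∃ c : Fin n → ℝ, (∀ i, 0 ≤ c i) ∧ y = p + ∑ i, c i • w p i})
    (ξ : Module.Dual ℝ E)
    (hpol : ∀ p ∈ Vert, ∀ i, ξ (w p i) ≠ 0)
    (x : E × ℝ) :
    ∑ p ∈ Vert,
        (-1 : ℝ) ^ Nat.card {i : Fin n // 0 < ξ (w p i)} *
          Set.indicator
            {z : E × ℝ | ∃ c : Fin n → ℝ,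
              (∀ i, 0 < ξ (w p i) → c i < 0) ∧
              (∀ i, ξ (w p i) < 0 → 0 ≤ c i) ∧
              ∃ s : ℝ, z = ((p + ∑ i, c i • w p i, (1 : ℝ)) + s • (p, (1 : ℝ)))}
            (fun _ => (1 : ℝ)) x =
      Set.indicator (coneOverPolytope P) (fun _ => (1 : ℝ)) x +
        (-1 : ℝ) ^ n *
          Set.indicator (-(interior (coneOverPolytope P))) (fun _ => (1 : ℝ)) x := by

  classical
  rcases Vert.eq_empty_or_nonempty with rfl | hne
  · have hC : coneOverPolytope P = ∅ := by
      simp [coneOverPolytope, hPhull]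
    simp [hC]
  rcases Nat.eq_zero_or_pos n with rfl | hn
  · have : Subsingleton E := finrank_zero_iff.1 hdim
    obtain ⟨p, hp⟩ := hne
    have hV : Vert = {p} :=
      Finset.eq_singleton_iff_unique_mem.2 ⟨hp, fun q _ => Subsingleton.elim q p⟩
    have hP : P = {p} := by simp [hPhull, hV]
    obtain ⟨h1, h2⟩ := coneOverPolytope_singleton p
    have hx : ∃ s : ℝ, x = (p + s • p, 1 + s) :=
      ⟨x.2 - 1, Prod.ext (Subsingleton.elim _ _) (by simp)⟩
    rw [hP, h2, h1, hV, Finset.sum_singleton]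
    simp only [Set.indicator_apply, Set.mem_neg, Set.mem_ofPred_eq]
    rcases le_or_gt 0 x.2 with h | h
    · simp [h, h.not_gt, hx]
    · simp [h, h.not_ge, hx]
  obtain ⟨S, N, hSV, hgen, hN, hedge, hheight, hcone⟩ :=
    exists_simpleCone hn hne hPcompact hPhull hindep hspan htangent
  subst hSV
  let Ξ : Dual ℝ (E × ℝ) := ξ ∘ₗ LinearMap.fst ℝ E ℝ
  have hΞ : ∀ p i, Ξ (S.edge p i) = N p i * ξ (w p i) := fun p i => by simp [Ξ, hedge]
  have hΞ0 : ∀ p ∈ S.vert, ∀ i, Ξ (S.edge p i) ≠ 0 := fun p hp i => by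
    rw [hΞ]
    exact mul_ne_zero (hN p hp i).ne' (hpol p hp i)
  have hΞpos : ∀ p ∈ S.vert, ∀ i, 0 < Ξ (S.edge p i) ↔ 0 < ξ (w p i) := fun p hp i => by
    rw [hΞ, mul_pos_iff_of_pos_left (hN p hp i)]
  have hΞneg : ∀ p ∈ S.vert, ∀ i, Ξ (S.edge p i) < 0 ↔ ξ (w p i) < 0 := fun p hp i => by
    rw [hΞ, ← smul_eq_mul, smul_neg_iff_of_pos_left (hN p hp i)]
  have hVface : S.faceVert ∅ = S.vert := by
    ext
    simp [S.mem_faceVert]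
  have hne0 : ∀ F ∈ S.facets, F ≠ 0 := by
    rintro F hF rfl
    obtain ⟨p, hp⟩ := hne
    obtain ⟨i, hi⟩ := S.exists_eq_facet p hp 0 hF rfl
    have := S.facet_edge p hp i i
    rw [← hi] at this
    simp at this
  have hmain := S.sum_polarTerm Ξ hΞ0 (Finset.empty_subset _) (hVface.symm ▸ hne) (x := x)
    (by simp)
  rw [hVface] at hmain
  have hint : x ∈ -interior (coneOverPolytope P) ↔
      ∀ F ∈ S.facets, F ∉ (∅ : Finset (Dual ℝ (E × ℝ))) → F x < 0 := by
    rw [hcone, interior_setOf_forall_dual_nonneg hne0]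
    simp
  have hmem : x ∈ coneOverPolytope P ↔ ∀ F ∈ S.facets, 0 ≤ F x := by
    rw [hcone]
    rfl
  simp only [Set.indicator_apply]
  simp only [hint, hmem]
  rw [Finset.card_empty, add_zero] at hmain
  rw [← hmain]
  refine Finset.sum_congr rfl fun p hp => ?_
  rw [S.polarTerm_empty Ξ (hΞ0 p hp) x]
  simp only [hΞpos p hp, hΞneg p hp]
  congr 1
  refine if_congr ?_ rfl rfl
  have hx : x.1 = x.2 • p + ∑ i, (S.facet p i x * N p i) • w p i := by
    have h := congrArg Prod.fst (S.expansion p hp x)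
    simpa [hgen, hedge, hheight, Prod.fst_sum, smul_smul] using h
  constructor
  · rintro ⟨c, hc1, hc2, s, hs⟩
    have hs2 : x.2 = 1 + s := by
      rw [hs]
      simp
    have hs1 : x.1 = x.2 • p + ∑ i, c i • w p i := by
      rw [hs2, hs]
      simp only [Prod.fst_add, Prod.smul_fst]
      module
    rw [hs1, add_right_inj] at hx
    have hc : ∀ i, c i = S.facet p i x * N p i := fun i =>
      congrFun ((hindep p hp).fintypeLinearCombination_injective
        (by simpa [Fintype.linearCombination_apply] using hx)) i
    refine ⟨fun i hi => ?_, fun i hi => ?_⟩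
    · exact neg_of_mul_neg_left (hc i ▸ hc1 i hi) (hN p hp i).le
    · exact nonneg_of_mul_nonneg_left (hc i ▸ hc2 i hi) (hN p hp i)
  · rintro ⟨h1, h2⟩
    refine ⟨fun i => S.facet p i x * N p i, fun i hi => mul_neg_of_neg_of_pos (h1 i hi) (hN p hp i),
      fun i hi => mul_nonneg (h2 i hi) (hN p hp i).le, x.2 - 1, ?_⟩
    ext
    · rw [hx]
      simp only [Prod.fst_add, Prod.smul_fst]
      module
    · simp
end

section
/- Dual polar decomposition of the cone over a polytope: For every polarizing vector ξ for P and every x ∈ V* × ℝ, Σ_{p ∈ Vert(P)} (−1)^{|E_p^+(ξ)|} 1_{Ǩ_p^#(ξ)}(x) = (−1)^n · 1_{C°}(x) + 1_{−C}(x), where C° is the interior of C in V* × ℝ. -/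
open Module

open Classical in
/-- The vertices of the face of `conv V` spanned at `p` by the edges `b p i`, `i ∈ S`. -/
noncomputable def faceVertices {E ι : Type*} [AddCommGroup E] [Module ℝ E] [Fintype ι]
    (V : Finset E) (b : E → Basis ι ℝ E) (p : E) (S : Finset ι) : Finset E :=
  V.filter fun q => ∀ j ∉ S, (b p).repr (q - p) j = 0

/-- The points of `V` are the vertices of a simple polytope whose edge vectors at `p ∈ V` are
`b p i`. -/
structure IsSimpleVertexSet {E ι : Type*} [AddCommGroup E] [Module ℝ E]
    (V : Finset E) (b : E → Basis ι ℝ E) : Prop where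
  repr_nonneg : ∀ p ∈ V, ∀ q ∈ V, ∀ i, 0 ≤ (b p).repr (q - p) i
  exists_edge_eq : ∀ p ∈ V, ∀ i, ∃ μ : E → ℝ,
    (∀ q ∈ V, 0 ≤ μ q) ∧ ∑ q ∈ V, μ q • (q - p) = b p i

open Classical in
/-- The signed indicator of the tangent cone along the face spanned at `p` by the edges in `S`,
evaluated at `-(v, t)`. -/
noncomputable def faceTerm {E ι : Type*} [AddCommGroup E] [Module ℝ E] [Fintype ι]
    (b : E → Basis ι ℝ E) (v : E) (t : ℝ) (p : E) (S : Finset ι) : ℝ :=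
  (-1) ^ S.card * if ∀ i ∉ S, 0 ≤ (b p).repr (t • p - v) i then 1 else 0

open Classical in
/-- The signed indicator of the dual polarized cone at `p`, evaluated at `(v, t)`. -/
noncomputable def polarTerm {E ι : Type*} [AddCommGroup E] [Module ℝ E] [Fintype ι]
    (b : E → Basis ι ℝ E) (ξ : Module.Dual ℝ E) (v : E) (t : ℝ) (p : E) : ℝ :=
  ∏ i, ((if 0 < ξ (b p i) then -1 else 0) + if 0 ≤ (b p).repr (t • p - v) i then 1 else 0)

theorem apply_eq_sum_repr {E ι : Type*} [AddCommGroup E] [Module ℝ E] [Fintype ι]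
    (b : Basis ι ℝ E) (f : Module.Dual ℝ E) (u : E) :
    f u = ∑ i, b.repr u i * f (b i) := by
  conv_lhs => rw [← b.sum_repr u]
  simp only [map_sum, map_smul, smul_eq_mul]

theorem mem_faceVertices {E ι : Type*} [AddCommGroup E] [Module ℝ E] [Fintype ι]
    {V : Finset E} {b : E → Basis ι ℝ E} {p q : E} {S : Finset ι} :
    q ∈ faceVertices V b p S ↔ q ∈ V ∧ ∀ j ∉ S, (b p).repr (q - p) j = 0 := by
  simp [faceVertices]

theorem self_mem_faceVertices {E ι : Type*} [AddCommGroup E] [Module ℝ E] [Fintype ι]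
    {V : Finset E} {b : E → Basis ι ℝ E} {p : E} (hp : p ∈ V) (S : Finset ι) :
    p ∈ faceVertices V b p S := by
  simp [mem_faceVertices, hp]

theorem polarTerm_eq_sum_faceTerm {E ι : Type*} [AddCommGroup E] [Module ℝ E] [Fintype ι]
    (b : E → Basis ι ℝ E) (ξ : Module.Dual ℝ E) (v : E) (t : ℝ) (p : E) :
    polarTerm b ξ v t p =
      ∑ S : Finset ι with ∀ i ∈ S, 0 < ξ (b p i), faceTerm b v t p S := by
  classical
  rw [polarTerm, Finset.prod_add, Finset.powerset_univ, Finset.sum_filter]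
  refine Finset.sum_congr rfl fun S _ => ?_
  rw [Finset.prod_ite_zero, Finset.prod_ite_zero]
  simp only [faceTerm, Finset.mem_sdiff, Finset.mem_univ, true_and]
  split_ifs <;> simp

namespace IsSimpleVertexSet

variable {E ι : Type*} [AddCommGroup E] [Module ℝ E] [Fintype ι]
  {V : Finset E} {b : E → Basis ι ℝ E}

theorem exists_edge_eq_sum_faceVertices (h : IsSimpleVertexSet V b) {p : E} (hp : p ∈ V)
    {S : Finset ι} {i : ι} (hi : i ∈ S) :
    ∃ μ : E → ℝ, (∀ q ∈ V, 0 ≤ μ q) ∧ ∑ q ∈ faceVertices V b p S, μ q • (q - p) = b p i := by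
  classical
  obtain ⟨μ, hμ, hsum⟩ := h.exists_edge_eq p hp i
  refine ⟨μ, hμ, ?_⟩
  rw [← hsum]
  refine Finset.sum_subset (fun q hq => (mem_faceVertices.1 hq).1) fun q hq hqF => ?_
  suffices μ q = 0 by simp [this]
  by_contra hne
  refine hqF (mem_faceVertices.2 ⟨hq, fun j hj => ?_⟩)
  have hcoord : ∑ q ∈ V, μ q * (b p).repr (q - p) j = 0 := by
    have := congrArg (fun u => (b p).coord j u) hsum
    have hij : i ≠ j := fun hij => hj (hij ▸ hi)
    simpa [-map_sub, Finsupp.single_apply, hij] using this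
  have := (Finset.sum_eq_zero_iff_of_nonneg fun r hr =>
    mul_nonneg (hμ r hr) (h.repr_nonneg p hp r hr j)).1 hcoord q hq
  exact (mul_eq_zero.1 this).resolve_left hne

theorem apply_edge_nonneg_of_faceVertices (h : IsSimpleVertexSet V b) {p : E} (hp : p ∈ V)
    {S : Finset ι} {i : ι} (hi : i ∈ S) {f : Module.Dual ℝ E}
    (hf : ∀ q ∈ faceVertices V b p S, 0 ≤ f (q - p)) : 0 ≤ f (b p i) := by
  obtain ⟨μ, hμ, hsum⟩ := h.exists_edge_eq_sum_faceVertices hp hi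
  rw [← hsum, map_sum]
  refine Finset.sum_nonneg fun q hq => ?_
  rw [map_smul, smul_eq_mul]
  exact mul_nonneg (hμ q (mem_faceVertices.1 hq).1) (hf q hq)

theorem apply_edge_nonneg (h : IsSimpleVertexSet V b) {p : E} (hp : p ∈ V)
    {f : Module.Dual ℝ E} (hf : ∀ q ∈ V, 0 ≤ f (q - p)) (i : ι) : 0 ≤ f (b p i) :=
  h.apply_edge_nonneg_of_faceVertices hp (Finset.mem_univ i)
    fun q hq => hf q (mem_faceVertices.1 hq).1

theorem exists_repr_pos (h : IsSimpleVertexSet V b) {p : E} (hp : p ∈ V)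
    {S : Finset ι} {i : ι} (hi : i ∈ S) :
    ∃ q ∈ faceVertices V b p S, 0 < (b p).repr (q - p) i := by
  by_contra! hneg
  have := h.apply_edge_nonneg_of_faceVertices hp hi (f := -(b p).coord i) fun q hq => by
    simpa [-map_sub] using hneg q hq
  simp at this
  linarith

theorem finrank_vectorSpan_faceVertices (h : IsSimpleVertexSet V b) {p : E} (hp : p ∈ V)
    (S : Finset ι) :
    finrank ℝ (vectorSpan ℝ (faceVertices V b p S : Set E)) = S.card := by
  have hspan : vectorSpan ℝ (faceVertices V b p S : Set E) =
      Submodule.span ℝ (Set.range fun i : S => b p i) := by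
    rw [vectorSpan_eq_span_vsub_set_right ℝ
      (Finset.mem_coe.2 (self_mem_faceVertices (b := b) hp S))]
    apply le_antisymm <;> rw [Submodule.span_le]
    · rintro _ ⟨q, hq, rfl⟩
      have hq' := (mem_faceVertices.1 (Finset.mem_coe.1 hq)).2
      simp only [vsub_eq_sub, SetLike.mem_coe]
      rw [← (b p).sum_repr (q - p)]
      refine Submodule.sum_mem _ fun i _ => ?_
      by_cases hi : i ∈ S
      · exact Submodule.smul_mem _ _ (Submodule.subset_span ⟨⟨i, hi⟩, rfl⟩)
      · simp [hq' i hi, -map_sub]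
    · rintro _ ⟨⟨i, hi⟩, rfl⟩
      obtain ⟨μ, -, hsum⟩ := h.exists_edge_eq_sum_faceVertices hp hi
      simp only [SetLike.mem_coe]
      rw [← hsum]
      exact Submodule.sum_mem _ fun q hq =>
        Submodule.smul_mem _ _ (Submodule.subset_span ⟨q, hq, rfl⟩)
  have hli : LinearIndependent ℝ fun i : S => b p i :=
    (b p).linearIndependent.comp _ Subtype.val_injective
  rw [hspan, finrank_span_eq_card hli, Fintype.card_coe]

theorem repr_edge_nonneg (h : IsSimpleVertexSet V b) {p r : E} (hp : p ∈ V)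
    {S : Finset ι} (hr : r ∈ faceVertices V b p S) {j : ι} (hj : j ∉ S) (i : ι) :
    0 ≤ (b p).repr (b r i) j := by
  have hr' := mem_faceVertices.1 hr
  refine h.apply_edge_nonneg (f := (b p).coord j) hr'.1 (fun q hq => ?_) i
  have h1 := h.repr_nonneg p hp q hq j
  have h2 : q - r = (q - p) - (r - p) := by abel
  rw [h2, map_sub, Basis.coord_apply, Basis.coord_apply, hr'.2 j hj, sub_zero]
  exact h1

theorem repr_edge_eq_zero (h : IsSimpleVertexSet V b) {p r q : E} (hp : p ∈ V)
    {S : Finset ι} (hr : r ∈ faceVertices V b p S) (hq : q ∈ faceVertices V b p S)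
    {i : ι} (hi : (b r).repr (q - r) i ≠ 0) {j : ι} (hj : j ∉ S) :
    (b p).repr (b r i) j = 0 := by
  have hr' := mem_faceVertices.1 hr
  have hq' := mem_faceVertices.1 hq
  have hzero : (b p).coord j (q - r) = 0 := by
    have h2 : q - r = (q - p) - (r - p) := by abel
    rw [h2, map_sub, Basis.coord_apply, Basis.coord_apply, hr'.2 j hj, hq'.2 j hj, sub_zero]
  rw [apply_eq_sum_repr (b r)] at hzero
  have := (Finset.sum_eq_zero_iff_of_nonneg fun k _ =>
    mul_nonneg (h.repr_nonneg r hr'.1 q hq'.1 k) (h.repr_edge_nonneg hp hr hj k)).1 hzero i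
    (Finset.mem_univ i)
  exact (mul_eq_zero.1 this).resolve_left hi

theorem exists_faceVertices_eq (h : IsSimpleVertexSet V b) {p r : E} (hp : p ∈ V)
    {S : Finset ι} (hr : r ∈ faceVertices V b p S) :
    ∃ S', faceVertices V b r S' = faceVertices V b p S := by
  classical
  have hr' := mem_faceVertices.1 hr
  refine ⟨Finset.univ.filter fun i => ∃ q ∈ faceVertices V b p S, (b r).repr (q - r) i ≠ 0, ?_⟩
  ext q
  constructor
  · intro hq
    obtain ⟨hqV, hq0⟩ := mem_faceVertices.1 hq
    refine mem_faceVertices.2 ⟨hqV, fun j hj => ?_⟩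
    have h2 : q - p = (q - r) + (r - p) := by abel
    rw [h2, map_add, Finsupp.add_apply, hr'.2 j hj, add_zero]
    change (b p).coord j (q - r) = 0
    rw [apply_eq_sum_repr (b r)]
    refine Finset.sum_eq_zero fun i _ => ?_
    by_cases hi : ∃ q ∈ faceVertices V b p S, (b r).repr (q - r) i ≠ 0
    · obtain ⟨s, hs, hsi⟩ := hi
      exact mul_eq_zero_of_right _ (h.repr_edge_eq_zero hp hr hs hsi hj)
    · exact mul_eq_zero_of_left (hq0 i (by simpa [-map_sub] using hi)) _
  · intro hq
    refine mem_faceVertices.2 ⟨(mem_faceVertices.1 hq).1, fun j hj => ?_⟩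
    by_contra hne
    exact hj (Finset.mem_filter.2 ⟨Finset.mem_univ j, q, hq, hne⟩)

theorem repr_nonneg_of_faceVertices_eq (h : IsSimpleVertexSet V b) {p r : E} (hp : p ∈ V)
    (hr : r ∈ V) {S S' : Finset ι} (hF : faceVertices V b p S = faceVertices V b r S')
    {v : E} {t : ℝ} (hv : ∀ i ∉ S, 0 ≤ (b p).repr (t • p - v) i) {j : ι} (hj : j ∉ S') :
    0 ≤ (b r).repr (t • r - v) j := by
  have hpF : p ∈ faceVertices V b r S' := hF ▸ self_mem_faceVertices hp S
  have h2 : t • r - v = (t • p - v) - t • (p - r) := by rw [smul_sub]; abel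
  rw [h2, map_sub, map_smul, Finsupp.sub_apply, Finsupp.smul_apply,
    (mem_faceVertices.1 hpF).2 j hj, smul_zero, sub_zero]
  change 0 ≤ (b r).coord j (t • p - v)
  rw [apply_eq_sum_repr (b p)]
  refine Finset.sum_nonneg fun i _ => ?_
  by_cases hi : i ∈ S
  · obtain ⟨q, hq, hqi⟩ := h.exists_repr_pos hp hi
    have := h.repr_edge_eq_zero hr hpF (hF ▸ hq) hqi.ne' hj
    simp [-map_sub, this]
  · exact mul_nonneg (hv i hi) (h.repr_edge_nonneg hr hpF hj i)

theorem faceTerm_eq_of_faceVertices_eq (h : IsSimpleVertexSet V b) {p r : E} (hp : p ∈ V)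
    (hr : r ∈ V) {S S' : Finset ι} (hF : faceVertices V b p S = faceVertices V b r S')
    (v : E) (t : ℝ) : faceTerm b v t p S = faceTerm b v t r S' := by
  have hcard : S.card = S'.card := by
    rw [← h.finrank_vectorSpan_faceVertices hp, hF, h.finrank_vectorSpan_faceVertices hr]
  have hiff : (∀ i ∉ S, 0 ≤ (b p).repr (t • p - v) i) ↔
      ∀ i ∉ S', 0 ≤ (b r).repr (t • r - v) i :=
    ⟨fun hv _ hj => h.repr_nonneg_of_faceVertices_eq hp hr hF hv hj,
      fun hv _ hj => h.repr_nonneg_of_faceVertices_eq hr hp hF.symm hv hj⟩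
  rw [faceTerm, faceTerm, hcard]
  refine congrArg _ ?_
  split_ifs <;> tauto

theorem apply_lt_of_mem_faceVertices {p q : E} (h : IsSimpleVertexSet V b) (hp : p ∈ V)
    {S : Finset ι} (hq : q ∈ faceVertices V b p S) (hne : q ≠ p) {ξ : Module.Dual ℝ E}
    (hS : ∀ i ∈ S, 0 < ξ (b p i)) : ξ p < ξ q := by
  obtain ⟨hqV, hq0⟩ := mem_faceVertices.1 hq
  rw [← sub_pos, ← map_sub, apply_eq_sum_repr (b p)]
  obtain ⟨i, hi⟩ : ∃ i, (b p).repr (q - p) i ≠ 0 := by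
    by_contra! hall
    exact hne (sub_eq_zero.1 ((b p).repr.map_eq_zero_iff.1 (Finsupp.ext hall)))
  have hnn : ∀ j, 0 ≤ (b p).repr (q - p) j * ξ (b p j) := fun j => by
    by_cases hj : j ∈ S
    · exact mul_nonneg (h.repr_nonneg p hp q hqV j) (hS j hj).le
    · simp [-map_sub, hq0 j hj]
  refine Finset.sum_pos' (fun j _ => hnn j) ⟨i, Finset.mem_univ i, ?_⟩
  exact mul_pos (lt_of_le_of_ne (h.repr_nonneg p hp q hqV i) hi.symm)
    (hS i (by_contra fun hiS => hi (hq0 i hiS)))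

theorem subset_of_faceVertices_eq (h : IsSimpleVertexSet V b) {p : E} (hp : p ∈ V)
    {S S' : Finset ι} (hF : faceVertices V b p S = faceVertices V b p S') : S ⊆ S' := by
  intro i hi
  obtain ⟨q, hq, hqi⟩ := h.exists_repr_pos hp hi
  by_contra hi'
  exact hqi.ne' ((mem_faceVertices.1 (hF ▸ hq)).2 i hi')

theorem vertex_eq_of_faceVertices_eq (h : IsSimpleVertexSet V b) {p r : E} (hp : p ∈ V)
    (hr : r ∈ V) {S S' : Finset ι} (hF : faceVertices V b p S = faceVertices V b r S')
    {ξ : Module.Dual ℝ E} (hS : ∀ i ∈ S, 0 < ξ (b p i)) (hS' : ∀ i ∈ S', 0 < ξ (b r i)) :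
    p = r := by
  by_contra hne
  exact lt_asymm
    (h.apply_lt_of_mem_faceVertices hp (hF ▸ self_mem_faceVertices hr S') (Ne.symm hne) hS)
    (h.apply_lt_of_mem_faceVertices hr (hF ▸ self_mem_faceVertices hp S) hne hS')

/-- Every face has a vertex at which all its edges are positive for a polarizing functional. -/
theorem exists_positive_vertex (h : IsSimpleVertexSet V b) {ξ : Module.Dual ℝ E}
    (hξ : ∀ p ∈ V, ∀ i, ξ (b p i) ≠ 0) {p : E} (hp : p ∈ V) (S : Finset ι) :
    ∃ r ∈ V, ∃ S', (∀ i ∈ S', 0 < ξ (b r i)) ∧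
      faceVertices V b r S' = faceVertices V b p S := by
  obtain ⟨r, hr, hmin⟩ := Finset.exists_min_image (faceVertices V b p S) ξ
    ⟨p, self_mem_faceVertices hp S⟩
  have hrV := (mem_faceVertices.1 hr).1
  obtain ⟨S', hS'⟩ := h.exists_faceVertices_eq hp hr
  refine ⟨r, hrV, S', fun i hi => lt_of_le_of_ne ?_ (hξ r hrV i).symm, hS'⟩
  refine h.apply_edge_nonneg_of_faceVertices hrV hi fun q hq => ?_
  rw [map_sub, sub_nonneg]
  exact hmin q (hS' ▸ hq)

/-- The alternating sum of the polarized cones does not depend on the polarizing functional. -/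
theorem sum_polarTerm_eq (h : IsSimpleVertexSet V b) {ξ ζ : Module.Dual ℝ E}
    (hξ : ∀ p ∈ V, ∀ i, ξ (b p i) ≠ 0) (hζ : ∀ p ∈ V, ∀ i, ζ (b p i) ≠ 0)
    (v : E) (t : ℝ) :
    ∑ p ∈ V, polarTerm b ξ v t p = ∑ p ∈ V, polarTerm b ζ v t p := by
  simp only [polarTerm_eq_sum_faceTerm, Finset.sum_sigma']
  have key : ∀ a ∈ V.sigma fun p => {S : Finset ι | ∀ i ∈ S, 0 < ξ (b p i)},
      ∃ c ∈ V.sigma fun p => {S : Finset ι | ∀ i ∈ S, 0 < ζ (b p i)},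
        faceVertices V b c.1 c.2 = faceVertices V b a.1 a.2 := by
    rintro ⟨p, S⟩ ha
    obtain ⟨r, hr, S', hS', hF⟩ := h.exists_positive_vertex hζ (Finset.mem_sigma.1 ha).1 S
    exact ⟨⟨r, S'⟩, by simp [hr]; exact hS', hF⟩
  choose! g hg hgF using key
  refine Finset.sum_bij (fun a _ => g a) hg ?_ ?_ ?_
  · rintro ⟨p, S⟩ ha ⟨r, S'⟩ hc hac
    have h1 := hgF _ ha
    rw [hac] at h1
    have hF : faceVertices V b p S = faceVertices V b r S' := h1.symm.trans (hgF _ hc)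
    simp only [Finset.mem_sigma, Finset.mem_filter, Finset.mem_univ, true_and] at ha hc
    obtain rfl := h.vertex_eq_of_faceVertices_eq ha.1 hc.1 hF ha.2 hc.2
    obtain rfl := (h.subset_of_faceVertices_eq ha.1 hF).antisymm
      (h.subset_of_faceVertices_eq ha.1 hF.symm)
    rfl
  · rintro ⟨p, S⟩ hc
    simp only [Finset.mem_sigma, Finset.mem_filter, Finset.mem_univ, true_and] at hc
    obtain ⟨r, hr, S', hS', hF⟩ := h.exists_positive_vertex hξ hc.1 S
    have hmem : (⟨r, S'⟩ : Sigma fun _ : E => Finset ι) ∈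
        V.sigma fun p => {S : Finset ι | ∀ i ∈ S, 0 < ξ (b p i)} := by
      simp [hr]; exact hS'
    refine ⟨⟨r, S'⟩, hmem, ?_⟩
    have h1 := hg _ hmem
    have h2 := (hgF _ hmem).trans hF
    generalize g ⟨r, S'⟩ = c at h1 h2 ⊢
    obtain ⟨s, T⟩ := c
    simp only [Finset.mem_sigma, Finset.mem_filter, Finset.mem_univ, true_and] at h1 h2
    obtain rfl := h.vertex_eq_of_faceVertices_eq h1.1 hc.1 h2 h1.2 hc.2
    obtain rfl := (h.subset_of_faceVertices_eq hc.1 h2).antisymm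
      (h.subset_of_faceVertices_eq hc.1 h2.symm)
    rfl
  · rintro a ha
    exact h.faceTerm_eq_of_faceVertices_eq (Finset.mem_sigma.1 ha).1
      (Finset.mem_sigma.1 (hg a ha)).1 (hgF a ha).symm v t

theorem exists_forall_pos_iff_eq (h : IsSimpleVertexSet V b) (hV : V.Nonempty)
    {ξ : Module.Dual ℝ E} (hξ : ∀ p ∈ V, ∀ i, ξ (b p i) ≠ 0) :
    ∃ p ∈ V, ∀ q ∈ V, (∀ i, 0 < ξ (b q i)) ↔ q = p := by
  obtain ⟨p₀, hp₀⟩ := hV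
  obtain ⟨p, hp, hmin⟩ := Finset.exists_min_image V ξ ⟨p₀, hp₀⟩
  have hpos : ∀ i, 0 < ξ (b p i) := fun i =>
    lt_of_le_of_ne (h.apply_edge_nonneg hp (fun q hq => by
      rw [map_sub, sub_nonneg]; exact hmin q hq) i) (hξ p hp i).symm
  refine ⟨p, hp, fun q hq => ⟨fun hqpos => ?_, fun hqp => hqp ▸ hpos⟩⟩
  refine h.vertex_eq_of_faceVertices_eq hq hp (S := Finset.univ) (S' := Finset.univ) ?_
    (fun i _ => hqpos i) (fun i _ => hpos i)
  ext r
  simp [mem_faceVertices]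

theorem sum_polarTerm_of_nonneg (h : IsSimpleVertexSet V b) (hV : V.Nonempty)
    {ξ : Module.Dual ℝ E} (hξ : ∀ p ∈ V, ∀ i, ξ (b p i) ≠ 0) {v : E} {t : ℝ}
    (hv : ∀ p ∈ V, ∀ i, 0 ≤ (b p).repr (t • p - v) i) :
    ∑ p ∈ V, polarTerm b ξ v t p = 1 := by
  obtain ⟨p, hp, hmax⟩ := h.exists_forall_pos_iff_eq hV (ξ := -ξ)
    (fun q hq i => by simpa using hξ q hq i)
  have hneg : ∀ q ∈ V, (∀ i, ¬ 0 < ξ (b q i)) ↔ q = p := fun q hq => by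
    rw [← hmax q hq]
    refine forall_congr' fun i => ?_
    simp only [LinearMap.neg_apply, Left.neg_pos_iff, not_lt]
    exact ⟨fun hi => lt_of_le_of_ne hi (hξ q hq i), le_of_lt⟩
  rw [Finset.sum_eq_single_of_mem p hp]
  · refine Finset.prod_eq_one fun i _ => ?_
    rw [if_neg ((hneg p hp).2 rfl i), if_pos (hv p hp i), zero_add]
  · intro q hq hqp
    have : ¬ ∀ i, ¬ 0 < ξ (b q i) := fun hall => hqp ((hneg q hq).1 hall)
    push Not at this
    obtain ⟨i, hi⟩ := this
    refine Finset.prod_eq_zero (Finset.mem_univ i) ?_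
    rw [if_pos hi, if_pos (hv q hq i), neg_add_cancel]

theorem sum_polarTerm_of_neg (h : IsSimpleVertexSet V b) (hV : V.Nonempty)
    {ξ : Module.Dual ℝ E} (hξ : ∀ p ∈ V, ∀ i, ξ (b p i) ≠ 0) {v : E} {t : ℝ}
    (hv : ∀ p ∈ V, ∀ i, (b p).repr (t • p - v) i < 0) :
    ∑ p ∈ V, polarTerm b ξ v t p = (-1) ^ Fintype.card ι := by
  obtain ⟨p, hp, hmin⟩ := h.exists_forall_pos_iff_eq hV hξ
  rw [Finset.sum_eq_single_of_mem p hp]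
  · rw [polarTerm, Finset.prod_congr rfl (g := fun _ => (-1 : ℝ))]
    · simp
    · intro i _
      rw [if_pos ((hmin p hp).2 rfl i), if_neg (hv p hp i).not_ge, add_zero]
  · intro q hq hqp
    have : ¬ ∀ i, 0 < ξ (b q i) := fun hall => hqp ((hmin q hq).1 hall)
    push Not at this
    obtain ⟨i, hi⟩ := this
    refine Finset.prod_eq_zero (Finset.mem_univ i) ?_
    rw [if_neg hi.not_gt, if_neg (hv q hq i).not_ge, add_zero]

theorem sum_polarTerm_eq_zero (h : IsSimpleVertexSet V b)
    {ξ f : Module.Dual ℝ E} (hξ : ∀ p ∈ V, ∀ i, ξ (b p i) ≠ 0) {v : E} {t : ℝ}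
    (hf : (∀ p ∈ V, 0 < f (t • p - v)) ∨ (0 < t ∧ f ≠ 0 ∧ ∀ p ∈ V, 0 ≤ f (t • p - v))) :
    ∑ p ∈ V, polarTerm b ξ v t p = 0 := by
  have hsmall : ∀ u : E, f u ≠ 0 → ∀ᶠ ε : ℝ in nhdsWithin 0 (Set.Ioi 0),
      0 < f u * (f u + ε * ξ u) := fun u hu => by
    have hc : Continuous fun ε : ℝ => f u * (f u + ε * ξ u) := by fun_prop
    exact (hc.tendsto 0).mono_left nhdsWithin_le_nhds |>.eventually_const_lt (by
      simpa using hu)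
  have hev : ∀ᶠ ε : ℝ in nhdsWithin 0 (Set.Ioi 0), 0 < ε ∧ ∀ p ∈ V,
      (f (t • p - v) ≠ 0 → 0 < f (t • p - v) * (f (t • p - v) + ε * ξ (t • p - v))) ∧
      ∀ i, f (b p i) ≠ 0 → 0 < f (b p i) * (f (b p i) + ε * ξ (b p i)) := by
    refine Filter.Eventually.and self_mem_nhdsWithin ?_
    rw [Filter.eventually_all_finset]
    refine fun p _ => Filter.Eventually.and ?_ (Filter.eventually_all.2 fun i => ?_)
    · by_cases hu : f (t • p - v) = 0
      · simp [hu]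
      · filter_upwards [hsmall _ hu] with ε hε _ using hε
    · by_cases hu : f (b p i) = 0
      · simp [hu]
      · filter_upwards [hsmall _ hu] with ε hε _ using hε
  obtain ⟨ε, hε, hall⟩ := hev.exists
  have hζ : ∀ p ∈ V, ∀ i, (f + ε • ξ) (b p i) ≠ 0 := fun p hp i => by
    simp only [LinearMap.add_apply, LinearMap.smul_apply, smul_eq_mul]
    by_cases hu : f (b p i) = 0
    · simpa [hu] using ⟨hε.ne', hξ p hp i⟩
    · exact fun h0 => by simpa [h0] using (hall p hp).2 i hu
  rw [h.sum_polarTerm_eq hξ hζ]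
  refine Finset.sum_eq_zero fun p hp => ?_
  by_contra hne
  have hfac := fun i => Finset.prod_ne_zero_iff.1 hne i (Finset.mem_univ i)
  have hle : ∀ i, (b p).repr (t • p - v) i * (f + ε • ξ) (b p i) ≤ 0 := fun i => by
    have := hfac i
    by_cases h1 : 0 < (f + ε • ξ) (b p i) <;> by_cases h2 : 0 ≤ (b p).repr (t • p - v) i
    · simp [h1, h2, -map_sub, -LinearMap.add_apply] at this
    · exact mul_nonpos_of_nonpos_of_nonneg (not_le.1 h2).le h1.le
    · exact mul_nonpos_of_nonneg_of_nonpos h2 (not_lt.1 h1)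
    · simp only [h1, h2, if_false, add_zero, ne_eq, not_true] at this
  have hnonpos : (f + ε • ξ) (t • p - v) ≤ 0 := by
    rw [apply_eq_sum_repr (b p)]
    exact Finset.sum_nonpos fun i _ => hle i
  have hzero : ¬ 0 < f (t • p - v) := fun hpos => by
    have := pos_of_mul_pos_right ((hall p hp).1 hpos.ne') hpos.le
    simp only [LinearMap.add_apply, LinearMap.smul_apply, smul_eq_mul] at hnonpos
    linarith
  rcases hf with hf | ⟨ht, hf0, hf⟩
  · exact hzero (hf p hp)
  have hfp : f (t • p - v) = 0 := le_antisymm (not_lt.1 hzero) (hf p hp)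
  have hedge : ∀ i, 0 ≤ f (b p i) := h.apply_edge_nonneg hp fun q hq => by
    have h1 := hf q hq
    have h2 : t • (q - p) = (t • q - v) - (t • p - v) := by rw [smul_sub]; abel
    have h3 := congrArg f h2
    rw [map_smul, map_sub f (t • q - v), hfp, sub_zero, smul_eq_mul] at h3
    exact nonneg_of_mul_nonneg_right (h3 ▸ h1) ht
  obtain ⟨i, hi⟩ : ∃ i, f (b p i) ≠ 0 := by
    by_contra! hall0
    exact hf0 ((b p).ext fun i => by simpa using hall0 i)
  have hneg : ∀ j, f (b p j) ≠ 0 → (b p).repr (t • p - v) j < 0 := fun j hj => by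
    have hjpos := lt_of_le_of_ne (hedge j) hj.symm
    have h1 : 0 < (f + ε • ξ) (b p j) := pos_of_mul_pos_right ((hall p hp).2 j hj) hjpos.le
    by_contra! h2
    have := hfac j
    rw [if_pos h1, if_pos h2] at this
    simp at this
  rw [apply_eq_sum_repr (b p)] at hfp
  refine (Finset.sum_neg' (fun j _ => ?_) ⟨i, Finset.mem_univ i, ?_⟩).ne hfp
  · by_cases hj : f (b p j) = 0
    · simp [hj]
    · exact mul_nonpos_of_nonpos_of_nonneg (hneg j hj).le (hedge j)
  · exact mul_neg_of_neg_of_pos (hneg i hi) (lt_of_le_of_ne (hedge i) hi.symm)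

end IsSimpleVertexSet

theorem IsSimpleVertexSet.repr_nonneg_of_mem_convexHull {E ι : Type*} [AddCommGroup E]
    [Module ℝ E] {V : Finset E} {b : E → Basis ι ℝ E} (h : IsSimpleVertexSet V b)
    {p η : E} (hp : p ∈ V) (hη : η ∈ convexHull ℝ (V : Set E)) (i : ι) :
    0 ≤ (b p).repr (η - p) i := by
  have hsub : convexHull ℝ (V : Set E) ⊆ {z | (b p).coord i p ≤ (b p).coord i z} :=
    convexHull_min (fun q hq => by simpa using h.repr_nonneg p hp q hq i)
      (convex_halfSpace_ge ((b p).coord i).isLinear _)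
  simpa using hsub hη

theorem IsSimpleVertexSet.interior_convexHull_nonempty {E ι : Type*} [NormedAddCommGroup E]
    [NormedSpace ℝ E] [FiniteDimensional ℝ E] [Fintype ι] {V : Finset E} {b : E → Basis ι ℝ E}
    (h : IsSimpleVertexSet V b) (hV : V.Nonempty) :
    (interior (convexHull ℝ (V : Set E))).Nonempty := by
  obtain ⟨p, hp⟩ := hV
  rw [interior_convexHull_nonempty_iff_affineSpan_eq_top,
    AffineSubspace.affineSpan_eq_top_iff_vectorSpan_eq_top_of_nonempty ℝ E E ⟨p, hp⟩]
  have hface : faceVertices V b p Finset.univ = V := by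
    ext q
    simp [mem_faceVertices]
  apply Submodule.eq_top_of_finrank_eq
  rw [← hface, h.finrank_vectorSpan_faceVertices hp, Finset.card_univ,
    finrank_eq_card_basis (b p)]

theorem isSimpleVertexSet_of_tangentCone_eq {E ι : Type*} [AddCommGroup E] [Module ℝ E]
    [Fintype ι] {V : Finset E} {b : E → Basis ι ℝ E}
    (htangent : ∀ p ∈ V,
      {y : E | ∃ r : ℝ, 0 ≤ r ∧ ∃ x ∈ convexHull ℝ (V : Set E), y = p + r • (x - p)} =
        {y : E | ∃ c : ι → ℝ, (∀ i, 0 ≤ c i) ∧ y = p + ∑ i, c i • b p i}) :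
    IsSimpleVertexSet V b where
  repr_nonneg p hp q hq i := by
    have hmem : q ∈ {y : E | ∃ c : ι → ℝ, (∀ i, 0 ≤ c i) ∧ y = p + ∑ i, c i • b p i} := by
      rw [← htangent p hp]
      exact ⟨1, zero_le_one, q, subset_convexHull ℝ _ hq, by simp⟩
    obtain ⟨c, hc, hq⟩ := hmem
    rw [hq, add_sub_cancel_left, (b p).repr_sum_self]
    exact hc i
  exists_edge_eq p hp i := by
    classical
    have hmem : p + b p i ∈ {y : E | ∃ r : ℝ, 0 ≤ r ∧
        ∃ x ∈ convexHull ℝ (V : Set E), y = p + r • (x - p)} := by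
      rw [htangent p hp]
      refine ⟨Pi.single i 1, fun j => ?_, ?_⟩
      · by_cases hj : j = i
        · subst hj; simp
        · simp [hj]
      · simp [Pi.single_apply]
    obtain ⟨r, hr, x, hx, hy⟩ := hmem
    obtain ⟨μ, hμ, hμ1, rfl⟩ := Finset.mem_convexHull'.1 hx
    refine ⟨fun q => r * μ q, fun q hq => mul_nonneg hr (hμ q hq), ?_⟩
    rw [add_left_cancel hy]
    simp only [mul_smul, ← Finset.smul_sum, smul_sub, Finset.sum_sub_distrib,
      ← Finset.sum_smul, hμ1, one_smul]

theorem signed_indicator_eq_polarTerm {E ι : Type*} [AddCommGroup E] [Module ℝ E] [Fintype ι]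
    (b : E → Basis ι ℝ E) (ξ : Module.Dual ℝ E) {p : E} (hξ : ∀ i, ξ (b p i) ≠ 0)
    (v : E) (t : ℝ) :
    (-1 : ℝ) ^ Nat.card {i : ι // 0 < ξ (b p i)} *
      Set.indicator
        {z : E × ℝ | ∃ c : ι → ℝ,
          (∀ i, 0 < ξ (b p i) → 0 < c i) ∧
          (∀ i, ξ (b p i) < 0 → c i ≤ 0) ∧
          ∃ s : ℝ, z = ((p + ∑ i, c i • b p i, (1 : ℝ)) + s • (p, (1 : ℝ)))}
        (fun _ => (1 : ℝ)) (v, t) = polarTerm b ξ v t p := by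
  classical
  have hmem : (v, t) ∈ {z : E × ℝ | ∃ c : ι → ℝ,
          (∀ i, 0 < ξ (b p i) → 0 < c i) ∧
          (∀ i, ξ (b p i) < 0 → c i ≤ 0) ∧
          ∃ s : ℝ, z = ((p + ∑ i, c i • b p i, (1 : ℝ)) + s • (p, (1 : ℝ)))} ↔
      ∀ i ∈ Finset.univ, (0 < ξ (b p i) ↔ (b p).repr (t • p - v) i < 0) := by
    constructor
    · rintro ⟨c, hpos, hneg, s, hz⟩ i -
      obtain ⟨rfl, rfl⟩ := Prod.mk.inj hz
      have hrepr : (b p).repr ((1 + s) • p - (p + ∑ i, c i • b p i + s • p)) i = -c i := by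
        have : (1 + s) • p - (p + ∑ i, c i • b p i + s • p) = -∑ i, c i • b p i := by
          rw [add_smul, one_smul]; abel
        rw [this, map_neg, Finsupp.neg_apply, (b p).repr_sum_self]
      simp only [Prod.smul_mk, smul_eq_mul, mul_one] at *
      rw [hrepr, neg_lt_zero]
      refine ⟨hpos i, fun hc => ?_⟩
      by_contra hle
      exact (hneg i (lt_of_le_of_ne (not_lt.1 hle) (hξ i))).not_gt hc
    · intro hall
      refine ⟨fun i => -(b p).repr (t • p - v) i, fun i hi => ?_, fun i hi => ?_, t - 1, ?_⟩
      · simpa only [neg_pos] using (hall i (Finset.mem_univ i)).1 hi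
      · have := mt (hall i (Finset.mem_univ i)).2 hi.not_gt
        simpa only [neg_nonpos, not_lt] using this
      · simp only [neg_smul, Finset.sum_neg_distrib, (b p).sum_repr]
        ext
        · rw [Prod.fst_add, Prod.smul_fst, sub_smul, one_smul]
          change v = p + -(t • p - v) + (t • p - p)
          abel
        · simp
  have hsign : (-1 : ℝ) ^ Nat.card {i : ι // 0 < ξ (b p i)} =
      ∏ i, if 0 < ξ (b p i) then -1 else 1 := by
    rw [Finset.prod_ite]
    simp [Nat.card_eq_fintype_card, Fintype.card_subtype]
  have hind : ∀ (s : Set (E × ℝ)) (Q : ι → Prop),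
      ((v, t) ∈ s ↔ ∀ i ∈ Finset.univ, Q i) →
      Set.indicator s (fun _ => (1 : ℝ)) (v, t) = ∏ i, if Q i then 1 else 0 := by
    intro s Q hs
    rw [Finset.prod_ite_zero, Set.indicator_apply]
    simp only [hs, Finset.prod_const_one]
  rw [hsign, hind _ _ hmem, ← Finset.prod_mul_distrib]
  refine Finset.prod_congr rfl fun i _ => ?_
  by_cases h1 : 0 < ξ (b p i) <;> by_cases h2 : (b p).repr (t • p - v) i < 0
  · rw [if_pos h1, if_pos (iff_of_true h1 h2), if_pos h1, if_neg h2.not_ge]; simp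
  · rw [if_pos h1, if_neg (by tauto), if_pos h1, if_pos (not_lt.1 h2)]; simp
  · rw [if_neg h1, if_neg (by tauto), if_neg h1, if_neg h2.not_ge]; simp
  · rw [if_neg h1, if_pos (by tauto), if_neg h1, if_pos (not_lt.1 h2)]; simp

theorem repr_nonneg_of_mem_coneOverPolytope {E ι : Type*} [AddCommGroup E] [Module ℝ E]
    {V : Finset E} {b : E → Basis ι ℝ E} (h : IsSimpleVertexSet V b) {x : E × ℝ}
    (hx : x ∈ coneOverPolytope (convexHull ℝ (V : Set E))) {p : E} (hp : p ∈ V) (i : ι) :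
    0 ≤ (b p).repr (x.1 - x.2 • p) i := by
  obtain ⟨r, hr, η, hη, rfl⟩ := hx
  have := mul_nonneg hr (h.repr_nonneg_of_mem_convexHull hp hη i)
  simp only [Prod.smul_mk, smul_eq_mul, mul_one, ← smul_sub]
  rwa [map_smul, Finsupp.smul_apply, smul_eq_mul]

theorem snd_nonneg_of_mem_coneOverPolytope {E : Type*} [AddCommGroup E] [Module ℝ E]
    {P : Set E} {x : E × ℝ} (hx : x ∈ coneOverPolytope P) : 0 ≤ x.2 := by
  obtain ⟨r, hr, η, hη, rfl⟩ := hx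
  simpa using hr

theorem mem_coneOverPolytope_of_pos {E : Type*} [AddCommGroup E] [Module ℝ E]
    {P : Set E} {v : E} {t : ℝ} (ht : 0 < t) (hv : t⁻¹ • v ∈ P) :
    (v, t) ∈ coneOverPolytope P :=
  ⟨t, ht.le, _, hv, by simp [smul_smul, ht.ne']⟩

theorem exists_sub_smul_mem_of_mem_interior {F : Type*} [NormedAddCommGroup F]
    [NormedSpace ℝ F] {s : Set F} {x : F} (hx : x ∈ interior s) (d : F) :
    ∃ ε : ℝ, 0 < ε ∧ x - ε • d ∈ s := by
  have hc : Continuous fun ε : ℝ => x - ε • d := by fun_prop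
  have hev : ∀ᶠ ε : ℝ in nhdsWithin 0 (Set.Ioi 0), x - ε • d ∈ s :=
    ((hc.tendsto 0).mono_left nhdsWithin_le_nhds).eventually_mem (by
      simpa using mem_interior_iff_mem_nhds.1 hx)
  have hpos : ∀ᶠ ε : ℝ in nhdsWithin 0 (Set.Ioi 0), 0 < ε := self_mem_nhdsWithin
  exact (hpos.and hev).exists

theorem snd_pos_of_mem_interior_coneOverPolytope {E : Type*} [NormedAddCommGroup E]
    [NormedSpace ℝ E] {P : Set E} {x : E × ℝ} (hx : x ∈ interior (coneOverPolytope P)) :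
    0 < x.2 := by
  obtain ⟨ε, hε, hmem⟩ := exists_sub_smul_mem_of_mem_interior hx (0, 1)
  have := snd_nonneg_of_mem_coneOverPolytope hmem
  simp at this
  linarith

theorem repr_pos_of_mem_interior_coneOverPolytope {E ι : Type*} [NormedAddCommGroup E]
    [NormedSpace ℝ E] {V : Finset E} {b : E → Basis ι ℝ E} (h : IsSimpleVertexSet V b)
    {x : E × ℝ} (hx : x ∈ interior (coneOverPolytope (convexHull ℝ (V : Set E)))) {p : E}
    (hp : p ∈ V) (i : ι) : 0 < (b p).repr (x.1 - x.2 • p) i := by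
  obtain ⟨ε, hε, hmem⟩ := exists_sub_smul_mem_of_mem_interior hx (b p i, 0)
  have := repr_nonneg_of_mem_coneOverPolytope h hmem hp i
  simp at this ⊢
  linarith

theorem mem_interior_coneOverPolytope {E : Type*} [NormedAddCommGroup E]
    [NormedSpace ℝ E] {P : Set E} {v : E} {t : ℝ} (ht : 0 < t)
    (hv : t⁻¹ • v ∈ interior P) : (v, t) ∈ interior (coneOverPolytope P) := by
  rw [mem_interior_iff_mem_nhds] at hv ⊢
  have hc : ContinuousAt (fun z : E × ℝ => z.2⁻¹ • z.1) (v, t) :=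
    (continuousAt_snd.inv₀ ht.ne').smul continuousAt_fst
  filter_upwards [hc.eventually_mem hv, continuousAt_snd.eventually (lt_mem_nhds ht)]
    with z hz hz0 using mem_coneOverPolytope_of_pos hz0 hz

/-- A point outside `C°` and `-C` is separated from the vertices, in the form required by
`IsSimpleVertexSet.sum_polarTerm_eq_zero`. -/
theorem exists_dual_separating {E ι : Type*} [NormedAddCommGroup E] [NormedSpace ℝ E]
    [FiniteDimensional ℝ E] [Fintype ι] {V : Finset E} {b : E → Basis ι ℝ E}
    (h : IsSimpleVertexSet V b) (hV : V.Nonempty) {v : E} {t : ℝ}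
    (hint : (v, t) ∉ interior (coneOverPolytope (convexHull ℝ (V : Set E))))
    (hneg : (v, t) ∉ -coneOverPolytope (convexHull ℝ (V : Set E))) :
    ∃ f : Module.Dual ℝ E, (∀ p ∈ V, 0 < f (t • p - v)) ∨
      (0 < t ∧ f ≠ 0 ∧ ∀ p ∈ V, 0 ≤ f (t • p - v)) := by
  have hVP : (V : Set E) ⊆ convexHull ℝ (V : Set E) := subset_convexHull ℝ _
  rw [Set.mem_neg] at hneg
  rcases lt_trichotomy t 0 with ht | rfl | ht
  · have hy : t⁻¹ • v ∉ convexHull ℝ (V : Set E) := fun hy =>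
      hneg (mem_coneOverPolytope_of_pos (neg_pos.2 ht) (by simpa [inv_neg] using hy))
    obtain ⟨f, u, hfP, hfy⟩ := geometric_hahn_banach_closed_point (convex_convexHull ℝ _)
      (V.finite_toSet.isClosed_convexHull ℝ) hy
    refine ⟨f, Or.inl fun p hp => ?_⟩
    have hlt := (hfP p (hVP hp)).trans hfy
    have heq : t • p - v = t • (p - t⁻¹ • v) := by
      rw [smul_sub, smul_smul, mul_inv_cancel₀ ht.ne, one_smul]
    rw [heq, map_smul, smul_eq_mul]
    refine mul_pos_of_neg_of_neg ht ?_
    rw [map_sub, sub_neg]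
    exact hlt
  · have hv : v ≠ 0 := by
      rintro rfl
      obtain ⟨p, hp⟩ := hV
      exact hneg ⟨0, le_rfl, p, hVP hp, by simp⟩
    obtain ⟨f, hf⟩ : ∃ f : Module.Dual ℝ E, f v ≠ 0 := by
      by_contra! hall
      exact hv ((Module.forall_dual_apply_eq_zero_iff ℝ v).1 hall)
    refine ⟨-(f v) • f, Or.inl fun p _ => ?_⟩
    simpa using mul_self_pos.2 hf
  · have hy : t⁻¹ • v ∉ interior (convexHull ℝ (V : Set E)) := fun hy =>
      hint (mem_interior_coneOverPolytope ht hy)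
    obtain ⟨f, hf⟩ := geometric_hahn_banach_open_point (convex_convexHull ℝ _).interior
      isOpen_interior hy
    obtain ⟨a, ha⟩ := h.interior_convexHull_nonempty hV
    refine ⟨-f, Or.inr ⟨ht, fun hzero => ?_, fun p hp => ?_⟩⟩
    · have hfa := hf a ha
      have h0 : ∀ z, f z = 0 := fun z => by simpa using LinearMap.congr_fun hzero z
      simp [h0] at hfa
    · have hclosure : p ∈ closure (interior (convexHull ℝ (V : Set E))) := by
        rw [(convex_convexHull ℝ _).closure_interior_eq_closure_of_nonempty_interior ⟨a, ha⟩]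
        exact subset_closure (hVP hp)
      have hle : f p ≤ f (t⁻¹ • v) :=
        closure_minimal (fun z hz => (hf z hz).le)
          (isClosed_le f.continuous continuous_const) hclosure
      have heq : t • p - v = t • (p - t⁻¹ • v) := by
        rw [smul_sub, smul_smul, mul_inv_cancel₀ ht.ne', one_smul]
      rw [heq, map_smul, smul_eq_mul]
      refine mul_nonneg ht.le ?_
      rw [LinearMap.neg_apply, map_sub, neg_sub, sub_nonneg]
      exact hle

/-- **Dual polar decomposition of the cone over a polytope.**  For a simple
convex polytope `P` with polarizing vector `ξ`, vertex set `Vert`, and for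
every `x ∈ V* × ℝ`:
`Σ_{p ∈ Vert} (−1)^{|E_p^+(ξ)|} 1_{Ǩ_p^#(ξ)}(x) = (−1)^n · 1_{C°}(x) + 1_{−C}(x)`,
where `Ǩ_p^#(ξ) = (Č_p^#(ξ) × {1}) + ℝ μ_p` with `μ_p = (p, 1)`.
`E` plays the role of the dual space `V*`, and `ξ ∈ V` is represented by the
functional `ξ : Module.Dual ℝ E` (via `V ≅ V**`), so `⟨w, ξ⟩` becomes `ξ w`. -/
theorem dual_polar_decomposition_cone_over_polytope
    {E : Type*} [NormedAddCommGroup E] [NormedSpace ℝ E] [FiniteDimensional ℝ E]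
    {n : ℕ} (hdim : finrank ℝ E = n)
    (P : Set E) (Vert : Finset E) (w : E → Fin n → E)
    (hPcompact : IsCompact P)
    (hPhull : P = convexHull ℝ (Vert : Set E))
    (hindep : ∀ p ∈ Vert, LinearIndependent ℝ (w p))
    (hspan : ∀ p ∈ Vert, Submodule.span ℝ (Set.range (w p)) = ⊤)
    (htangent : ∀ p ∈ Vert,
      {y : E | ∃ r : ℝ, 0 ≤ r ∧ ∃ x ∈ P, y = p + r • (x - p)} =
        {y : E | ∃ c : Fin n → ℝ, (∀ i, 0 ≤ c i) ∧ y = p + ∑ i, c i • w p i})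
    (ξ : Module.Dual ℝ E)
    (hpol : ∀ p ∈ Vert, ∀ i, ξ (w p i) ≠ 0)
    (x : E × ℝ) :
    ∑ p ∈ Vert,
        (-1 : ℝ) ^ Nat.card {i : Fin n // 0 < ξ (w p i)} *
          Set.indicator
            {z : E × ℝ | ∃ c : Fin n → ℝ,
              (∀ i, 0 < ξ (w p i) → 0 < c i) ∧
              (∀ i, ξ (w p i) < 0 → c i ≤ 0) ∧
              ∃ s : ℝ, z = ((p + ∑ i, c i • w p i, (1 : ℝ)) + s • (p, (1 : ℝ)))}
            (fun _ => (1 : ℝ)) x =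
      (-1 : ℝ) ^ n *
          Set.indicator (interior (coneOverPolytope P)) (fun _ => (1 : ℝ)) x +
        Set.indicator (-(coneOverPolytope P)) (fun _ => (1 : ℝ)) x := by
  subst hPhull
  rcases Vert.eq_empty_or_nonempty with rfl | hV
  · have hC : coneOverPolytope (convexHull ℝ ((∅ : Finset E) : Set E)) = ∅ := by
      simp [coneOverPolytope]
    rw [hC]
    simp
  classical
  let b : E → Basis (Fin n) ℝ E := fun p =>
    if hp : p ∈ Vert then Basis.mk (hindep p hp) (hspan p hp).ge
    else finBasisOfFinrankEq ℝ E hdim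
  have hw : ∀ p ∈ Vert, w p = b p := fun p hp => by simp [b, hp]
  have h : IsSimpleVertexSet Vert b := isSimpleVertexSet_of_tangentCone_eq fun p hp => by
    rw [htangent p hp, hw p hp]
  have hξ : ∀ p ∈ Vert, ∀ i, ξ (b p i) ≠ 0 := fun p hp i => hw p hp ▸ hpol p hp i
  obtain ⟨v, t⟩ := x
  rw [Finset.sum_congr rfl (g := fun p => polarTerm b ξ v t p) fun p hp => by
    rw [hw p hp, signed_indicator_eq_polarTerm b ξ (hξ p hp) v t]]
  by_cases hneg : (v, t) ∈ -coneOverPolytope (convexHull ℝ (Vert : Set E))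
  · have hint : (v, t) ∉ interior (coneOverPolytope (convexHull ℝ (Vert : Set E))) := fun hint => by
      have h1 := snd_pos_of_mem_interior_coneOverPolytope hint
      have h2 := snd_nonneg_of_mem_coneOverPolytope (Set.mem_neg.1 hneg)
      simp at h1 h2
      linarith
    rw [Set.indicator_of_notMem hint, Set.indicator_of_mem hneg, mul_zero, zero_add]
    refine h.sum_polarTerm_of_nonneg hV hξ fun p hp i => ?_
    have := repr_nonneg_of_mem_coneOverPolytope h (Set.mem_neg.1 hneg) hp i
    rwa [Prod.fst_neg, Prod.snd_neg, neg_smul, neg_sub_neg] at this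
  rw [Set.indicator_of_notMem hneg, add_zero]
  by_cases hint : (v, t) ∈ interior (coneOverPolytope (convexHull ℝ (Vert : Set E)))
  · rw [Set.indicator_of_mem hint, mul_one, h.sum_polarTerm_of_neg hV hξ, Fintype.card_fin]
    intro p hp i
    have := repr_pos_of_mem_interior_coneOverPolytope h hint hp i
    rw [← neg_sub, map_neg, Finsupp.neg_apply]
    exact neg_lt_zero.2 this
  · rw [Set.indicator_of_notMem hint, mul_zero]
    obtain ⟨f, hf⟩ := exists_dual_separating h hV hint hneg
    exact h.sum_polarTerm_eq_zero hξ hf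
end
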